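/- arXiv:2302.05497 — 2 statements merged into one kernel-verified Lean document; each statement's English description precedes it below -/
import Mathlib

section
/- For every u ∈ Σ there exists exactly one continuous path ζ : [0,∞) → Σ with ζ_0 = u that satisfies both condition (A) and condition (B). -/
open Finset

section ZRP

variable {V : Type*} [Fintype V] [DecidableEq V]

/-- Irreducibility of a set of transition rates. -/
def IrreducibleRates (r : V → V → ℝ) : Prop :=
  ∀ i j : V, i ≠ j → ∃ (m : ℕ) (k : ℕ → V), k 0 = i ∧ k m = j ∧ ∀ l < m, 0 < r (k l) (k (l + 1))

/-- `ind A j` plays the role of the vector `1^A_j`: it equals the indicator of `{j}` on `A`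
and is harmonic (for the generator of `r`) at every point outside `A`. -/
def IsHarmFamily (r : V → V → ℝ) (ind : Finset V → V → V → ℝ) : Prop :=
  ∀ (A : Finset V), ∀ j ∈ A,
    (∀ i ∈ A, ind A j i = if i = j then (1 : ℝ) else 0) ∧
    (∀ k, k ∉ A → ∑ l, r k l * (ind A j l - ind A j k) = 0)

/-- The trace rates `r^A(i,j) = r(i,j) + ∑_{k∉A} r(i,k)·1^A_j(k)` (for `i ≠ j`). -/
noncomputable def traceRate (r : V → V → ℝ) (ind : Finset V → V → V → ℝ)
    (A : Finset V) (i j : V) : ℝ :=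
  if i = j then 0 else r i j + ∑ k ∈ Aᶜ, r i k * ind A j k

/-- `λ^A(i) = ∑_{j∈A} (r^A(j,i) − r^A(i,j))`. -/
noncomputable def lamA (r : V → V → ℝ) (ind : Finset V → V → V → ℝ)
    (A : Finset V) (i : V) : ℝ :=
  ∑ j ∈ A, (traceRate r ind A j i - traceRate r ind A i j)

/-- `A` is `r`-absorbing if `A = V` or `λ^{A∪{j}}(j) ≤ 0` for every `j ∉ A`. -/
def IsAbsorbing (r : V → V → ℝ) (ind : Finset V → V → V → ℝ) (A : Finset V) : Prop :=
  A = Finset.univ ∨ ∀ j ∉ A, lamA r ind (insert j A) j ≤ 0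

/-- The support `𝒮(u) = {i : u i > 0}`. -/
noncomputable def suppF (u : V → ℝ) : Finset V :=
  open scoped Classical in Finset.univ.filter (fun i => 0 < u i)

/-- `𝒜(S)`: the intersection of all `r`-absorbing subsets of `V` containing `S`. -/
noncomputable def minAbs (r : V → V → ℝ) (ind : Finset V → V → V → ℝ) (S : Finset V) :
    Finset V :=
  open scoped Classical in
  Finset.univ.filter (fun i => ∀ A : Finset V, IsAbsorbing r ind A → S ⊆ A → i ∈ A)

/-- The vector `v_i = ∑_k r(i,k)(1_{k} − 1_{i})`. -/
noncomputable def vvec (r : V → V → ℝ) (i : V) : V → ℝ :=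
  fun l => ∑ k, r i k * ((if l = k then (1 : ℝ) else 0) - (if l = i then (1 : ℝ) else 0))

/-- The vector `λ(j) = ∑_i (r(i,j) − r(j,i))`. -/
noncomputable def lamV (r : V → V → ℝ) : V → ℝ := fun j => ∑ i, (r i j - r j i)

/-- Membership in `D_B`: `f` is `C¹` on an open set containing the simplex and
`⟨∇f(u), v_i⟩ = 0` whenever `u ∈ Σ`, `u i = 0`, for every `i ∈ B`. -/
def MemD (r : V → V → ℝ) (B : Finset V) (f : (V → ℝ) → ℝ) : Prop :=
  (∃ U : Set (V → ℝ), IsOpen U ∧ stdSimplex ℝ V ⊆ U ∧ ContDiffOn ℝ 1 f U) ∧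
  ∀ i ∈ B, ∀ u ∈ stdSimplex ℝ V, u i = 0 → fderiv ℝ f u (vvec r i) = 0

/-- Condition (A). -/
def CondA (r : V → V → ℝ) (ζ : ℝ → V → ℝ) : Prop :=
  ∀ f : (V → ℝ) → ℝ, MemD r Finset.univ f → ∀ t : ℝ, 0 ≤ t →
    f (ζ t) = f (ζ 0) + ∫ s in (0:ℝ)..t, fderiv ℝ f (ζ s) (lamV r)

/-- A continuous path in the simplex (for nonnegative times). -/
def IsPath (ζ : ℝ → V → ℝ) : Prop :=
  ContinuousOn ζ (Set.Ici 0) ∧ ∀ t : ℝ, 0 ≤ t → ζ t ∈ stdSimplex ℝ V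

/-- `Σ_abs`: the configurations whose support is `r`-absorbing. -/
def SigmaAbs (r : V → V → ℝ) (ind : Finset V → V → V → ℝ) : Set (V → ℝ) :=
  {u | u ∈ stdSimplex ℝ V ∧ IsAbsorbing r ind (suppF u)}

/-- Condition (B): `inf{t ≥ 0 : ζ_t ∈ Σ_abs} = 0`. -/
def CondB (r : V → V → ℝ) (ind : Finset V → V → V → ℝ) (ζ : ℝ → V → ℝ) : Prop :=
  ∀ ε : ℝ, 0 < ε → ∃ t : ℝ, 0 ≤ t ∧ t < ε ∧ ζ t ∈ SigmaAbs r ind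

end ZRP

section Flow

variable {V : Type*} [Fintype V]

/-- The generator `L w`. -/
def gen (r : V → V → ℝ) (w : V → ℝ) (i : V) : ℝ := ∑ k, r i k * (w k - w i)

/-- The adjoint of the generator: net flow into `i` when site `j` is served at rate `σ j`. -/
def flow (r : V → V → ℝ) (σ : V → ℝ) (i : V) : ℝ := ∑ j, (σ j * r j i - σ i * r i j)

lemma flow_sub (r : V → V → ℝ) (σ τ : V → ℝ) (i : V) :
    flow r (σ - τ) i = flow r σ i - flow r τ i := by
  simp only [flow, ← Finset.sum_sub_distrib, Pi.sub_apply]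
  exact Finset.sum_congr rfl fun j _ => by ring

lemma gen_sub (r : V → V → ℝ) (w z : V → ℝ) (i : V) :
    gen r (w - z) i = gen r w i - gen r z i := by
  simp only [gen, ← Finset.sum_sub_distrib, Pi.sub_apply]
  exact Finset.sum_congr rfl fun j _ => by ring

lemma gen_add (r : V → V → ℝ) (w z : V → ℝ) (i : V) :
    gen r (w + z) i = gen r w i + gen r z i := by
  simp only [gen, ← Finset.sum_add_distrib, Pi.add_apply]
  exact Finset.sum_congr rfl fun j _ => by ring

lemma gen_smul (r : V → V → ℝ) (c : ℝ) (w : V → ℝ) (i : V) :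
    gen r (c • w) i = c * gen r w i := by
  simp only [gen, Finset.mul_sum, Pi.smul_apply, smul_eq_mul]
  exact Finset.sum_congr rfl fun j _ => by ring

lemma gen_sum {ι : Type*} (r : V → V → ℝ) (s : Finset ι) (w : ι → V → ℝ) (i : V) :
    gen r (∑ j ∈ s, w j) i = ∑ j ∈ s, gen r (w j) i := by
  simp only [gen, Finset.sum_apply]
  rw [Finset.sum_comm]
  refine Finset.sum_congr rfl fun k _ => ?_
  rw [← Finset.sum_sub_distrib, Finset.mul_sum]

lemma sum_flow_mul (r : V → V → ℝ) (σ w : V → ℝ) :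
    ∑ i, flow r σ i * w i = ∑ j, σ j * gen r w j := by
  simp only [flow, gen, Finset.sum_mul, Finset.mul_sum, sub_mul, mul_sub, Finset.sum_sub_distrib]
  rw [Finset.sum_comm]
  congr 1
  · exact Finset.sum_congr rfl fun i _ => Finset.sum_congr rfl fun j _ => by ring
  · exact Finset.sum_congr rfl fun i _ => Finset.sum_congr rfl fun j _ => by ring

variable [DecidableEq V]

lemma sum_flow (r : V → V → ℝ) (σ : V → ℝ) (N : Finset V) :
    ∑ i ∈ N, flow r σ i =
      ∑ i ∈ N, ∑ j ∈ Nᶜ, σ j * r j i - ∑ i ∈ N, ∑ j ∈ Nᶜ, σ i * r i j := by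
  have h : ∀ i, flow r σ i = ((∑ j ∈ N, σ j * r j i) - ∑ j ∈ N, σ i * r i j) +
      ((∑ j ∈ Nᶜ, σ j * r j i) - ∑ j ∈ Nᶜ, σ i * r i j) := by
    intro i
    rw [flow, Finset.sum_sub_distrib, ← Finset.sum_add_sum_compl N (fun j => σ j * r j i),
      ← Finset.sum_add_sum_compl N (fun j => σ i * r i j)]
    ring
  simp only [h, Finset.sum_add_distrib, Finset.sum_sub_distrib]
  rw [Finset.sum_comm (s := N) (t := N)]
  ring

lemma sum_flow_univ (r : V → V → ℝ) (σ : V → ℝ) : ∑ i, flow r σ i = 0 := by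
  rw [sum_flow]; simp

lemma eq_univ_of_no_exit {r : V → V → ℝ} (hirr : IrreducibleRates r) {N : Finset V}
    (hN : N.Nonempty) (h : ∀ i ∈ N, ∀ j ∉ N, r i j = 0) : N = Finset.univ := by
  obtain ⟨i, hi⟩ := hN
  refine Finset.eq_univ_iff_forall.2 fun j => ?_
  by_contra hj
  obtain ⟨m, k, h0, hm, hk⟩ := hirr i j (by rintro rfl; exact hj hi)
  have : ∀ l ≤ m, k l ∈ N := by
    intro l
    induction l with
    | zero => intro _; rwa [h0]
    | succ l ih =>
      intro hl
      by_contra hc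
      exact (hk l (by omega)).ne' (h _ (ih (by omega)) _ hc)
  exact hj (hm ▸ this m le_rfl)

/-- Minimum principle for the adjoint generator. -/
lemma nonneg_of_flow_nonpos {r : V → V → ℝ} (hr : ∀ i j, 0 ≤ r i j)
    (hirr : IrreducibleRates r) {B : Finset V} (hB : B.Nonempty) {σ : V → ℝ}
    (h1 : ∀ i ∈ B, 0 ≤ σ i) (h2 : ∀ i ∉ B, flow r σ i ≤ 0) (i : V) : 0 ≤ σ i := by
  set N : Finset V := Finset.univ.filter fun i => σ i < 0 with hNdef
  have hmem : ∀ i, i ∈ N ↔ σ i < 0 := by simp [hNdef]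
  by_contra hi
  have hNne : N.Nonempty := ⟨i, (hmem i).2 (not_le.1 hi)⟩
  have hle : ∑ i ∈ N, flow r σ i ≤ 0 := Finset.sum_nonpos fun i hi => h2 i fun hiB =>
    absurd (h1 i hiB) (not_le.2 ((hmem i).1 hi))
  have hin : 0 ≤ ∑ i ∈ N, ∑ j ∈ Nᶜ, σ j * r j i :=
    Finset.sum_nonneg fun i _ => Finset.sum_nonneg fun j hj => mul_nonneg
      (not_lt.1 fun h => (Finset.mem_compl.1 hj) ((hmem j).2 h)) (hr _ _)
  have hterm : ∀ i ∈ N, ∀ j ∈ Nᶜ, 0 ≤ -(σ i * r i j) := fun i hi j _ => by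
    have := mul_nonneg (neg_nonneg.2 ((hmem i).1 hi).le) (hr i j)
    linarith
  have hout : ∑ i ∈ N, ∑ j ∈ Nᶜ, -(σ i * r i j) = 0 := by
    refine le_antisymm ?_ (Finset.sum_nonneg fun i hi => Finset.sum_nonneg (hterm i hi))
    simp only [Finset.sum_neg_distrib]
    rw [sum_flow] at hle
    linarith
  have hz : ∀ i ∈ N, ∀ j ∉ N, r i j = 0 := by
    intro i hi j hj
    have h3 := (Finset.sum_eq_zero_iff_of_nonneg
      fun i hi => Finset.sum_nonneg (hterm i hi)).1 hout i hi
    have h4 := (Finset.sum_eq_zero_iff_of_nonneg (hterm i hi)).1 h3 j (Finset.mem_compl.2 hj)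
    rcases mul_eq_zero.1 (neg_eq_zero.1 h4) with h | h
    · exact absurd h ((hmem i).1 hi).ne
    · exact h
  obtain ⟨b, hb⟩ := hB
  have := eq_univ_of_no_exit hirr hNne hz
  have hbN : b ∈ N := this ▸ Finset.mem_univ b
  exact absurd (h1 b hb) (not_le.2 ((hmem b).1 hbN))

/-- Minimum principle for the generator. -/
lemma nonneg_of_gen_nonpos {r : V → V → ℝ} (hr : ∀ i j, 0 ≤ r i j)
    (hirr : IrreducibleRates r) {B : Finset V} (hB : B.Nonempty) {w : V → ℝ}
    (h1 : ∀ i ∈ B, 0 ≤ w i) (h2 : ∀ i ∉ B, gen r w i ≤ 0) (i : V) : 0 ≤ w i := by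
  obtain ⟨m, -, hm⟩ := Finset.exists_min_image Finset.univ w ⟨i, Finset.mem_univ i⟩
  by_contra hi
  have hmneg : w m < 0 := lt_of_le_of_lt (hm i (Finset.mem_univ i)) (not_le.1 hi)
  set N : Finset V := Finset.univ.filter fun i => w i = w m with hNdef
  have hmem : ∀ i, i ∈ N ↔ w i = w m := by simp [hNdef]
  have hz : ∀ i ∈ N, ∀ j ∉ N, r i j = 0 := by
    intro i hi j hj
    have hterm : ∀ k ∈ Finset.univ, 0 ≤ r i k * (w k - w i) := fun k hk =>
      mul_nonneg (hr _ _) (by rw [(hmem i).1 hi]; linarith [hm k hk])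
    have h0 : gen r w i = 0 := le_antisymm
      (h2 i fun hiB => absurd (h1 i hiB) (by rw [(hmem i).1 hi]; linarith))
      (Finset.sum_nonneg hterm)
    rcases mul_eq_zero.1 ((Finset.sum_eq_zero_iff_of_nonneg hterm).1 h0 j (Finset.mem_univ j))
      with h | h
    · exact h
    · exact absurd ((hmem j).2 (by rw [← (hmem i).1 hi]; linarith)) hj
  obtain ⟨b, hb⟩ := hB
  have := eq_univ_of_no_exit hirr ⟨m, (hmem m).2 rfl⟩ hz
  have hbN : b ∈ N := this ▸ Finset.mem_univ b
  have := (hmem b).1 hbN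
  linarith [h1 b hb]

lemma eq_of_gen_eq {r : V → V → ℝ} (hr : ∀ i j, 0 ≤ r i j)
    (hirr : IrreducibleRates r) {B : Finset V} (hB : B.Nonempty) {w z : V → ℝ}
    (h1 : ∀ i ∈ B, w i = z i) (h2 : ∀ i ∉ B, gen r w i = gen r z i) : w = z := by
  funext i
  have ha := nonneg_of_gen_nonpos hr hirr hB (w := w - z)
    (fun i hi => by simp [h1 i hi]) (fun i hi => by simp [gen_sub, h2 i hi]) i
  have hb := nonneg_of_gen_nonpos hr hirr hB (w := z - w)
    (fun i hi => by simp [h1 i hi]) (fun i hi => by simp [gen_sub, h2 i hi]) i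
  simp only [Pi.sub_apply] at ha hb
  linarith

lemma exists_flow_eq_zero {r : V → V → ℝ} (hr : ∀ i j, 0 ≤ r i j)
    (hirr : IrreducibleRates r) {A : Finset V} (hA : A.Nonempty) :
    ∃ ρ : V → ℝ, (∀ i ∈ A, ρ i = 1) ∧ ∀ i ∉ A, flow r ρ i = 0 := by
  let T : (V → ℝ) →ₗ[ℝ] (V → ℝ) :=
    { toFun := fun σ i => if i ∈ A then σ i else flow r σ i
      map_add' := fun σ τ => by
        funext i
        by_cases h : i ∈ A
        · simp [h]
        · simp only [h, if_false, Pi.add_apply, flow, ← Finset.sum_add_distrib]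
          exact Finset.sum_congr rfl fun j _ => by ring
      map_smul' := fun c σ => by
        funext i
        by_cases h : i ∈ A
        · simp [h]
        · simp only [h, if_false, Pi.smul_apply, flow, Finset.mul_sum, smul_eq_mul,
            RingHom.id_apply]
          exact Finset.sum_congr rfl fun j _ => by ring }
  have hle : ∀ σ, T σ = 0 → ∀ i, 0 ≤ σ i := fun σ hσ =>
    nonneg_of_flow_nonpos hr hirr hA
      (fun i hi => by have := congrFun hσ i; simp [T, hi] at this; exact this.ge)
      (fun i hi => by have := congrFun hσ i; simp [T, hi] at this; exact this.le)
  have hinj : Function.Injective T := by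
    refine (injective_iff_map_eq_zero T).2 fun σ hσ => ?_
    funext i
    have h1 := hle σ hσ i
    have h2 := hle (-σ) (by rw [map_neg, hσ, neg_zero]) i
    simp only [Pi.neg_apply, Pi.zero_apply] at *
    linarith
  obtain ⟨ρ, hρ⟩ := LinearMap.injective_iff_surjective.1 hinj fun i => if i ∈ A then 1 else 0
  refine ⟨ρ, fun i hi => ?_, fun i hi => ?_⟩
  · simpa [T, hi] using congrFun hρ i
  · simpa [T, hi] using congrFun hρ i

lemma exists_gen_eq {r : V → V → ℝ} (hr : ∀ i j, 0 ≤ r i j)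
    (hirr : IrreducibleRates r) {A : Finset V} (hA : A.Nonempty) (b : V → ℝ) :
    ∃ w : V → ℝ, (∀ i ∈ A, w i = b i) ∧ ∀ i ∉ A, gen r w i = b i := by
  let T : (V → ℝ) →ₗ[ℝ] (V → ℝ) :=
    { toFun := fun σ i => if i ∈ A then σ i else gen r σ i
      map_add' := fun σ τ => by
        funext i
        by_cases h : i ∈ A <;> simp [h, gen_add]
      map_smul' := fun c σ => by
        funext i
        by_cases h : i ∈ A <;> simp [h, gen_smul] }
  have hinj : Function.Injective T := fun w z hwz => eq_of_gen_eq hr hirr hA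
    (fun i hi => by simpa [T, hi] using congrFun hwz i)
    (fun i hi => by simpa [T, hi] using congrFun hwz i)
  obtain ⟨w, hw⟩ := LinearMap.injective_iff_surjective.1 hinj b
  refine ⟨w, fun i hi => ?_, fun i hi => ?_⟩
  · simpa [T, hi] using congrFun hw i
  · simpa [T, hi] using congrFun hw i

open scoped Classical in
/-- The service rates when exactly the sites of `A` are occupied: `1` on `A`, balanced off `A`. -/
noncomputable def serviceRate (r : V → V → ℝ) (A : Finset V) : V → ℝ :=
  if h : ∃ ρ : V → ℝ, (∀ i ∈ A, ρ i = 1) ∧ ∀ i ∉ A, flow r ρ i = 0 then h.choose else 0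

/-- The velocity of the path while its support is `A`. -/
noncomputable def velocity (r : V → V → ℝ) (A : Finset V) : V → ℝ := flow r (serviceRate r A)

section

variable {r : V → V → ℝ} (hr : ∀ i j, 0 ≤ r i j) (hirr : IrreducibleRates r)
include hr hirr

lemma serviceRate_of_mem {A : Finset V} {i : V} (hi : i ∈ A) : serviceRate r A i = 1 := by
  have h := exists_flow_eq_zero hr hirr ⟨i, hi⟩
  rw [serviceRate, dif_pos h]
  exact h.choose_spec.1 i hi

lemma velocity_of_notMem {A : Finset V} (hA : A.Nonempty) {i : V} (hi : i ∉ A) :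
    velocity r A i = 0 := by
  have h := exists_flow_eq_zero hr hirr hA
  rw [velocity, serviceRate, dif_pos h]
  exact h.choose_spec.2 i hi

lemma serviceRate_mono {A B : Finset V} (hA : A.Nonempty) (hAB : A ⊆ B)
    (h : ∀ i, serviceRate r A i ≤ 1) (i : V) : serviceRate r A i ≤ serviceRate r B i := by
  have := nonneg_of_flow_nonpos hr hirr (hA.mono hAB) (σ := serviceRate r B - serviceRate r A)
    (fun i hi => by simpa [serviceRate_of_mem hr hirr hi] using h i)
    (fun i hi => by
      rw [flow_sub]
      have h1 := velocity_of_notMem hr hirr (hA.mono hAB) hi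
      have h2 := velocity_of_notMem hr hirr hA (fun h => hi (hAB h))
      rw [velocity] at h1 h2
      rw [h1, h2, sub_zero]) i
  simpa using this

lemma sum_compl_velocity_nonpos {A B : Finset V} (hA : A.Nonempty) (hAB : A ⊆ B)
    (h : ∀ i, serviceRate r A i ≤ 1) : ∑ i ∈ Aᶜ, velocity r B i ≤ 0 := by
  have e : ∑ i ∈ Aᶜ, velocity r B i =
      ∑ i ∈ Aᶜ, flow r (serviceRate r B - serviceRate r A) i :=
    Finset.sum_congr rfl fun i hi => by
      have := velocity_of_notMem hr hirr hA (Finset.mem_compl.1 hi)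
      rw [flow_sub, ← velocity, ← velocity, this, sub_zero]
  rw [e, sum_flow, compl_compl]
  have h1 : ∑ i ∈ Aᶜ, ∑ j ∈ A, (serviceRate r B - serviceRate r A) j * r j i = 0 :=
    Finset.sum_eq_zero fun i _ => Finset.sum_eq_zero fun j hj => by
      simp [serviceRate_of_mem hr hirr hj, serviceRate_of_mem hr hirr (hAB hj)]
  have h2 : 0 ≤ ∑ i ∈ Aᶜ, ∑ j ∈ A, (serviceRate r B - serviceRate r A) i * r i j :=
    Finset.sum_nonneg fun i _ => Finset.sum_nonneg fun j _ => mul_nonneg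
      (by simpa using serviceRate_mono hr hirr hA hAB h i) (hr _ _)
  linarith

lemma serviceRate_le_one_of_subset {A B : Finset V} (hA : A.Nonempty) (hAB : A ⊆ B)
    (h : ∀ i, serviceRate r B i ≤ 1) (hv : ∀ i ∈ B, i ∉ A → velocity r B i ≤ 0) (i : V) :
    serviceRate r A i ≤ 1 := by
  have := nonneg_of_flow_nonpos hr hirr hA (σ := serviceRate r B - serviceRate r A)
    (fun i hi => by
      simp [serviceRate_of_mem hr hirr hi, serviceRate_of_mem hr hirr (hAB hi)])
    (fun i hi => by
      rw [flow_sub, ← velocity, ← velocity, velocity_of_notMem hr hirr hA hi, sub_zero]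
      by_cases hB : i ∈ B
      · exact hv i hB hi
      · exact (velocity_of_notMem hr hirr (hA.mono hAB) hB).le) i
  simp only [Pi.sub_apply] at this
  linarith [h i]

lemma subset_of_velocity_pos {S C D : Finset V} (hS : S.Nonempty) (hSC : S ⊆ C) (hSD : S ⊆ D)
    (hC : ∀ i, serviceRate r C i ≤ 1) (hD : ∀ i, serviceRate r D i ≤ 1)
    (hv : ∀ i ∈ C, i ∉ S → 0 < velocity r C i) : C ⊆ D := by
  set σ := serviceRate r C - serviceRate r D with hσ
  set Q : Finset V := Finset.univ.filter fun i => 0 < σ i ∨ (i ∈ C ∧ i ∉ D) with hQdef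
  have hQ : ∀ i, i ∈ Q ↔ (0 < σ i ∨ (i ∈ C ∧ i ∉ D)) := by simp [hQdef]
  have hQD : ∀ i ∈ Q, i ∉ D := by
    intro i hi hiD
    rcases (hQ i).1 hi with h | h
    · rw [hσ, Pi.sub_apply, serviceRate_of_mem hr hirr hiD] at h
      linarith [hC i]
    · exact h.2 hiD
  have hQ0 : ∀ i ∈ Q, 0 ≤ σ i := by
    intro i hi
    rcases (hQ i).1 hi with h | h
    · exact h.le
    · rw [hσ, Pi.sub_apply, serviceRate_of_mem hr hirr h.1]
      linarith [hD i]
  have hQ1 : ∀ i ∉ Q, σ i ≤ 0 := fun i hi => not_lt.1 fun h => hi ((hQ i).2 (Or.inl h))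
  have hfl : ∀ i ∈ Q, flow r σ i = velocity r C i := fun i hi => by
    rw [hσ, flow_sub, ← velocity, ← velocity,
      velocity_of_notMem hr hirr (hS.mono hSD) (hQD i hi), sub_zero]
  have hle : ∑ i ∈ Q, velocity r C i ≤ 0 := by
    rw [← Finset.sum_congr rfl hfl, sum_flow]
    have h1 : ∑ i ∈ Q, ∑ j ∈ Qᶜ, σ j * r j i ≤ 0 :=
      Finset.sum_nonpos fun i _ => Finset.sum_nonpos fun j hj =>
        mul_nonpos_of_nonpos_of_nonneg (hQ1 j (Finset.mem_compl.1 hj)) (hr _ _)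
    have h2 : 0 ≤ ∑ i ∈ Q, ∑ j ∈ Qᶜ, σ i * r i j :=
      Finset.sum_nonneg fun i hi => Finset.sum_nonneg fun j _ => mul_nonneg (hQ0 i hi) (hr _ _)
    linarith
  have hnn : ∀ i ∈ Q, 0 ≤ velocity r C i := by
    intro i hi
    by_cases hiC : i ∈ C
    · exact (hv i hiC fun h => hQD i hi (hSD h)).le
    · exact (velocity_of_notMem hr hirr (hS.mono hSC) hiC).ge
  intro i hiC
  by_contra hiD
  have hi : i ∈ Q := (hQ i).2 (Or.inr ⟨hiC, hiD⟩)
  have := Finset.single_le_sum hnn hi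
  linarith [hv i hiC fun h => hiD (hSD h)]

lemma sum_lamV_mul_harmonic {B : Finset V} {w : V → ℝ} (hw : ∀ i ∉ B, gen r w i = 0) :
    ∑ i, lamV r i * w i = ∑ i, velocity r B i * w i := by
  have h1 : ∀ i, lamV r i = flow r (fun _ => 1) i := fun i => by simp [lamV, flow]
  simp only [h1, velocity, sum_flow_mul]
  refine Finset.sum_congr rfl fun i _ => ?_
  by_cases hi : i ∈ B
  · rw [serviceRate_of_mem hr hirr hi]
  · simp [hw i hi]

lemma lamA_eq_velocity {ind : Finset V → V → V → ℝ} (hind : IsHarmFamily r ind)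
    {A : Finset V} {i : V} (hi : i ∈ A) : lamA r ind A i = velocity r A i := by
  have hA : A.Nonempty := ⟨i, hi⟩
  have hgen : ∀ j ∈ A, ∀ k ∉ A, gen r (ind A j) k = 0 := fun j hj k hk => (hind A j hj).2 k hk
  have hone : ∑ j ∈ A, ind A j = fun _ => 1 := by
    refine eq_of_gen_eq hr hirr hA (fun k hk => ?_) (fun k hk => ?_)
    · rw [Finset.sum_apply, Finset.sum_congr rfl fun j hj => (hind A j hj).1 k hk]
      simp [hk]
    · rw [gen_sum, Finset.sum_eq_zero fun j hj => hgen j hj k hk]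
      simp [gen]
  have htr : ∀ j ∈ A, ∀ k ∈ A, j ≠ k → traceRate r ind A j k = gen r (ind A k) j := by
    intro j hj k hk hjk
    rw [traceRate, if_neg hjk, gen, (hind A k hk).1 j hj, if_neg hjk,
      ← Finset.sum_add_sum_compl A]
    simp only [sub_zero]
    congr 1
    rw [Finset.sum_congr rfl fun l hl => by rw [(hind A k hk).1 l hl]]
    simp [hk]
  have hvel : velocity r A i = ∑ j ∈ A, gen r (ind A i) j := by
    have h1 : ∑ k, velocity r A k * ind A i k = velocity r A i := by
      rw [Finset.sum_eq_single i]
      · rw [(hind A i hi).1 i hi]; simp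
      · intro k _ hk
        by_cases hkA : k ∈ A
        · rw [(hind A i hi).1 k hkA]; simp [hk]
        · rw [velocity_of_notMem hr hirr hA hkA]; simp
      · simp
    rw [← h1]
    simp only [velocity, sum_flow_mul]
    rw [← Finset.sum_add_sum_compl A]
    rw [Finset.sum_congr rfl fun j hj => by rw [serviceRate_of_mem hr hirr hj, one_mul],
      Finset.sum_eq_zero (s := Aᶜ) fun j hj => by
        rw [hgen i hi j (Finset.mem_compl.1 hj), mul_zero],
      add_zero]
  have hself : gen r (ind A i) i = - ∑ j ∈ A.erase i, gen r (ind A j) i := by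
    have h0 : gen r (∑ j ∈ A, ind A j) i = 0 := by rw [hone]; simp [gen]
    rw [gen_sum, ← Finset.add_sum_erase A _ hi] at h0
    linarith
  rw [hvel, ← Finset.add_sum_erase A _ hi, hself, lamA, ← Finset.add_sum_erase A _ hi, sub_self,
    zero_add, Finset.sum_sub_distrib]
  rw [Finset.sum_congr rfl fun j hj => htr j (Finset.mem_of_mem_erase hj) i hi
      (Finset.ne_of_mem_erase hj),
    Finset.sum_congr (s₁ := A.erase i) rfl fun j hj => htr i hi j (Finset.mem_of_mem_erase hj)
      (Finset.ne_of_mem_erase hj).symm]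
  ring

lemma isAbsorbing_iff {ind : Finset V → V → V → ℝ} (hind : IsHarmFamily r ind)
    {A : Finset V} (hA : A.Nonempty) :
    IsAbsorbing r ind A ↔ ∀ i, serviceRate r A i ≤ 1 := by
  constructor
  · rintro (rfl | h) i
    · exact (serviceRate_of_mem hr hirr (Finset.mem_univ i)).le
    · by_cases hi : i ∈ A
      · exact (serviceRate_of_mem hr hirr hi).le
      have hv := h i hi
      rw [lamA_eq_velocity hr hirr hind (Finset.mem_insert_self i A)] at hv
      have := nonneg_of_flow_nonpos hr hirr hA
        (σ := serviceRate r (insert i A) - serviceRate r A)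
        (fun j hj => by
          simp [serviceRate_of_mem hr hirr hj,
            serviceRate_of_mem hr hirr (Finset.mem_insert_of_mem hj)])
        (fun j hj => by
          rw [flow_sub, ← velocity, ← velocity, velocity_of_notMem hr hirr hA hj, sub_zero]
          by_cases hji : j = i
          · rwa [hji]
          · exact (velocity_of_notMem hr hirr (Finset.insert_nonempty _ _)
              (by simp [hji, hj])).le) i
      rw [Pi.sub_apply, serviceRate_of_mem hr hirr (Finset.mem_insert_self i A)] at this
      linarith
  · intro h
    refine Or.inr fun j hj => ?_
    rw [lamA_eq_velocity hr hirr hind (Finset.mem_insert_self j A)]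
    have := sum_compl_velocity_nonpos hr hirr hA (Finset.subset_insert j A) h
    rwa [Finset.sum_eq_single_of_mem j (Finset.mem_compl.2 hj)] at this
    intro k hk hkj
    exact velocity_of_notMem hr hirr (Finset.insert_nonempty _ _)
      (by simpa [hkj] using hk)

end

end Flow

section SmoothMax

/-- A `C¹` approximation of `max s 0`, exact for `|s| ≥ η`. -/
noncomputable def smoothPos (η s : ℝ) : ℝ := ((max (s + η) 0) ^ 2 - (max (s - η) 0) ^ 2) / (4 * η)

/-- The derivative of `smoothPos η`. -/
noncomputable def smoothStep (η s : ℝ) : ℝ := (max (s + η) 0 - max (s - η) 0) / (2 * η)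

lemma hasDerivAt_sq_max_zero (s : ℝ) :
    HasDerivAt (fun s : ℝ => (max s 0) ^ 2) (2 * max s 0) s := by
  rcases lt_trichotomy s 0 with h | rfl | h
  · rw [max_eq_right h.le, mul_zero]
    refine (hasDerivAt_const s (0 : ℝ)).congr_of_eventuallyEq ?_
    filter_upwards [Iio_mem_nhds h] with y hy
    simp [max_eq_right (le_of_lt (Set.mem_Iio.1 hy))]
  · rw [hasDerivAt_iff_isLittleO]
    simp only [max_self, mul_zero, smul_zero, sub_zero, ne_eq, OfNat.ofNat_ne_zero,
      not_false_eq_true, zero_pow]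
    refine Asymptotics.IsBigO.trans_isLittleO (g := fun y : ℝ => y ^ 2) ?_ ?_
    · refine Asymptotics.IsBigO.of_bound 1 (Filter.Eventually.of_forall fun y => ?_)
      rw [one_mul, norm_pow, norm_pow]
      refine pow_le_pow_left₀ (norm_nonneg _) ?_ 2
      rw [Real.norm_eq_abs, Real.norm_eq_abs, abs_of_nonneg (le_max_right _ _)]
      exact max_le (le_abs_self _) (abs_nonneg _)
    · exact Asymptotics.isLittleO_pow_id (by norm_num)
  · rw [max_eq_left h.le]
    have : HasDerivAt (fun s : ℝ => s ^ 2) (2 * s) s := by simpa using hasDerivAt_pow 2 s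
    refine this.congr_of_eventuallyEq ?_
    filter_upwards [Ioi_mem_nhds h] with y hy
    simp [max_eq_left (le_of_lt (Set.mem_Ioi.1 hy))]

variable {η : ℝ} (hη : 0 < η)
include hη

lemma hasDerivAt_smoothPos (s : ℝ) : HasDerivAt (smoothPos η) (smoothStep η s) s := by
  have h1 := (hasDerivAt_sq_max_zero (s + η)).comp_add_const s η
  have h2 := (hasDerivAt_sq_max_zero (s - η)).comp_sub_const s η
  have h3 := (h1.sub h2).div_const (4 * η)
  refine HasDerivAt.congr_deriv (f := smoothPos η) h3 ?_
  rw [smoothStep]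
  field_simp
  ring

omit hη in
lemma continuous_smoothStep : Continuous (smoothStep η) := by
  unfold smoothStep
  fun_prop

lemma smoothStep_nonneg (s : ℝ) : 0 ≤ smoothStep η s :=
  div_nonneg (sub_nonneg.2 (max_le_max (by linarith) le_rfl)) (by linarith)

lemma smoothStep_le_one (s : ℝ) : smoothStep η s ≤ 1 := by
  rw [smoothStep, div_le_one (by linarith)]
  rcases max_cases (s + η) 0 with h | h <;> rcases max_cases (s - η) 0 with h' | h' <;> linarith

lemma smoothStep_of_le {s : ℝ} (h : s ≤ -η) : smoothStep η s = 0 := by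
  rw [smoothStep, max_eq_right (by linarith), max_eq_right (by linarith)]; simp

lemma smoothStep_of_ge {s : ℝ} (h : η ≤ s) : smoothStep η s = 1 := by
  rw [smoothStep, max_eq_left (by linarith), max_eq_left (by linarith)]
  field_simp
  ring

lemma smoothPos_of_le {s : ℝ} (h : s ≤ -η) : smoothPos η s = 0 := by
  rw [smoothPos, max_eq_right (by linarith), max_eq_right (by linarith)]; simp

lemma smoothPos_nonneg (s : ℝ) : 0 ≤ smoothPos η s :=
  div_nonneg (sub_nonneg.2 (pow_le_pow_left₀ (le_max_right _ _)
    (max_le_max (by linarith) le_rfl) 2)) (by linarith)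

lemma le_smoothPos (s : ℝ) : s ≤ smoothPos η s := by
  rw [smoothPos, le_div_iff₀ (by linarith)]
  rcases max_cases (s + η) 0 with h | h <;> rcases max_cases (s - η) 0 with h' | h' <;>
    rw [h.1, h'.1] <;> nlinarith [sq_nonneg (s - η)]

lemma smoothPos_le_add {s : ℝ} (h : -η ≤ s) : smoothPos η s ≤ s + η := by
  rw [smoothPos, div_le_iff₀ (by linarith)]
  rcases max_cases (s + η) 0 with h | h <;> rcases max_cases (s - η) 0 with h' | h' <;>
    rw [h.1, h'.1] <;> nlinarith

lemma smoothPos_le_of_le {s : ℝ} (h : s ≤ η) : smoothPos η s ≤ η := by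
  rw [smoothPos, div_le_iff₀ (by linarith), max_eq_right (a := s - η) (by linarith)]
  rcases max_cases (s + η) 0 with h | h <;> rw [h.1] <;> nlinarith

/-- A `C¹` smoothing of a finite maximum of affine functions: its gradient is a convex
combination of the gradients of the nearly active pieces. -/
lemma exists_smoothMax {ι E : Type*} [NormedAddCommGroup E] [NormedSpace ℝ E]
    (s : Finset ι) (hs : s.Nonempty) (l : ι → E →L[ℝ] ℝ) (c : ι → ℝ) :
    ∃ (F : E → ℝ) (p : ι → E → ℝ), (∀ i, Continuous (p i)) ∧
      (∀ x, HasFDerivAt F (∑ i ∈ s, p i x • l i) x) ∧ (∀ i x, 0 ≤ p i x) ∧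
      (∀ x, ∑ i ∈ s, p i x = 1) ∧ (∀ i ∈ s, ∀ x, l i x - c i ≤ F x) ∧
      ∀ i ∈ s, ∀ x, p i x ≠ 0 → F x ≤ l i x - c i + s.card * η := by
  classical
  induction hs using Finset.Nonempty.cons_induction with
  | singleton a =>
    refine ⟨fun x => l a x - c a, fun _ _ => 1, fun _ => continuous_const, fun x => ?_,
      fun _ _ => zero_le_one, fun x => by simp, fun i hi x => ?_, fun i hi x _ => ?_⟩
    · simpa using (l a).hasFDerivAt.sub_const (c a)
    · rw [Finset.mem_singleton.1 hi]
    · rw [Finset.mem_singleton.1 hi]; simp [hη.le]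
  | cons a s ha hs ih =>
    obtain ⟨F, p, hpc, hF, hp0, hp1, hge, hact⟩ := ih
    have hFc : Continuous F := continuous_iff_continuousAt.2 fun x => (hF x).continuousAt
    set g : E → ℝ := fun x => l a x - c a - F x with hg
    have hgc : Continuous g := by fun_prop
    have hne : ∀ i ∈ s, i ≠ a := fun i hi h => ha (h ▸ hi)
    refine ⟨fun x => F x + smoothPos η (g x),
      fun i x => if i = a then smoothStep η (g x) else (1 - smoothStep η (g x)) * p i x,
      fun i => ?_, fun x => ?_, fun i x => ?_, fun x => ?_, fun i hi x => ?_,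
      fun i hi x hpi => ?_⟩
    · have : Continuous fun x => smoothStep η (g x) := continuous_smoothStep.comp hgc
      by_cases h : i = a
      · simpa [h] using this
      · simp only [h, if_false]
        exact (continuous_const.sub this).mul (hpc i)
    · have hgd : HasFDerivAt g (l a - ∑ i ∈ s, p i x • l i) x :=
        ((l a).hasFDerivAt.sub_const (c a)).sub (hF x)
      have h2 := (hF x).add ((hasDerivAt_smoothPos hη (g x)).comp_hasFDerivAt x hgd)
      refine HasFDerivAt.congr_fderiv (f := fun x => F x + smoothPos η (g x)) h2 ?_
      simp only []
      have hsum : ∑ i ∈ s, (if i = a then smoothStep η (g x)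
          else (1 - smoothStep η (g x)) * p i x) • l i =
          (1 - smoothStep η (g x)) • ∑ i ∈ s, p i x • l i := by
        rw [Finset.smul_sum]
        exact Finset.sum_congr rfl fun i hi => by rw [if_neg (hne i hi), mul_smul]
      rw [Finset.sum_cons, if_pos rfl, hsum]
      module
    · by_cases h : i = a
      · simpa [h] using smoothStep_nonneg hη (g x)
      · simpa [h] using mul_nonneg (sub_nonneg.2 (smoothStep_le_one hη (g x))) (hp0 i x)
    · simp only []
      rw [Finset.sum_cons, if_pos rfl,
        Finset.sum_congr rfl fun i hi => by rw [if_neg (hne i hi)], ← Finset.mul_sum, hp1]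
      ring
    · rcases Finset.mem_cons.1 hi with rfl | hi
      · have := le_smoothPos hη (g x)
        simp only [hg] at this ⊢
        linarith
      · linarith [hge i hi x, smoothPos_nonneg hη (g x)]
    · rw [Finset.card_cons, Nat.cast_add, Nat.cast_one]
      have hcard : 0 ≤ (s.card : ℝ) * η := by positivity
      rcases Finset.mem_cons.1 hi with rfl | hi
      · simp only [if_true] at hpi
        have h1 : -η ≤ g x := by
          by_contra h
          exact hpi (smoothStep_of_le hη (not_le.1 h).le)
        have := smoothPos_le_add hη h1
        simp only [hg] at this ⊢
        linarith
      · simp only [hne i hi, if_false] at hpi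
        have h1 : g x ≤ η := by
          by_contra h
          exact hpi (by rw [smoothStep_of_ge hη (not_le.1 h).le]; simp)
        have := smoothPos_le_of_le hη h1
        have := hact i hi x (right_ne_zero_of_mul hpi)
        linarith

end SmoothMax

section TestFunctions

variable {V : Type*} [Fintype V] [DecidableEq V]

/-- The linear functional `x ↦ ∑ i, w i * x i`. -/
noncomputable def dotL (w : V → ℝ) : (V → ℝ) →L[ℝ] ℝ :=
  ∑ i, w i • ContinuousLinearMap.proj (R := ℝ) (φ := fun _ : V => ℝ) i

omit [DecidableEq V] in
lemma dotL_apply (w x : V → ℝ) : dotL w x = ∑ i, w i * x i := by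
  simp [dotL]

lemma dotL_vvec (r : V → V → ℝ) (w : V → ℝ) (k : V) : dotL w (vvec r k) = gen r w k := by
  simp only [dotL_apply, vvec, gen, Finset.mul_sum]
  rw [Finset.sum_comm]
  refine Finset.sum_congr rfl fun j _ => ?_
  have : ∀ i, w i * (r k j * ((if i = j then (1 : ℝ) else 0) - if i = k then 1 else 0)) =
      (if i = j then w i * r k j else 0) - if i = k then w i * r k j else 0 := by
    intro i; split_ifs <;> ring
  simp only [this, Finset.sum_sub_distrib, Finset.sum_ite_eq', Finset.mem_univ, if_true]
  ring

omit [DecidableEq V] in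
lemma mem_suppF {x : V → ℝ} {i : V} : i ∈ suppF x ↔ 0 < x i := by simp [suppF]

omit [Fintype V] [DecidableEq V] in
lemma exists_pos_le {ι : Type*} [Finite ι] (f : ι → ℝ) (P : ι → Prop)
    (h : ∀ i, P i → 0 < f i) : ∃ κ > 0, ∀ i, P i → κ ≤ f i := by
  cases isEmpty_or_nonempty {i // P i} with
  | inl he => exact ⟨1, one_pos, fun i hi => (he.false ⟨i, hi⟩).elim⟩
  | inr hn =>
    obtain ⟨i, hi⟩ := Finite.exists_min fun i : {i // P i} => f i
    exact ⟨f i, h _ i.2, fun j hj => hi ⟨j, hj⟩⟩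

variable {r : V → V → ℝ} (hr : ∀ i j, 0 ≤ r i j) (hirr : IrreducibleRates r)
include hr hirr

/-- If `β` is strictly superharmonic off `B`, then it strictly dominates the function that agrees
with it on `B` and is harmonic off `B`. -/
lemma lt_of_gen_neg {B : Finset V} (hB : B.Nonempty) {β w : V → ℝ}
    (hβ : ∀ i ∉ B, gen r β i < 0) (hw : ∀ i ∈ B, w i = β i) (hw' : ∀ i ∉ B, gen r w i = 0)
    {l : V} (hl : l ∉ B) : w l < β l := by
  have h0 := nonneg_of_gen_nonpos hr hirr hB (w := β - w) (fun i hi => by simp [hw i hi])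
    (fun i hi => by rw [gen_sub, hw' i hi, sub_zero]; exact (hβ i hi).le)
  refine lt_of_le_of_ne (by simpa using h0 l) fun h => ?_
  have h1 : gen r (β - w) l < 0 := by rw [gen_sub, hw' l hl, sub_zero]; exact hβ l hl
  refine h1.not_ge (Finset.sum_nonneg fun k _ => mul_nonneg (hr _ _) ?_)
  have := h0 k
  simp only [Pi.sub_apply] at this ⊢
  linarith

lemma exists_testFunction {a : V} {β : V → ℝ} (hβ : ∀ i, i ≠ a → gen r β i < 0)
    {m c₀ : ℝ} (hm : ∀ i, i ≠ a → m ≤ β i) (hc : c₀ < m) :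
    ∃ C K ε₀ : ℝ, 0 < ε₀ ∧ ∀ ε : ℝ, 0 < ε → ε < ε₀ → ∃ f : (V → ℝ) → ℝ,
      MemD r Finset.univ f ∧ ∀ x ∈ stdSimplex ℝ V, dotL β x ≤ c₀ →
        |f x - dotL β x| ≤ C * ε ∧ |fderiv ℝ f x (lamV r)| ≤ K ∧
        ((∀ i, x i = 0 ∨ C * ε < x i) →
          fderiv ℝ f x (lamV r) = dotL β (velocity r (suppF x))) := by
  have hWex : ∀ B : Finset V, ∃ w : V → ℝ,
      B.Nonempty → (∀ i ∈ B, w i = β i) ∧ ∀ i ∉ B, gen r w i = 0 := by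
    intro B
    by_cases hB : B.Nonempty
    · obtain ⟨w, h1, h2⟩ := exists_gen_eq hr hirr hB fun i => if i ∈ B then β i else 0
      exact ⟨w, fun _ => ⟨fun i hi => by simp [h1 i hi, hi], fun i hi => by simp [h2 i hi, hi]⟩⟩
    · exact ⟨0, fun h => absurd h hB⟩
  choose W hW using hWex
  have hβB : ∀ B : Finset V, a ∈ B → ∀ i ∉ B, gen r β i < 0 := fun B haB i hi =>
    hβ i fun h => hi (h ▸ haB)
  have hWlt : ∀ B : Finset V, a ∈ B → ∀ l ∉ B, W B l < β l := fun B haB l hl =>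
    lt_of_gen_neg hr hirr ⟨a, haB⟩ (hβB B haB) (hW B ⟨a, haB⟩).1 (hW B ⟨a, haB⟩).2 hl
  have hWle : ∀ B : Finset V, a ∈ B → ∀ i, W B i ≤ β i := fun B haB i => by
    by_cases hi : i ∈ B
    · exact ((hW B ⟨a, haB⟩).1 i hi).le
    · exact (hWlt B haB i hi).le
  obtain ⟨κ, hκ, hκW⟩ := exists_pos_le (fun q : Finset V × V => β q.2 - W q.1 q.2)
    (fun q => a ∈ q.1 ∧ q.2 ∉ q.1) fun q hq => sub_pos.2 (hWlt q.1 hq.1 q.2 hq.2)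
  set K : ℝ := 1 + ∑ B : Finset V, ∑ i, |W B i| with hK
  have hWK : ∀ B i, |W B i| ≤ K := fun B i => by
    have h1 := Finset.single_le_sum (f := fun i => |W B i|) (fun i _ => abs_nonneg _)
      (Finset.mem_univ i)
    have h2 := Finset.single_le_sum (f := fun B => ∑ i, |W B i|)
      (fun B _ => Finset.sum_nonneg fun i _ => abs_nonneg _) (Finset.mem_univ B)
    linarith
  have hK0 : 0 < K := by
    have : 0 ≤ ∑ B : Finset V, ∑ i, |W B i| :=
      Finset.sum_nonneg fun B _ => Finset.sum_nonneg fun i _ => abs_nonneg _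
    linarith
  set n : ℕ := Fintype.card V with hn
  have hn0 : 0 < (n : ℝ) := Nat.cast_pos.2 (Fintype.card_pos_iff.2 ⟨a⟩)
  obtain ⟨θ, hθ0, hθ1, hθ2⟩ : ∃ θ : ℝ, 0 < θ ∧ θ ≤ 1 / 2 ∧ 8 * K * n * θ < κ := by
    refine ⟨min (1 / 2) (κ / (16 * K * n)), lt_min (by norm_num) (by positivity),
      min_le_left _ _, ?_⟩
    have h1 : min (1 / 2) (κ / (16 * K * n)) ≤ κ / (16 * K * n) := min_le_right _ _
    calc 8 * K * n * min (1 / 2) (κ / (16 * K * n)) ≤ 8 * K * n * (κ / (16 * K * n)) := by gcongr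
      _ = κ / 2 := by field_simp; norm_num
      _ < κ := by linarith
  have hθle : θ ≤ 1 := by linarith
  set cc : ℕ → ℝ := fun m => ∑ i ∈ Finset.range m, θ ^ (i + 1) with hcc
  have hccs : ∀ m, cc (m + 1) = cc m + θ ^ (m + 1) := fun m => Finset.sum_range_succ _ _
  have hcc0 : ∀ m, 0 ≤ cc m := fun m => Finset.sum_nonneg fun i _ => by positivity
  have hccle : ∀ m, cc m ≤ m := fun m =>
    (Finset.sum_le_card_nsmul _ _ 1 fun i _ => pow_le_one₀ hθ0.le hθle).trans (by simp)
  set s : Finset (Finset V) := Finset.univ.filter fun B => a ∈ B with hs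
  have hmem : ∀ B, B ∈ s ↔ a ∈ B := by simp [hs]
  have huniv : Finset.univ ∈ s := (hmem _).2 (Finset.mem_univ a)
  set η' : ℝ := (m - c₀) / 4 with hη'
  have hη'0 : 0 < η' := by rw [hη']; linarith
  set C : ℝ := n + 1 + 2 / κ with hC
  have hCn : (n : ℝ) + 1 ≤ C := by rw [hC]; linarith [div_pos two_pos hκ]
  refine ⟨C, ∑ B ∈ s, |dotL (W B) (lamV r)|, η' / (n + 1), by positivity, fun ε hε hεlt => ?_⟩
  rw [lt_div_iff₀ (by positivity)] at hεlt
  set η : ℝ := ε * θ ^ (n + 1) / s.card with hη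
  have hscard : 0 < (s.card : ℝ) := Nat.cast_pos.2 (Finset.card_pos.2 ⟨_, huniv⟩)
  have hη0 : 0 < η := by positivity
  have hsη : s.card * η = ε * θ ^ (n + 1) := by rw [hη]; field_simp
  obtain ⟨F, p, hpc, hF, hp0, hp1, hge, hact⟩ := exists_smoothMax hη0 s ⟨_, huniv⟩
    (fun B => dotL (W B)) fun B => ε * cc B.card
  rw [hsη] at hact
  have hσ : ε * θ ^ (n + 1) ≤ ε := mul_le_of_le_one_right hε.le (pow_le_one₀ hθ0.le hθle)
  -- a nearly active piece `B` at `x` consists of occupied sites, and the others are almost empty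
  have hout : ∀ x ∈ stdSimplex ℝ V, ∀ B ∈ s, p B x ≠ 0 → ∀ l ∉ B,
      κ * x l ≤ 2 * (ε * θ ^ (B.card + 1)) := by
    intro x hx B hB hpB l hl
    have haB := (hmem B).1 hB
    have haB' : a ∈ insert l B := Finset.mem_insert_of_mem haB
    have h1 := hact B hB x hpB
    have h2 := hge (insert l B) ((hmem _).2 haB') x
    rw [Finset.card_insert_of_notMem hl, hccs] at h2
    have hcard : B.card + 1 ≤ n + 1 := by
      have := Finset.card_le_univ B
      omega
    have h3 : ε * θ ^ (n + 1) ≤ ε * θ ^ (B.card + 1) :=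
      mul_le_mul_of_nonneg_left (pow_le_pow_of_le_one hθ0.le hθle hcard) hε.le
    have hd : ∀ i, 0 ≤ (W (insert l B) - W B) i := by
      refine nonneg_of_gen_nonpos hr hirr (B := insert l B) ⟨a, haB'⟩ (fun i hi => ?_)
        fun i hi => ?_
      · rw [Pi.sub_apply, (hW _ ⟨a, haB'⟩).1 i hi]
        exact sub_nonneg.2 (hWle B haB i)
      · rw [gen_sub, (hW _ ⟨a, haB'⟩).2 i hi,
          (hW _ ⟨a, haB⟩).2 i fun h => hi (Finset.mem_insert_of_mem h), sub_zero]
    have h4 : κ * x l ≤ dotL (W (insert l B)) x - dotL (W B) x := by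
      rw [dotL_apply, dotL_apply, ← Finset.sum_sub_distrib]
      have h5 : κ * x l ≤ W (insert l B) l * x l - W B l * x l := by
        rw [(hW _ ⟨a, haB'⟩).1 l (Finset.mem_insert_self l B), ← sub_mul]
        exact mul_le_mul_of_nonneg_right (hκW (B, l) ⟨haB, hl⟩) (hx.1 l)
      refine h5.trans (Finset.single_le_sum
        (f := fun i => W (insert l B) i * x i - W B i * x i) (fun i _ => ?_) (Finset.mem_univ l))
      rw [← sub_mul]
      exact mul_nonneg (hd i) (hx.1 i)
    linarith
  have hin : ∀ x ∈ stdSimplex ℝ V, ∀ B ∈ s, p B x ≠ 0 → ∀ k ∈ B, k ≠ a → 0 < x k := by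
    intro x hx B hB hpB k hk hka
    by_contra hxk
    have hxk0 : x k = 0 := le_antisymm (not_lt.1 hxk) (hx.1 k)
    have haB := (hmem B).1 hB
    have haE : a ∈ B.erase k := Finset.mem_erase.2 ⟨hka.symm, haB⟩
    obtain ⟨b, hb⟩ : ∃ b, B.card = b + 1 := ⟨B.card - 1, by
      have := Finset.card_pos.2 ⟨k, hk⟩
      omega⟩
    have h1 := hact B hB x hpB
    have h2 := hge (B.erase k) ((hmem _).2 haE) x
    rw [Finset.card_erase_of_mem hk, hb, Nat.add_sub_cancel] at h2
    rw [hb, hccs] at h1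
    have hcard : b + 2 ≤ n + 1 := by
      have := Finset.card_le_univ B
      omega
    have h3 : ε * θ ^ (n + 1) ≤ ε * θ ^ (b + 2) :=
      mul_le_mul_of_nonneg_left (pow_le_pow_of_le_one hθ0.le hθle hcard) hε.le
    have h4 : dotL (W B) x - dotL (W (B.erase k)) x ≤
        n * (2 * K * (2 * (ε * θ ^ (b + 2)) / κ)) := by
      rw [dotL_apply, dotL_apply, ← Finset.sum_sub_distrib]
      refine (Finset.sum_le_card_nsmul _ _ (2 * K * (2 * (ε * θ ^ (b + 2)) / κ))
        fun i _ => ?_).trans (by rw [nsmul_eq_mul, Finset.card_univ])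
      have hpos : 0 ≤ 2 * K * (2 * (ε * θ ^ (b + 2)) / κ) := by positivity
      by_cases hi : i ∈ B
      · by_cases hik : i = k
        · simpa [hik, hxk0] using hpos
        · rw [(hW B ⟨a, haB⟩).1 i hi,
            (hW _ ⟨a, haE⟩).1 i (Finset.mem_erase.2 ⟨hik, hi⟩), sub_self]
          exact hpos
      · have h5 := hout x hx B hB hpB i hi
        rw [hb] at h5
        have h6 : x i ≤ 2 * (ε * θ ^ (b + 2)) / κ := by
          rw [le_div_iff₀ hκ]; linarith
        have h7 : W B i - W (B.erase k) i ≤ 2 * K := by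
          linarith [(abs_le.1 (hWK B i)).2, (abs_le.1 (hWK (B.erase k) i)).1]
        rw [← sub_mul]
        exact (mul_le_mul_of_nonneg_right h7 (hx.1 i)).trans
          (mul_le_mul_of_nonneg_left h6 (by positivity))
    have h5 : n * (2 * K * (2 * (ε * θ ^ (b + 2)) / κ)) < ε * θ ^ (b + 1) / 2 := by
      have : n * (2 * K * (2 * (ε * θ ^ (b + 2)) / κ)) =
          (8 * K * n * θ) / κ * (ε * θ ^ (b + 1) / 2) := by field_simp; ring
      rw [this]
      exact mul_lt_of_lt_one_left (by positivity) ((div_lt_one hκ).2 hθ2)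
    have h6 : ε * θ ^ (b + 2) ≤ ε * θ ^ (b + 1) / 2 := by
      rw [pow_succ θ (b + 1)]
      have := mul_le_mul_of_nonneg_left hθ1 (by positivity : 0 ≤ ε * θ ^ (b + 1))
      linarith
    linarith
  have hFlow : ∀ x, dotL β x - ε * n ≤ F x := fun x => by
    refine le_trans ?_ (hge _ huniv x)
    have : W Finset.univ = β :=
      funext fun i => (hW _ ⟨a, Finset.mem_univ a⟩).1 i (Finset.mem_univ i)
    rw [this, Finset.card_univ]
    linarith [mul_le_mul_of_nonneg_left (hccle n) hε.le]
  have hFup : ∀ x ∈ stdSimplex ℝ V, F x ≤ dotL β x + ε := fun x hx => by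
    obtain ⟨B, hB, hpB⟩ : ∃ B ∈ s, p B x ≠ 0 := by
      by_contra! h
      have := hp1 x
      rw [Finset.sum_eq_zero h] at this
      exact zero_ne_one this
    have h1 := hact B hB x hpB
    have h2 : dotL (W B) x ≤ dotL β x := by
      rw [dotL_apply, dotL_apply]
      exact Finset.sum_le_sum fun i _ =>
        mul_le_mul_of_nonneg_right (hWle B ((hmem B).1 hB) i) (hx.1 i)
    linarith [mul_nonneg hε.le (hcc0 B.card)]
  have hma : ∀ x ∈ stdSimplex ℝ V, x a = 0 → m ≤ dotL β x := by
    intro x hx hxa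
    have : m * ∑ i, x i ≤ dotL β x := by
      rw [dotL_apply, Finset.mul_sum]
      refine Finset.sum_le_sum fun i _ => ?_
      by_cases hi : i = a
      · rw [hi, hxa]; simp
      · exact mul_le_mul_of_nonneg_right (hm i hi) (hx.1 i)
    rwa [hx.2, mul_one] at this
  set c : ℝ := c₀ + 2 * η' with hcdef
  set g : (V → ℝ) → ((V → ℝ) →L[ℝ] ℝ) := fun x =>
    (1 - smoothStep η' (F x - c)) • ∑ B ∈ s, p B x • dotL (W B) with hg
  have hfd : ∀ x, HasFDerivAt (fun x => F x - smoothPos η' (F x - c)) (g x) x := fun x => by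
    have h1 := (hasDerivAt_smoothPos hη'0 (F x - c)).comp_hasFDerivAt x ((hF x).sub_const c)
    refine HasFDerivAt.congr_fderiv (f := fun x => F x - smoothPos η' (F x - c))
      ((hF x).sub h1) ?_
    simp only [hg]
    module
  have hFc : Continuous F := continuous_iff_continuousAt.2 fun x => (hF x).continuousAt
  have hgc : Continuous g := by
    have h1 : Continuous fun x => smoothStep η' (F x - c) :=
      continuous_smoothStep.comp (hFc.sub continuous_const)
    exact (continuous_const.sub h1).smul (continuous_finsetSum _ fun B _ =>
      (hpc B).smul continuous_const)
  have hgapp : ∀ x v, g x v =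
      (1 - smoothStep η' (F x - c)) * ∑ B ∈ s, p B x * dotL (W B) v := fun x v => by
    simp [hg]
  refine ⟨fun x => F x - smoothPos η' (F x - c), ⟨⟨Set.univ, isOpen_univ, Set.subset_univ _, ?_⟩,
    fun k _ x hx hxk => ?_⟩, fun x hx hxc => ?_⟩
  · rw [contDiffOn_univ, contDiff_one_iff_fderiv]
    refine ⟨fun x => (hfd x).differentiableAt, ?_⟩
    rwa [funext fun x => (hfd x).fderiv]
  · rw [(hfd x).fderiv, hgapp]
    by_cases hka : k = a
    · have h1 := hma x hx (hka ▸ hxk)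
      rw [smoothStep_of_ge hη'0 (by linarith [hFlow x]), sub_self, zero_mul]
    · rw [Finset.sum_eq_zero, mul_zero]
      intro B hB
      by_cases hpB : p B x = 0
      · rw [hpB, zero_mul]
      · rw [dotL_vvec, (hW B ⟨a, (hmem B).1 hB⟩).2 k fun hkB =>
          (hin x hx B hB hpB k hkB hka).ne' hxk, mul_zero]
  · have hstep : F x - c ≤ -η' := by
      have : ε ≤ η' := by nlinarith
      linarith [hFup x hx]
    have hval : fderiv ℝ (fun x => F x - smoothPos η' (F x - c)) x (lamV r) =
        ∑ B ∈ s, p B x * dotL (W B) (lamV r) := by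
      rw [(hfd x).fderiv, hgapp, smoothStep_of_le hη'0 hstep, sub_zero, one_mul]
    rw [hval]
    simp only [smoothPos_of_le hη'0 hstep, sub_zero]
    refine ⟨?_, ?_, fun hx0 => ?_⟩
    · have h1 : (n + 1) * ε ≤ C * ε := mul_le_mul_of_nonneg_right hCn hε.le
      have h2 : 0 ≤ n * ε := by positivity
      rw [abs_le]
      constructor <;> linarith [hFlow x, hFup x hx]
    · refine (Finset.abs_sum_le_sum_abs _ _).trans (Finset.sum_le_sum fun B hB => ?_)
      rw [abs_mul, abs_of_nonneg (hp0 B x)]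
      refine mul_le_of_le_one_left (abs_nonneg _) ?_
      rw [← hp1 x]
      exact Finset.single_le_sum (f := fun B => p B x) (fun B _ => hp0 B x) hB
    · have hxa : 0 < x a := by
        refine lt_of_le_of_ne (hx.1 a) fun h => ?_
        linarith [hma x hx h.symm]
      have hBeq : ∀ B ∈ s, p B x ≠ 0 → B = suppF x := by
        intro B hB hpB
        ext i
        rw [mem_suppF]
        refine ⟨fun hi => ?_, fun hi => ?_⟩
        · by_cases hia : i = a
          · rwa [hia]
          · exact hin x hx B hB hpB i hi hia
        · by_contra hiB
          have h1 := hout x hx B hB hpB i hiB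
          have h2 : x i ≤ 2 / κ * ε := by
            rw [div_mul_eq_mul_div, le_div_iff₀ hκ]
            have : ε * θ ^ (B.card + 1) ≤ ε :=
              mul_le_of_le_one_right hε.le (pow_le_one₀ hθ0.le hθle)
            linarith
          have h3 : 2 / κ * ε ≤ C * ε :=
            mul_le_mul_of_nonneg_right (by rw [hC]; linarith) hε.le
          rcases hx0 i with h | h <;> linarith
      have hsupp : (suppF x).Nonempty := ⟨a, mem_suppF.2 hxa⟩
      have h1 : ∀ B ∈ s, p B x * dotL (W B) (lamV r) =
          p B x * dotL (W (suppF x)) (lamV r) := by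
        intro B hB
        by_cases hpB : p B x = 0
        · simp [hpB]
        · rw [← hBeq B hB hpB]
      rw [Finset.sum_congr rfl h1, ← Finset.sum_mul, hp1, one_mul, dotL_apply, dotL_apply]
      have h2 := sum_lamV_mul_harmonic hr hirr (hW _ hsupp).2
      simp only [mul_comm (W (suppF x) _)]
      rw [h2]
      refine Finset.sum_congr rfl fun i _ => ?_
      by_cases hi : i ∈ suppF x
      · rw [(hW _ hsupp).1 i hi, mul_comm]
      · rw [velocity_of_notMem hr hirr hsupp hi]; simp

end TestFunctions

section IntegralEquation

open MeasureTheory Filter Topology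

variable {V : Type*} [Fintype V] [DecidableEq V]

lemma MemD.continuousOn_fderiv {r : V → V → ℝ} {B : Finset V} {f : (V → ℝ) → ℝ}
    (hf : MemD r B f) (v : V → ℝ) :
    ContinuousOn (fun x => fderiv ℝ f x v) (stdSimplex ℝ V) := by
  obtain ⟨⟨U, hU, hsub, hfU⟩, -⟩ := hf
  exact ((hfU.continuousOn_fderiv_of_isOpen hU le_rfl).mono hsub).clm_apply continuousOn_const

lemma MemD.hasFDerivAt {r : V → V → ℝ} {B : Finset V} {f : (V → ℝ) → ℝ}
    (hf : MemD r B f) {x : V → ℝ} (hx : x ∈ stdSimplex ℝ V) :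
    HasFDerivAt f (fderiv ℝ f x) x := by
  obtain ⟨⟨U, hU, hsub, hfU⟩, -⟩ := hf
  exact ((hfU.differentiableOn one_ne_zero).differentiableAt
    (hU.mem_nhds (hsub hx))).hasFDerivAt

lemma IsPath.continuousOn_fderiv {ζ : ℝ → V → ℝ} (hζ : IsPath ζ) {r : V → V → ℝ} {B : Finset V}
    {f : (V → ℝ) → ℝ} (hf : MemD r B f) (v : V → ℝ) :
    ContinuousOn (fun s => fderiv ℝ f (ζ s) v) (Set.Ici 0) :=
  (hf.continuousOn_fderiv v).comp hζ.1 fun t ht => hζ.2 t ht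

lemma IsPath.intervalIntegrable_fderiv {ζ : ℝ → V → ℝ} (hζ : IsPath ζ) {r : V → V → ℝ}
    {B : Finset V} {f : (V → ℝ) → ℝ} (hf : MemD r B f) (v : V → ℝ) {t₁ t₂ : ℝ} (h1 : 0 ≤ t₁)
    (h2 : 0 ≤ t₂) : IntervalIntegrable (fun s => fderiv ℝ f (ζ s) v) volume t₁ t₂ :=
  ((hζ.continuousOn_fderiv hf v).mono fun _ hs => (le_min h1 h2).trans hs.1).intervalIntegrable

lemma CondA.sub_eq {ζ : ℝ → V → ℝ} (hζ : IsPath ζ) {r : V → V → ℝ} (hA : CondA r ζ)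
    {f : (V → ℝ) → ℝ} (hf : MemD r Finset.univ f) {t₁ t₂ : ℝ} (h1 : 0 ≤ t₁) (h2 : 0 ≤ t₂) :
    f (ζ t₂) - f (ζ t₁) = ∫ s in t₁..t₂, fderiv ℝ f (ζ s) (lamV r) := by
  rw [hA f hf t₁ h1, hA f hf t₂ h2, add_sub_add_left_eq_sub]
  exact intervalIntegral.integral_interval_sub_left
    (hζ.intervalIntegrable_fderiv hf _ le_rfl h2) (hζ.intervalIntegrable_fderiv hf _ le_rfl h1)

omit [DecidableEq V] in
lemma measurable_comp_suppF (g : Finset V → ℝ) : Measurable fun x : V → ℝ => g (suppF x) := by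
  let _ : MeasurableSpace (Finset V) := ⊤
  have h : Measurable (suppF : (V → ℝ) → Finset V) := by
    refine measurable_to_countable' fun A => ?_
    have : (suppF : (V → ℝ) → Finset V) ⁻¹' {A} = ⋂ i, {x | 0 < x i ↔ i ∈ A} := by
      ext x
      simp [Finset.ext_iff, mem_suppF]
    rw [this]
    refine MeasurableSet.iInter fun i => ?_
    have hm : MeasurableSet {x : V → ℝ | 0 < x i} :=
      measurableSet_lt measurable_const (measurable_pi_apply i)
    by_cases hi : i ∈ A
    · simpa [hi] using hm
    · convert hm.compl using 1
      ext x
      simp [hi]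
  exact measurable_from_top.comp h

omit [DecidableEq V] in
lemma IsPath.intervalIntegrable_suppF {ζ : ℝ → V → ℝ} (hζ : IsPath ζ) (g : Finset V → ℝ)
    {t₁ t₂ : ℝ} (h1 : 0 ≤ t₁) (h12 : t₁ ≤ t₂) :
    IntervalIntegrable (fun s => g (suppF (ζ s))) volume t₁ t₂ := by
  rw [intervalIntegrable_iff_integrableOn_Ioc_of_le h12]
  have hm : AEMeasurable ζ (volume.restrict (Set.Ioc t₁ t₂)) :=
    (hζ.1.mono fun s hs => h1.trans hs.1.le).aemeasurable measurableSet_Ioc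
  refine Integrable.of_bound ((measurable_comp_suppF g).comp_aemeasurable hm).aestronglyMeasurable
    (∑ A, |g A|) (Eventually.of_forall fun s => ?_)
  exact Finset.single_le_sum (f := fun A => |g A|) (fun _ _ => abs_nonneg _) (Finset.mem_univ _)

variable {r : V → V → ℝ} (hr : ∀ i j, 0 ≤ r i j) (hirr : IrreducibleRates r)
include hr hirr

lemma dotL_sub_eq_integral {ζ : ℝ → V → ℝ} (hζ : IsPath ζ) (hA : CondA r ζ) {a : V} {β : V → ℝ}
    (hβ : ∀ i, i ≠ a → gen r β i < 0) {m c₀ : ℝ} (hm : ∀ i, i ≠ a → m ≤ β i) (hc : c₀ < m)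
    {t₁ t₂ : ℝ} (h1 : 0 ≤ t₁) (h12 : t₁ ≤ t₂) (hle : ∀ s ∈ Set.Icc t₁ t₂, dotL β (ζ s) ≤ c₀) :
    dotL β (ζ t₂) - dotL β (ζ t₁) = ∫ s in t₁..t₂, dotL β (velocity r (suppF (ζ s))) := by
  obtain ⟨C, K, ε₀, hε₀, hex⟩ := exists_testFunction hr hirr hβ hm hc
  set ε : ℕ → ℝ := fun n => ε₀ / 2 * (1 / ((n : ℝ) + 1)) with hε
  have hεpos : ∀ n, 0 < ε n := fun n => by simp only [hε]; positivity
  have hεlt : ∀ n, ε n < ε₀ := fun n => by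
    have : 1 / ((n : ℝ) + 1) ≤ 1 := by
      rw [div_le_one (by positivity)]
      linarith [n.cast_nonneg (α := ℝ)]
    have := mul_le_mul_of_nonneg_left this (half_pos hε₀).le
    simp only [hε]
    linarith
  have hlim : Tendsto (fun n => C * ε n) atTop (𝓝 0) := by
    simpa [hε] using
      ((tendsto_one_div_add_atTop_nhds_zero_nat (𝕜 := ℝ)).const_mul (ε₀ / 2)).const_mul C
  choose f hf hfx using fun n => hex (ε n) (hεpos n) (hεlt n)
  have hval : ∀ s ∈ Set.Icc t₁ t₂, Tendsto (fun n => f n (ζ s)) atTop (𝓝 (dotL β (ζ s))) := by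
    intro s hs
    rw [tendsto_iff_norm_sub_tendsto_zero]
    exact squeeze_zero (fun n => norm_nonneg _)
      (fun n => (hfx n (ζ s) (hζ.2 s (h1.trans hs.1)) (hle s hs)).1) hlim
  have hl := (hval t₂ ⟨h12, le_rfl⟩).sub (hval t₁ ⟨le_rfl, h12⟩)
  simp only [fun n => hA.sub_eq hζ (hf n) h1 (h1.trans h12)] at hl
  refine tendsto_nhds_unique hl ?_
  refine intervalIntegral.tendsto_integral_filter_of_dominated_convergence (fun _ => K)
    (Eventually.of_forall fun n => ?_) (Eventually.of_forall fun n => ?_)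
    intervalIntegrable_const ?_
  · rw [Set.uIoc_of_le h12]
    exact ((intervalIntegrable_iff_integrableOn_Ioc_of_le h12).1
      (hζ.intervalIntegrable_fderiv (hf n) _ h1 (h1.trans h12))).aestronglyMeasurable
  · refine ae_of_all _ ?_
    intro s hs
    rw [Set.uIoc_of_le h12] at hs
    exact (hfx n (ζ s) (hζ.2 s (h1.trans hs.1.le)) (hle s ⟨hs.1.le, hs.2⟩)).2.1
  · refine ae_of_all _ ?_
    intro s hs
    rw [Set.uIoc_of_le h12] at hs
    have hsx := hζ.2 s (h1.trans hs.1.le)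
    have hev : ∀ᶠ n in atTop, ∀ i, ζ s i = 0 ∨ C * ε n < ζ s i := by
      refine eventually_all.2 fun i => ?_
      rcases (hsx.1 i).eq_or_lt with h | h
      · exact Eventually.of_forall fun n => Or.inl h.symm
      · filter_upwards [hlim.eventually_lt_const h] with n hn using Or.inr hn
    refine tendsto_const_nhds.congr' ?_
    filter_upwards [hev] with n hn
    exact ((hfx n (ζ s) hsx (hle s ⟨hs.1.le, hs.2⟩)).2.2 hn).symm

/-- Functions strictly superharmonic off `a`, close to the indicator of the complement of `a`,
whose differences span the coordinates. -/
lemma exists_superharmonic_perturbation (a k : V) (hka : k ≠ a) {κ : ℝ} (hκ : 0 < κ) :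
    ∃ (β : V → ℝ) (δ : ℝ), 0 < δ ∧ ∀ d : ℝ, (d = 0 ∨ d = δ) →
      (∀ i, i ≠ a → gen r (β + d • Pi.single k (1 : ℝ)) i < 0) ∧
      (∀ i, i ≠ a → 1 ≤ β i + d * (Pi.single k (1 : ℝ) : V → ℝ) i) ∧
      ∀ x ∈ stdSimplex ℝ V, κ ≤ x a → dotL (β + d • Pi.single k (1 : ℝ)) x ≤ 1 - κ / 2 := by
  obtain ⟨τ, hτa, hτ⟩ := exists_gen_eq hr hirr (Finset.singleton_nonempty a)
    fun i => if i = a then 0 else -1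
  simp only [Finset.mem_singleton] at hτa hτ
  have hτ0 : ∀ i, 0 ≤ τ i := nonneg_of_gen_nonpos hr hirr (Finset.singleton_nonempty a)
    (fun i hi => by
      rw [Finset.mem_singleton] at hi
      subst hi
      simp [hτa i rfl])
    (fun i hi => by
      rw [Finset.mem_singleton] at hi
      simp [hτ i hi, hi])
  set M : ℝ := ∑ i, τ i with hM
  have hτM : ∀ i, τ i ≤ M := fun i => Finset.single_le_sum (fun i _ => hτ0 i) (Finset.mem_univ i)
  have hM0 : 0 ≤ M := Finset.sum_nonneg fun i _ => hτ0 i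
  set R : ℝ := 1 + ∑ i, |gen r (Pi.single k (1 : ℝ)) i| with hR
  have hgenR : ∀ i, gen r (Pi.single k (1 : ℝ)) i < R := fun i => by
    have h1 := Finset.single_le_sum (f := fun i => |gen r (Pi.single k (1 : ℝ)) i|)
      (fun i _ => abs_nonneg _) (Finset.mem_univ i)
    have h2 := le_abs_self (gen r (Pi.single k (1 : ℝ)) i)
    linarith
  have hR0 : 0 < R := by
    have : 0 ≤ ∑ i, |gen r (Pi.single k (1 : ℝ)) i| := Finset.sum_nonneg fun i _ => abs_nonneg _
    linarith
  set e : ℝ := κ / (4 * (M + 1)) with he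
  have he0 : 0 < e := by positivity
  have heM : e * M ≤ κ / 4 := by
    rw [he, div_mul_eq_mul_div, div_le_div_iff₀ (by positivity) (by norm_num)]
    nlinarith
  set δ : ℝ := min (e / R) (κ / 4) with hδ
  have hδ0 : 0 < δ := lt_min (by positivity) (by positivity)
  have hδR : δ * R ≤ e := by
    rw [← le_div_iff₀ hR0]; exact min_le_left _ _
  set b : V → ℝ := fun i => if i = a then 0 else 1 with hb
  refine ⟨b + e • τ, δ, hδ0, fun d hd => ?_⟩
  have hd0 : 0 ≤ d := by rcases hd with rfl | rfl <;> linarith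
  have hdδ : d ≤ δ := by rcases hd with rfl | rfl <;> linarith
  refine ⟨fun i hi => ?_, fun i hi => ?_, fun x hx hxa => ?_⟩
  · rw [gen_add, gen_add, gen_smul, gen_smul, hτ i hi, if_neg hi]
    have h1 : gen r b i ≤ 0 := Finset.sum_nonpos fun j _ =>
      mul_nonpos_of_nonneg_of_nonpos (hr _ _) (by simp only [hb, if_neg hi]; split_ifs <;> norm_num)
    rcases hd0.eq_or_lt with rfl | hdpos
    · linarith
    · have h2 := mul_lt_mul_of_pos_left (hgenR i) hdpos
      have h3 := mul_le_mul_of_nonneg_right hdδ hR0.le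
      linarith
  · have h1 : 0 ≤ (Pi.single k (1 : ℝ) : V → ℝ) i := by
      by_cases h : i = k
      · subst h; simp
      · simp [h]
    have h2 := mul_nonneg hd0 h1
    have h3 := mul_nonneg he0.le (hτ0 i)
    simp only [Pi.add_apply, Pi.smul_apply, smul_eq_mul, hb, if_neg hi]
    linarith
  · have hterm : ∀ i, (b + e • τ + d • (Pi.single k (1 : ℝ) : V → ℝ)) i * x i ≤
        (1 + κ / 2) * x i - if i = a then x i else 0 := by
      intro i
      have h3 := mul_le_mul_of_nonneg_left (hτM i) he0.le
      have hdκ : d ≤ κ / 4 := hdδ.trans (min_le_right _ _)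
      by_cases hi : i = a
      · subst hi
        simp only [Pi.add_apply, Pi.smul_apply, smul_eq_mul, hb, if_true,
          Pi.single_eq_of_ne hka.symm, if_true]
        have := mul_le_mul_of_nonneg_right (h3.trans heM) (hx.1 i)
        nlinarith [mul_nonneg hκ.le (hx.1 i)]
      · have h4 : (Pi.single k (1 : ℝ) : V → ℝ) i ≤ 1 := by
          by_cases h : i = k
          · subst h; simp
          · simp [h]
        simp only [Pi.add_apply, Pi.smul_apply, smul_eq_mul, hb, if_neg hi, sub_zero]
        refine mul_le_mul_of_nonneg_right ?_ (hx.1 i)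
        have := mul_le_mul_of_nonneg_left h4 hd0
        linarith
    rw [dotL_apply]
    refine (Finset.sum_le_sum fun i _ => hterm i).trans ?_
    rw [Finset.sum_sub_distrib, ← Finset.mul_sum, hx.2, Finset.sum_ite_eq']
    simp only [Finset.mem_univ, if_true]
    linarith

/-- While some coordinate stays away from `0`, a path satisfying condition (A) moves with the
velocity prescribed by its support. -/
lemma sub_eq_integral_velocity {ζ : ℝ → V → ℝ} (hζ : IsPath ζ) (hA : CondA r ζ) {a : V} {κ : ℝ}
    (hκ : 0 < κ) {t₁ t₂ : ℝ} (h1 : 0 ≤ t₁) (h12 : t₁ ≤ t₂)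
    (ha : ∀ s ∈ Set.Icc t₁ t₂, κ ≤ ζ s a) (k : V) :
    ζ t₂ k - ζ t₁ k = ∫ s in t₁..t₂, velocity r (suppF (ζ s)) k := by
  have hne : ∀ k, k ≠ a → ζ t₂ k - ζ t₁ k = ∫ s in t₁..t₂, velocity r (suppF (ζ s)) k := by
    intro k hka
    obtain ⟨β, δ, hδ, hβ⟩ := exists_superharmonic_perturbation hr hirr a k hka hκ
    have hP : ∀ d, (d = 0 ∨ d = δ) → dotL (β + d • Pi.single k (1 : ℝ)) (ζ t₂) -
        dotL (β + d • Pi.single k (1 : ℝ)) (ζ t₁) =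
        ∫ s in t₁..t₂, dotL (β + d • Pi.single k (1 : ℝ)) (velocity r (suppF (ζ s))) := fun d hd =>
      dotL_sub_eq_integral hr hirr hζ hA (hβ d hd).1 (hβ d hd).2.1 (by linarith) h1 h12
        fun s hs => (hβ d hd).2.2 (ζ s) (hζ.2 s (h1.trans hs.1)) (ha s hs)
    have hadd : ∀ x, dotL (β + δ • Pi.single k (1 : ℝ)) x = dotL β x + δ * x k := fun x => by
      simp only [dotL_apply, Pi.add_apply, Pi.smul_apply, smul_eq_mul, add_mul,
        Finset.sum_add_distrib]
      congr 1
      rw [Finset.sum_eq_single k] <;> simp +contextual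
    have h0 := hP 0 (Or.inl rfl)
    have hd := hP δ (Or.inr rfl)
    simp only [zero_smul, add_zero] at h0
    simp only [hadd] at hd
    rw [intervalIntegral.integral_add
      (hζ.intervalIntegrable_suppF (fun A => dotL β (velocity r A)) h1 h12)
      ((hζ.intervalIntegrable_suppF (fun A => velocity r A k) h1 h12).const_mul δ),
      intervalIntegral.integral_const_mul, ← h0] at hd
    have : δ * (ζ t₂ k - ζ t₁ k) = δ * ∫ s in t₁..t₂, velocity r (suppF (ζ s)) k := by linarith
    exact mul_left_cancel₀ hδ.ne' this
  by_cases hka : k = a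
  · subst hka
    have hx : ∀ t, 0 ≤ t → ζ t k = 1 - ∑ i ∈ Finset.univ.erase k, ζ t i := fun t ht => by
      rw [← (hζ.2 t ht).2, ← Finset.add_sum_erase _ _ (Finset.mem_univ k)]; ring
    have hv : ∀ A, velocity r A k = - ∑ i ∈ Finset.univ.erase k, velocity r A i := fun A => by
      have := sum_flow_univ r (serviceRate r A)
      rw [← Finset.add_sum_erase _ _ (Finset.mem_univ k)] at this
      exact eq_neg_of_add_eq_zero_left this
    simp only [hv]
    rw [hx t₂ (h1.trans h12), hx t₁ h1, intervalIntegral.integral_neg,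
      intervalIntegral.integral_finsetSum fun i _ =>
        hζ.intervalIntegrable_suppF (fun A => velocity r A i) h1 h12,
      ← Finset.sum_congr rfl fun i hi => hne i (Finset.ne_of_mem_erase hi),
      Finset.sum_sub_distrib]
    ring
  · exact hne k hka

end IntegralEquation

section Construction

open MeasureTheory Filter Topology

variable {V : Type*} [Fintype V] [DecidableEq V]

/-- Nonempty sets whose balancing service rates do not exceed `1`. For nonempty sets, this is
equivalent to being absorbing. -/
def Stable (r : V → V → ℝ) (A : Finset V) : Prop :=
  A.Nonempty ∧ ∀ i, serviceRate r A i ≤ 1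

omit [DecidableEq V] in
lemma suppF_nonempty {x : V → ℝ} (hx : x ∈ stdSimplex ℝ V) : (suppF x).Nonempty := by
  by_contra h
  rw [Finset.not_nonempty_iff_eq_empty] at h
  have h0 : ∀ i, x i = 0 := fun i => by
    have : ¬ 0 < x i := fun hi => by simpa [h] using mem_suppF.2 hi
    exact le_antisymm (not_lt.1 this) (hx.1 i)
  have := hx.2
  simp [h0] at this

omit [DecidableEq V] in
lemma eq_zero_of_notMem_suppF {x : V → ℝ} (hx : x ∈ stdSimplex ℝ V) {i : V} (hi : i ∉ suppF x) :
    x i = 0 :=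
  le_antisymm (not_lt.1 fun h => hi (mem_suppF.2 h)) (hx.1 i)

omit [DecidableEq V] in
lemma IsPath.shift {ζ : ℝ → V → ℝ} (hζ : IsPath ζ) {τ : ℝ} (hτ : 0 ≤ τ) :
    IsPath fun s => ζ (τ + s) :=
  ⟨hζ.1.comp (continuous_const.add continuous_id).continuousOn
    fun _ hs => add_nonneg hτ hs, fun _ ht => hζ.2 _ (add_nonneg hτ ht)⟩

lemma CondA.shift {r : V → V → ℝ} {ζ : ℝ → V → ℝ} (hζ : IsPath ζ) (hA : CondA r ζ) {τ : ℝ}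
    (hτ : 0 ≤ τ) : CondA r fun s => ζ (τ + s) := by
  intro f hf t ht
  have h := hA.sub_eq hζ hf (add_nonneg hτ le_rfl) (add_nonneg hτ ht)
  rw [← intervalIntegral.integral_comp_add_left (fun s => fderiv ℝ f (ζ s) (lamV r))] at h
  linarith

lemma flow_eq_sum_vvec (r : V → V → ℝ) (σ : V → ℝ) : flow r σ = ∑ k, σ k • vvec r k := by
  ext i
  rw [Finset.sum_apply]
  simp only [flow, vvec, Pi.smul_apply, smul_eq_mul, mul_sub, Finset.sum_sub_distrib, mul_ite,
    mul_one, mul_zero, Finset.sum_ite_eq, Finset.mem_univ, if_true]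
  congr 1
  symm
  rw [Finset.sum_eq_single i]
  · simp [Finset.mul_sum]
  · intro k _ hk
    simp [hk.symm]
  · simp

lemma lamV_eq_sum_vvec (r : V → V → ℝ) : lamV r = ∑ k, vvec r k := by
  have : lamV r = flow r 1 := by
    ext i
    simp [lamV, flow]
  simp [this, flow_eq_sum_vvec]

omit [DecidableEq V] in
/-- Concatenation of a linear piece with a path. -/
lemma isPath_concat {x v : V → ℝ} {τ : ℝ}
    (hmem : ∀ t ∈ Set.Icc 0 τ, x + t • v ∈ stdSimplex ℝ V) {ξ : ℝ → V → ℝ} (hξ : IsPath ξ)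
    (hξ0 : ξ 0 = x + τ • v) : IsPath fun t => if t ≤ τ then x + t • v else ξ (t - τ) := by
  refine ⟨?_, fun t ht => ?_⟩
  · have h1 : ContinuousOn (fun t : ℝ => x + t • v) (Set.Iic τ) := by fun_prop
    have h2 : ContinuousOn (fun t => ξ (t - τ)) (Set.Ici τ) :=
      hξ.1.comp (by fun_prop) fun t ht => Set.mem_Ici.2 (sub_nonneg.2 ht)
    refine Continuous.continuousOn ?_
    exact continuous_if_le continuous_id continuous_const h1 h2 fun t ht => by
      simp [ht, hξ0]
  · simp only
    split_ifs with h
    · exact hmem t ⟨ht, h⟩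
    · exact hξ.2 _ (by linarith)

variable {r : V → V → ℝ} (hr : ∀ i j, 0 ≤ r i j) (hirr : IrreducibleRates r)
include hr hirr

lemma MemD.fderiv_velocity {f : (V → ℝ) → ℝ} (hf : MemD r Finset.univ f) {B : Finset V}
    {x : V → ℝ} (hx : x ∈ stdSimplex ℝ V) (hxB : ∀ k ∉ B, x k = 0) :
    fderiv ℝ f x (velocity r B) = fderiv ℝ f x (lamV r) := by
  rw [velocity, flow_eq_sum_vvec, lamV_eq_sum_vvec, map_sum, map_sum]
  refine Finset.sum_congr rfl fun k _ => ?_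
  by_cases hk : k ∈ B
  · rw [serviceRate_of_mem hr hirr hk, one_smul]
  · rw [map_smul, hf.2 k (Finset.mem_univ k) x hx (hxB k hk), smul_zero]

lemma sub_eq_integral_velocity_of_pos {ζ : ℝ → V → ℝ} (hζ : IsPath ζ) (hA : CondA r ζ) {a : V}
    {t₁ t₂ : ℝ} (h1 : 0 ≤ t₁) (h12 : t₁ ≤ t₂) (ha : ∀ s ∈ Set.Icc t₁ t₂, 0 < ζ s a) (k : V) :
    ζ t₂ k - ζ t₁ k = ∫ s in t₁..t₂, velocity r (suppF (ζ s)) k := by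
  have hc : ContinuousOn (fun s => ζ s a) (Set.Icc t₁ t₂) :=
    (continuous_apply a).comp_continuousOn (hζ.1.mono fun s hs => h1.trans hs.1)
  obtain ⟨s₀, hs₀, hmin⟩ := isCompact_Icc.exists_isMinOn ⟨t₁, le_rfl, h12⟩ hc
  exact sub_eq_integral_velocity hr hirr hζ hA (ha s₀ hs₀) h1 h12 (fun s hs => hmin hs) k

lemma eq_add_smul_velocity {ζ : ℝ → V → ℝ} (hζ : IsPath ζ) (hA : CondA r ζ) {C : Finset V}
    {t₁ t₂ : ℝ} (h1 : 0 ≤ t₁) (h12 : t₁ ≤ t₂) (hC : ∀ s ∈ Set.Icc t₁ t₂, suppF (ζ s) = C) :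
    ζ t₂ = ζ t₁ + (t₂ - t₁) • velocity r C := by
  obtain ⟨a, ha⟩ := suppF_nonempty (hζ.2 t₁ h1)
  rw [hC t₁ ⟨le_rfl, h12⟩] at ha
  ext k
  have h := sub_eq_integral_velocity_of_pos hr hirr hζ hA (a := a) h1 h12
    (fun s hs => mem_suppF.1 (by rwa [hC s hs])) k
  have hcongr : ∫ s in t₁..t₂, velocity r (suppF (ζ s)) k =
      ∫ _ in t₁..t₂, velocity r C k :=
    intervalIntegral.integral_congr fun s hs => by
      rw [Set.uIcc_of_le h12] at hs
      simp only [hC s hs]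
  rw [hcongr, intervalIntegral.integral_const, smul_eq_mul] at h
  simp only [Pi.add_apply, Pi.smul_apply, smul_eq_mul]
  linarith

/-- A path whose support is stable is linear for a short time. -/
lemma exists_linear {ζ : ℝ → V → ℝ} (hζ : IsPath ζ) (hA : CondA r ζ) {t : ℝ} (ht : 0 ≤ t)
    (hS : Stable r (suppF (ζ t))) : ∃ δ > 0, ∀ s ∈ Set.Icc t (t + δ),
      ζ s = ζ t + (s - t) • velocity r (suppF (ζ t)) := by
  set A := suppF (ζ t) with hAdef
  have hev : ∀ᶠ s in 𝓝[≥] t, ∀ i, i ∈ A → 0 < ζ s i := by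
    refine eventually_all.2 fun i => ?_
    by_cases hi : i ∈ A
    · have hc : Tendsto (fun s => ζ s i) (𝓝[≥] t) (𝓝 (ζ t i)) :=
        ((continuous_apply i).comp_continuousOn hζ.1 t ht).mono_left
          (nhdsWithin_mono _ fun s hs => ht.trans hs)
      filter_upwards [hc.eventually_const_lt (mem_suppF.1 hi)] with s hs _ using hs
    · exact Eventually.of_forall fun s h => absurd h hi
  obtain ⟨T, hT, hTsub⟩ := mem_nhdsGE_iff_exists_Icc_subset.1 hev
  have hTt : t < T := hT
  have hpos : ∀ s ∈ Set.Icc t T, ∀ i ∈ A, 0 < ζ s i := fun s hs => hTsub hs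
  obtain ⟨a, ha⟩ := hS.1
  have hsupp : ∀ s ∈ Set.Icc t T, suppF (ζ s) = A := by
    intro s hs
    have hsx := hζ.2 s (ht.trans hs.1)
    have hint : ∀ k ∈ Aᶜ, ζ s k = ∫ q in t..s, velocity r (suppF (ζ q)) k := fun k hk => by
      rw [← sub_eq_integral_velocity_of_pos hr hirr hζ hA ht hs.1
        (fun q hq => hpos q ⟨hq.1, hq.2.trans hs.2⟩ a ha) k,
        eq_zero_of_notMem_suppF (hζ.2 t ht) (Finset.mem_compl.1 hk), sub_zero]
    have hsum : ∑ k ∈ Aᶜ, ζ s k ≤ 0 := by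
      rw [Finset.sum_congr rfl hint, ← intervalIntegral.integral_finsetSum fun k _ =>
        hζ.intervalIntegrable_suppF (fun B => velocity r B k) ht hs.1]
      rw [← neg_nonneg, ← intervalIntegral.integral_neg]
      refine intervalIntegral.integral_nonneg hs.1 fun q hq => neg_nonneg.2 ?_
      exact sum_compl_velocity_nonpos hr hirr hS.1
        (fun i hi => mem_suppF.2 (hpos q ⟨hq.1, hq.2.trans hs.2⟩ i hi)) hS.2
    have hzero := (Finset.sum_eq_zero_iff_of_nonneg fun k _ => hsx.1 k).1
      (le_antisymm hsum (Finset.sum_nonneg fun k _ => hsx.1 k))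
    ext i
    refine ⟨fun hi => by_contra fun h => ?_, fun hi => mem_suppF.2 (hpos s hs i hi)⟩
    exact (mem_suppF.1 hi).ne' (hzero i (Finset.mem_compl.2 h))
  refine ⟨T - t, sub_pos.2 hTt, fun s hs => ?_⟩
  rw [add_sub_cancel] at hs
  exact eq_add_smul_velocity hr hirr hζ hA ht hs.1 fun q hq =>
    hsupp q ⟨hq.1, hq.2.trans hs.2⟩

/-- A path that starts linearly stays linear until the line leaves the open face. -/
lemma linear_continuation {ζ : ℝ → V → ℝ} (hζ : IsPath ζ) (hA : CondA r ζ) {B : Finset V}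
    (hB : Stable r B) {τ δ : ℝ}
    (hsupp : ∀ t ∈ Set.Ioo 0 τ, suppF (ζ 0 + t • velocity r B) = B) (hδ : 0 < δ)
    (hlin : ∀ s ∈ Set.Icc 0 δ, ζ s = ζ 0 + s • velocity r B) :
    ∀ s ∈ Set.Icc 0 τ, ζ s = ζ 0 + s • velocity r B := by
  refine IsClosed.Icc_subset_of_forall_mem_nhdsWithin
    (s := {s | ζ s = ζ 0 + s • velocity r B}) ?_ (by simp) ?_
  · have hc : ContinuousOn (fun s => ζ s - (ζ 0 + s • velocity r B)) (Set.Icc 0 τ) :=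
      (hζ.1.mono fun s hs => hs.1).sub (by fun_prop)
    have := hc.preimage_isClosed_of_isClosed isClosed_Icc (isClosed_singleton (x := 0))
    convert this using 1
    ext s
    simp [sub_eq_zero, and_comm]
  · rintro y ⟨hy, hy0, hyτ⟩
    rcases hy0.eq_or_lt with rfl | hpos
    · filter_upwards [Ioc_mem_nhdsGT hδ] with s hs using hlin s ⟨hs.1.le, hs.2⟩
    · have hs := hsupp y ⟨hpos, hyτ⟩
      have hy' : ζ y = ζ 0 + y • velocity r B := hy
      rw [← hy'] at hs
      obtain ⟨ε, hε, h⟩ := exists_linear hr hirr hζ hA hy0 (by rwa [hs])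
      filter_upwards [Ioc_mem_nhdsGT (lt_add_of_pos_right y hε)] with s hs'
      have := h s ⟨hs'.1.le, hs'.2⟩
      rw [hs, hy', add_assoc, ← add_smul, add_sub_cancel] at this
      exact this


lemma exists_first_exit {B : Finset V} (hB : Stable r B) {x : V → ℝ} (hx : x ∈ stdSimplex ℝ V)
    (hxB : suppF x ⊆ B) (hv : ∀ i ∈ B, i ∉ suppF x → 0 < velocity r B i)
    (hne : velocity r B ≠ 0) :
    ∃ τ : ℝ, 0 < τ ∧ (∀ t ∈ Set.Icc 0 τ, x + t • velocity r B ∈ stdSimplex ℝ V) ∧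
      (∀ t ∈ Set.Ioo 0 τ, suppF (x + t • velocity r B) = B) ∧
      Stable r (suppF (x + τ • velocity r B)) ∧ suppF (x + τ • velocity r B) ⊂ B := by
  set v := velocity r B with hvdef
  have hv0 : ∀ i ∉ B, v i = 0 := fun i hi => velocity_of_notMem hr hirr hB.1 hi
  have hsum : ∑ i, v i = 0 := sum_flow_univ r _
  have hx0 : ∀ i ∉ suppF x, x i = 0 := fun i hi => eq_zero_of_notMem_suppF hx hi
  obtain ⟨j₁, hj₁⟩ : ∃ j, v j < 0 := by
    by_contra! h
    exact hne (funext fun i => (Finset.sum_eq_zero_iff_of_nonneg fun i _ => h i).1 hsum i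
      (Finset.mem_univ i))
  have hxpos : ∀ j, v j < 0 → 0 < x j := by
    intro j hj
    by_contra h
    have hjS : j ∉ suppF x := fun h' => h (mem_suppF.1 h')
    by_cases hjB : j ∈ B
    · exact (hv j hjB hjS).not_gt hj
    · exact hj.ne (hv0 j hjB)
  obtain ⟨j₀, hj₀, hmin⟩ := Finset.exists_min_image (Finset.univ.filter fun j => v j < 0)
    (fun j => x j / -v j) ⟨j₁, by simpa using hj₁⟩
  simp only [Finset.mem_filter, Finset.mem_univ, true_and] at hj₀ hmin
  set τ := x j₀ / -v j₀ with hτ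
  have hτ0 : 0 < τ := div_pos (hxpos j₀ hj₀) (neg_pos.2 hj₀)
  have hneg : ∀ j, v j < 0 → 0 ≤ x j + τ * v j := fun j hj => by
    have := (le_div_iff₀ (neg_pos.2 hj)).1 (hmin j hj)
    linarith
  have hcoord : ∀ t i, (x + t • v) i = x i + t * v i := fun t i => by simp
  have hpos : ∀ t ∈ Set.Ioo 0 τ, ∀ i ∈ B, 0 < x i + t * v i := by
    intro t ht i hi
    rcases lt_or_ge (v i) 0 with h | h
    · have := mul_lt_mul_of_neg_right ht.2 h
      linarith [hneg i h]
    · by_cases his : i ∈ suppF x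
      · have := mul_nonneg ht.1.le h
        linarith [mem_suppF.1 his]
      · have := mul_pos ht.1 (hv i hi his)
        linarith [hx.1 i]
  have hend : ∀ i ∈ B, i ∉ suppF (x + τ • v) → v i < 0 := by
    intro i hi his
    by_contra! h
    refine his (mem_suppF.2 ?_)
    rw [hcoord]
    by_cases his : i ∈ suppF x
    · have := mul_nonneg hτ0.le h
      linarith [mem_suppF.1 his]
    · have := mul_pos hτ0 (hv i hi his)
      linarith [hx.1 i]
  have hmem : ∀ t ∈ Set.Icc 0 τ, x + t • v ∈ stdSimplex ℝ V := by
    intro t ht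
    refine ⟨fun i => ?_, ?_⟩
    · rw [hcoord]
      rcases lt_or_ge (v i) 0 with h | h
      · have := mul_le_mul_of_nonpos_right ht.2 h.le
        linarith [hneg i h]
      · have := mul_nonneg ht.1 h
        linarith [hx.1 i]
    · simp only [hcoord, Finset.sum_add_distrib, ← Finset.mul_sum, hsum, hx.2]
      simp
  have hsub : ∀ t : ℝ, suppF (x + t • v) ⊆ B := by
    intro t i hi
    by_contra h
    have := mem_suppF.1 hi
    rw [hcoord, hx0 i fun h' => h (hxB h'), hv0 i h] at this
    simp at this
  have hssub : suppF (x + τ • v) ⊂ B := by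
    refine (Finset.ssubset_iff_of_subset (hsub τ)).2 ⟨j₀, ?_, fun h => ?_⟩
    · exact by_contra fun h => hj₀.ne (hv0 j₀ h)
    · have h1 := mem_suppF.1 h
      rw [hcoord, hτ, div_neg, neg_mul, div_mul_cancel₀ _ hj₀.ne] at h1
      linarith
  have hS := suppF_nonempty (hmem τ ⟨hτ0.le, le_rfl⟩)
  refine ⟨τ, hτ0, hmem, fun t ht => ?_, ⟨hS, ?_⟩, hssub⟩
  · refine (hsub t).antisymm fun i hi => mem_suppF.2 ?_
    rw [hcoord]
    exact hpos t ht i hi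
  · exact serviceRate_le_one_of_subset hr hirr hS hssub.1 hB.2 fun i hi his => (hend i hi his).le


lemma condA_concat {B : Finset V} {x : V → ℝ} (hx : ∀ k ∉ B, x k = 0) (hB : B.Nonempty) {τ : ℝ}
    (hτ : 0 ≤ τ) (hmem : ∀ t ∈ Set.Icc 0 τ, x + t • velocity r B ∈ stdSimplex ℝ V)
    {ξ : ℝ → V → ℝ} (hξ : IsPath ξ) (hA : CondA r ξ) (hξ0 : ξ 0 = x + τ • velocity r B) :
    CondA r fun t => if t ≤ τ then x + t • velocity r B else ξ (t - τ) := by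
  set v := velocity r B with hv
  set ζ : ℝ → V → ℝ := fun t => if t ≤ τ then x + t • v else ξ (t - τ) with hζdef
  have hζ : IsPath ζ := isPath_concat hmem hξ hξ0
  have hlin : ∀ t ≤ τ, ζ t = x + t • v := fun t ht => if_pos ht
  have htail : ∀ t, τ ≤ t → ζ t = ξ (t - τ) := fun t ht => by
    rcases ht.eq_or_lt with rfl | h
    · rw [hlin _ le_rfl, sub_self, hξ0]
    · exact if_neg h.not_ge
  intro f hf
  have hfirst : ∀ t, 0 ≤ t → t ≤ τ →
      ∫ s in (0 : ℝ)..t, fderiv ℝ f (ζ s) (lamV r) = f (ζ t) - f (ζ 0) := by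
    intro t ht htτ
    have hder : ∀ s ∈ Set.uIcc 0 t,
        HasDerivAt (fun s => f (x + s • v)) (fderiv ℝ f (ζ s) (lamV r)) s := by
      intro s hs
      rw [Set.uIcc_of_le ht] at hs
      have hsm := hmem s ⟨hs.1, hs.2.trans htτ⟩
      rw [hlin s (hs.2.trans htτ), ← hf.fderiv_velocity hr hirr (B := B) hsm fun k hk => by
        simp [hx k hk, hv, velocity_of_notMem hr hirr hB hk]]
      have hl : HasDerivAt (fun s : ℝ => x + s • v) v s := by
        simpa using ((hasDerivAt_id s).smul_const v).const_add x
      exact (hf.hasFDerivAt hsm).comp_hasDerivAt s hl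
    rw [intervalIntegral.integral_eq_sub_of_hasDerivAt hder
      (hζ.intervalIntegrable_fderiv hf _ le_rfl ht), hlin t htτ, hlin 0 hτ]
  intro t ht
  rcases le_total t τ with h | h
  · rw [hfirst t ht h]
    ring
  · have h2 : ∫ s in τ..t, fderiv ℝ f (ζ s) (lamV r) = f (ζ t) - f (ζ τ) := by
      have hcongr : ∫ s in τ..t, fderiv ℝ f (ζ s) (lamV r) =
          ∫ s in τ..t, fderiv ℝ f (ξ (s - τ)) (lamV r) :=
        intervalIntegral.integral_congr fun s hs => by
          rw [Set.uIcc_of_le h] at hs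
          simp only [htail s hs.1]
      rw [hcongr, intervalIntegral.integral_comp_sub_right fun s => fderiv ℝ f (ξ s) (lamV r),
        sub_self, htail t h, htail τ le_rfl, hA f hf _ (sub_nonneg.2 h), sub_self]
      ring
    rw [← intervalIntegral.integral_add_adjacent_intervals
      (hζ.intervalIntegrable_fderiv hf _ le_rfl hτ) (hζ.intervalIntegrable_fderiv hf _ hτ ht),
      hfirst τ hτ le_rfl, h2]
    ring

/-- From a configuration from which the face of `B` is entered with positive velocity, there is
a unique solution starting off with velocity `velocity r B`. -/
lemma exists_path_of_stable (B : Finset V) : Stable r B → ∀ x ∈ stdSimplex ℝ V, suppF x ⊆ B →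
    (∀ i ∈ B, i ∉ suppF x → 0 < velocity r B i) →
    ∃ ζ : ℝ → V → ℝ, IsPath ζ ∧ ζ 0 = x ∧ CondA r ζ ∧
      (∀ t, 0 < t → Stable r (suppF (ζ t)) ∧ suppF (ζ t) ⊆ B) ∧
      ∀ ζ' : ℝ → V → ℝ, IsPath ζ' → CondA r ζ' → ζ' 0 = x →
        (∃ δ > 0, ∀ s ∈ Set.Icc 0 δ, ζ' s = x + s • velocity r B) →
        ∀ t, 0 ≤ t → ζ' t = ζ t := by
  induction B using Finset.strongInduction with
  | H B ih =>
  intro hB x hx hxB hv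
  have hx0 : ∀ i ∉ suppF x, x i = 0 := fun i hi => eq_zero_of_notMem_suppF hx hi
  by_cases hne : velocity r B = 0
  · have hsupp : suppF x = B := hxB.antisymm fun i hi => by
      by_contra h
      simpa [hne] using hv i hi h
    refine ⟨fun _ => x, ⟨continuousOn_const, fun _ _ => hx⟩, rfl, ?_, fun t _ => ?_, ?_⟩
    · intro f hf t _
      have := hf.fderiv_velocity hr hirr (B := B) hx fun k hk => hx0 k (by rwa [hsupp])
      simp [← this, hne]
    · simp only [hsupp]
      exact ⟨hB, Finset.Subset.rfl⟩
    · rintro ζ' hζ' hA' rfl ⟨δ, hδ, hlin⟩ t ht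
      have := linear_continuation hr hirr hζ' hA' hB (τ := t) (by simp [hne, hsupp]) hδ hlin t
        ⟨ht, le_rfl⟩
      simpa [hne] using this
  · obtain ⟨τ, hτ, hmem, hopen, hstab, hss⟩ := exists_first_exit hr hirr hB hx hxB hv hne
    obtain ⟨ξ, hξ, hξ0, hξA, hξS, hξu⟩ := ih _ hss hstab _ (hmem τ ⟨hτ.le, le_rfl⟩)
      Finset.Subset.rfl fun i hi h => absurd hi h
    refine ⟨fun t => if t ≤ τ then x + t • velocity r B else ξ (t - τ),
      isPath_concat hmem hξ hξ0, by simp [hτ.le],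
      condA_concat hr hirr (fun k hk => hx0 k fun h => hk (hxB h)) hB.1 hτ.le hmem hξ hξA hξ0,
      fun t ht => ?_, ?_⟩
    · simp only
      split_ifs with h
      · rcases h.eq_or_lt with rfl | h
        · exact ⟨hstab, hss.1⟩
        · rw [hopen t ⟨ht, h⟩]
          exact ⟨hB, Finset.Subset.rfl⟩
      · have := hξS (t - τ) (by linarith)
        exact ⟨this.1, this.2.trans hss.1⟩
    · rintro ζ' hζ' hA' rfl ⟨δ, hδ, hlin⟩ t ht
      have hcont := linear_continuation hr hirr hζ' hA' hB hopen hδ hlin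
      simp only
      split_ifs with h
      · exact hcont t ⟨ht, h⟩
      · have hτeq := hcont τ ⟨hτ.le, le_rfl⟩
        obtain ⟨ε, hε, hloc⟩ := exists_linear hr hirr hζ' hA' hτ.le (by rwa [hτeq])
        have := hξu (fun s => ζ' (τ + s)) (hζ'.shift hτ.le) (hA'.shift hζ' hτ.le)
          (by simpa using hτeq) ⟨ε, hε, fun s hs => by
            have := hloc (τ + s) ⟨by linarith [hs.1], by linarith [hs.2]⟩
            rwa [hτeq, add_sub_cancel_left] at this⟩ (t - τ) (by linarith)
        simpa using this

/-- Once the support is stable it stays stable and can only shrink. -/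
lemma stable_of_le {ζ : ℝ → V → ℝ} (hζ : IsPath ζ) (hA : CondA r ζ) {s t : ℝ} (hs : 0 ≤ s)
    (hst : s ≤ t) (hS : Stable r (suppF (ζ s))) :
    Stable r (suppF (ζ t)) ∧ suppF (ζ t) ⊆ suppF (ζ s) := by
  rcases hst.eq_or_lt with rfl | hst
  · exact ⟨hS, Finset.Subset.rfl⟩
  obtain ⟨ξ, -, -, -, hξS, hξu⟩ := exists_path_of_stable hr hirr (suppF (ζ s)) hS (ζ s)
    (hζ.2 s hs) Finset.Subset.rfl fun i hi h => absurd hi h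
  obtain ⟨δ, hδ, hlin⟩ := exists_linear hr hirr hζ hA hs hS
  have := hξu (fun q => ζ (s + q)) (hζ.shift hs) (hA.shift hζ hs) (by simp) ⟨δ, hδ, fun q hq => by
    have := hlin (s + q) ⟨by linarith [hq.1], by linarith [hq.2]⟩
    rwa [add_sub_cancel_left] at this⟩ (t - s) (by linarith)
  simp only [add_sub_cancel] at this
  rw [this]
  exact hξS _ (by linarith)

/-- The initial face and velocity of a path whose supports are stable at positive times. -/
lemma exists_initial_face {ζ : ℝ → V → ℝ} (hζ : IsPath ζ) (hA : CondA r ζ)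
    (hS : ∀ t, 0 < t → Stable r (suppF (ζ t))) :
    ∃ C, Stable r C ∧ suppF (ζ 0) ⊆ C ∧ (∀ i ∈ C, i ∉ suppF (ζ 0) → 0 < velocity r C i) ∧
      ∃ δ > 0, ∀ s ∈ Set.Icc 0 δ, ζ s = ζ 0 + s • velocity r C := by
  obtain ⟨C, ⟨t₁, ht₁, rfl⟩, hmax⟩ := Set.exists_max_image
    {A : Finset V | ∃ t, 0 < t ∧ suppF (ζ t) = A} Finset.card (Set.toFinite _)
    ⟨_, 1, one_pos, rfl⟩
  set C := suppF (ζ t₁) with hC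
  have hconst : ∀ t ∈ Set.Ioc 0 t₁, suppF (ζ t) = C := fun t ht =>
    (Finset.eq_of_subset_of_card_le (stable_of_le hr hirr hζ hA ht.1.le ht.2 (hS t ht.1)).2
      (hmax _ ⟨t, ht.1, rfl⟩)).symm
  have hlin : ∀ s ∈ Set.Icc 0 t₁, ζ s = ζ 0 + s • velocity r C := by
    intro s hs
    rcases hs.1.eq_or_lt with rfl | hs0
    · simp
    have hc : ContinuousOn (fun t => ζ t + (s - t) • velocity r C) (Set.Ici 0) :=
      hζ.1.add (by fun_prop)
    have hlim := (hc 0 Set.self_mem_Ici).mono_left (nhdsWithin_mono _ Set.Ioi_subset_Ici_self)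
    simp only [sub_zero] at hlim
    refine tendsto_nhds_unique (tendsto_const_nhds.congr' ?_) hlim
    filter_upwards [Ioc_mem_nhdsGT hs0] with t ht
    exact eq_add_smul_velocity hr hirr hζ hA ht.1.le ht.2 fun q hq =>
      hconst q ⟨ht.1.trans_le hq.1, hq.2.trans hs.2⟩
  have h1 : ∀ i, ζ t₁ i = ζ 0 i + t₁ * velocity r C i := fun i => by
    have := congrFun (hlin t₁ ⟨ht₁.le, le_rfl⟩) i
    simpa using this
  refine ⟨C, hS t₁ ht₁, fun i hi => ?_, fun i hi h => ?_, t₁, ht₁, hlin⟩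
  · by_contra h
    have := h1 i
    rw [velocity_of_notMem hr hirr (hS t₁ ht₁).1 h,
      eq_zero_of_notMem_suppF (hζ.2 t₁ ht₁.le) h] at this
    linarith [mem_suppF.1 hi]
  · have := mem_suppF.1 hi
    rw [h1 i, eq_zero_of_notMem_suppF (hζ.2 0 le_rfl) h, zero_add] at this
    exact pos_of_mul_pos_right this ht₁.le

/-- The initial face prescribed by an initial support. -/
lemma exists_stable_superset {S : Finset V} (hS : S.Nonempty) :
    ∃ B, Stable r B ∧ S ⊆ B ∧ ∀ i ∈ B, i ∉ S → 0 < velocity r B i := by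
  obtain ⟨B, ⟨hB, hSB⟩, hmin⟩ := Set.exists_min_image
    {B : Finset V | Stable r B ∧ S ⊆ B} Finset.card (Set.toFinite _)
    ⟨Finset.univ, ⟨hS.mono (Finset.subset_univ S), fun i =>
      (serviceRate_of_mem hr hirr (Finset.mem_univ i)).le⟩, Finset.subset_univ S⟩
  refine ⟨B, hB, hSB, fun i hi hiS => ?_⟩
  by_contra! h
  have hsub : S ⊆ B.erase i := fun j hj => Finset.mem_erase.2 ⟨fun h => hiS (h ▸ hj), hSB hj⟩
  have hne := hS.mono hsub
  have hle := hmin (B.erase i) ⟨⟨hne, serviceRate_le_one_of_subset hr hirr hne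
    (Finset.erase_subset i B) hB.2 fun j hj hj' => by
      have : j = i := by_contra fun hji => hj' (Finset.mem_erase.2 ⟨hji, hj⟩)
      rwa [this]⟩, hsub⟩
  exact (Finset.card_erase_lt_of_mem hi).not_ge hle

end Construction

/-- well-posedness of the `(λ, D_V)`-problem: for every `u ∈ Σ` there is
exactly one continuous path in `Σ` starting at `u` satisfying conditions (A) and (B)
(uniqueness for nonnegative times). -/
theorem wellposedness (V : Type*) [Fintype V] [DecidableEq V] [Nonempty V]
    (r : V → V → ℝ) (hr_nonneg : ∀ i j, 0 ≤ r i j) (hr_diag : ∀ i, r i i = 0)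
    (hr_irr : IrreducibleRates r)
    (ind : Finset V → V → V → ℝ) (hind : IsHarmFamily r ind)
    (u : V → ℝ) (hu : u ∈ stdSimplex ℝ V) :
    ∃ ζ : ℝ → V → ℝ,
      (IsPath ζ ∧ ζ 0 = u ∧ CondA r ζ ∧ CondB r ind ζ) ∧
      ∀ ζ' : ℝ → V → ℝ,
        (IsPath ζ' ∧ ζ' 0 = u ∧ CondA r ζ' ∧ CondB r ind ζ') →
        ∀ t : ℝ, 0 ≤ t → ζ' t = ζ t := by
  obtain ⟨B, hB, huB, hBv⟩ := exists_stable_superset hr_nonneg hr_irr (suppF_nonempty hu)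
  obtain ⟨ζ, hζ, hζ0, hζA, hζS, hζu⟩ :=
    exists_path_of_stable hr_nonneg hr_irr B hB u hu huB hBv
  have habs : ∀ x ∈ stdSimplex ℝ V, IsAbsorbing r ind (suppF x) ↔ Stable r (suppF x) :=
    fun x hx => (isAbsorbing_iff hr_nonneg hr_irr hind (suppF_nonempty hx)).trans
      ⟨fun h => ⟨suppF_nonempty hx, h⟩, fun h => h.2⟩
  refine ⟨ζ, ⟨hζ, hζ0, hζA, fun ε hε => ⟨ε / 2, by linarith, by linarith, ?_⟩⟩, ?_⟩
  · have hmem := hζ.2 (ε / 2) (by linarith)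
    exact ⟨hmem, (habs _ hmem).2 (hζS _ (half_pos hε)).1⟩
  · rintro ζ' ⟨hζ', rfl, hA', hB'⟩
    have hstable : ∀ t, 0 < t → Stable r (suppF (ζ' t)) := fun t ht => by
      obtain ⟨s, hs, hst, hmem, hsabs⟩ := hB' t ht
      exact (stable_of_le hr_nonneg hr_irr hζ' hA' hs hst.le ((habs _ hmem).1 hsabs)).1
    obtain ⟨C, hC, huC, hCv, hlin⟩ := exists_initial_face hr_nonneg hr_irr hζ' hA' hstable
    have hS := suppF_nonempty hu
    have hCB : C = B :=
      (subset_of_velocity_pos hr_nonneg hr_irr hS huC huB hC.2 hB.2 hCv).antisymm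
        (subset_of_velocity_pos hr_nonneg hr_irr hS huB huC hB.2 hC.2 hBv)
    exact hζu ζ' hζ' hA' rfl (hCB ▸ hlin)
end

section
/- A nonempty subset A ⊆ V is r-absorbing if and only if the following holds: for every u ∈ Σ with ∑_{j∈A} u(j) = 1 and every continuous path ζ : [0,∞) → Σ with ζ_0 = u satisfying conditions (A) and (B), one has ∑_{j∈A} ζ_t(j) = 1 for all t ≥ 0. -/
open Finset

namespace ZeroRange

variable {V : Type*} [Fintype V] {r : V → V → ℝ} {A B C S : Finset V}

/-! ### Supports -/

lemma mem_suppF {u : V → ℝ} {i : V} : i ∈ suppF u ↔ 0 < u i := by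
  simp [suppF]

lemma eq_zero_of_notMem_suppF {u : V → ℝ} (hu : u ∈ stdSimplex ℝ V) {i : V}
    (hi : i ∉ suppF u) : u i = 0 :=
  le_antisymm (not_lt.1 (mt mem_suppF.2 hi)) (hu.1 i)

lemma suppF_nonempty {u : V → ℝ} (hu : u ∈ stdSimplex ℝ V) : (suppF u).Nonempty := by
  rw [nonempty_iff_ne_empty]
  intro h
  have := hu.2
  rw [sum_eq_zero fun i _ => eq_zero_of_notMem_suppF hu (by simp [h])] at this
  exact zero_ne_one this

/-! ### The flux operator and the balance equation -/

/-- Nonnegative rates under which every proper nonempty set of sites can be left. -/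
structure Escaping (r : V → V → ℝ) : Prop where
  nonneg : ∀ i j, 0 ≤ r i j
  escape : ∀ P : Finset V, P.Nonempty → P ≠ univ → ∃ k ∈ P, ∃ l, l ∉ P ∧ 0 < r k l

lemma Escaping.of_irreducible (h0 : ∀ i j, 0 ≤ r i j) (h : IrreducibleRates r) :
    Escaping r := by
  refine ⟨h0, fun P ⟨i, hi⟩ hP => ?_⟩
  obtain ⟨j, hj⟩ : ∃ j, j ∉ P := by simpa [Finset.eq_univ_iff_forall] using hP
  obtain ⟨m, k, hk0, hkm, hk⟩ := h i j (by rintro rfl; exact hj hi)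
  by_contra! hcon
  have hmem : ∀ l ≤ m, k l ∈ P := by
    intro l
    induction l with
    | zero => intro _; rwa [hk0]
    | succ l ih =>
      intro hl
      by_contra hn
      exact absurd (hk l hl) (not_lt.2 (hcon _ (ih (by omega)) _ hn))
  exact hj (hkm ▸ hmem m le_rfl)

/-- The net mass flux into each site when site `k` emits mass at rate `p k`;
this is the vector `∑ k, p k • v_k`. -/
def flux (r : V → V → ℝ) : (V → ℝ) →ₗ[ℝ] (V → ℝ) where
  toFun p j := ∑ k, p k * r k j - p j * ∑ k, r j k
  map_add' p q := by
    ext j; simp only [Pi.add_apply, add_mul, sum_add_distrib]; ring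
  map_smul' c p := by
    ext j
    simp only [Pi.smul_apply, smul_eq_mul, RingHom.id_apply, mul_assoc, mul_sub, mul_sum]

lemma flux_apply (p : V → ℝ) (j : V) :
    flux r p j = ∑ k, p k * r k j - p j * ∑ k, r j k := rfl

lemma sum_flux_mul (p w : V → ℝ) :
    ∑ j, flux r p j * w j = ∑ k, p k * ∑ l, r k l * (w l - w k) := by
  simp only [flux_apply, sub_mul, sum_sub_distrib, mul_sub, sum_mul, mul_sum]
  congr 1
  · rw [sum_comm]
    exact sum_congr rfl fun _ _ => sum_congr rfl fun _ _ => by ring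
  · exact sum_congr rfl fun _ _ => sum_congr rfl fun _ _ => by ring

lemma sum_flux (p : V → ℝ) : ∑ j, flux r p j = 0 := by
  simpa using sum_flux_mul (r := r) p 1

lemma sum_add_smul_flux {u : V → ℝ} (hu : ∑ i, u i = 1) (t : ℝ) (p : V → ℝ) :
    ∑ i, (u + t • flux r p) i = 1 := by
  simp [sum_add_distrib, hu, ← mul_sum, sum_flux]

lemma lamV_eq_flux : lamV r = flux r 1 := by
  ext j; simp [lamV, flux_apply]

/-- A vector vanishing at a site, nonpositive elsewhere, has nonpositive flux there. -/
lemma flux_nonpos_of_eq_zero (hr : Escaping r) {d : V → ℝ} (hd : ∀ k, d k ≤ 0) {j : V}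
    (hj : d j = 0) : flux r d j ≤ 0 := by
  rw [flux_apply, hj, zero_mul, sub_zero]
  exact sum_nonpos fun k _ => mul_nonpos_of_nonpos_of_nonneg (hd k) (hr.nonneg k j)

variable [DecidableEq V]

lemma vvec_eq_flux (i : V) : vvec r i = flux r (Pi.single i 1) := by
  ext l
  simp only [vvec, flux_apply, mul_sub, sum_sub_distrib, Pi.single_apply, mul_ite, mul_one,
    mul_zero, ite_mul, one_mul, zero_mul, sum_ite_eq, sum_ite_eq', mem_univ, if_true]
  by_cases h : l = i <;> simp [h]

lemma flux_eq_sum_vvec (p : V → ℝ) : flux r p = ∑ i, p i • vvec r i := by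
  conv_lhs => rw [pi_eq_sum_univ p, map_sum]
  refine sum_congr rfl fun i _ => ?_
  rw [map_smul, vvec_eq_flux]
  congr 2
  ext j
  simp [Pi.single_apply, eq_comm]

/-- Maximum principle. -/
lemma nonpos_of_flux_nonneg (hr : Escaping r) (hA : A.Nonempty) {d : V → ℝ}
    (h1 : ∀ j ∈ A, d j ≤ 0) (h2 : ∀ j ∉ A, 0 ≤ flux r d j) (j : V) : d j ≤ 0 := by
  by_contra! hj
  set P : Finset V := univ.filter fun i => 0 < d i with hP
  have memP : ∀ i, i ∈ P ↔ 0 < d i := fun i => by simp [hP]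
  obtain ⟨a, ha⟩ := hA
  have haP : a ∉ P := by rw [memP]; exact not_lt.2 (h1 a ha)
  obtain ⟨k, hk, l, hl, hkl⟩ := hr.escape P ⟨j, (memP j).2 hj⟩
    (fun h => haP (h ▸ mem_univ a))
  have hsum : 0 ≤ ∑ i, flux r d i * (if i ∈ P then 1 else 0) := by
    refine sum_nonneg fun i _ => ?_
    split_ifs with hi
    · simpa using h2 i fun hiA => absurd (h1 i hiA) (not_le.2 ((memP i).1 hi))
    · simp
  rw [sum_flux_mul] at hsum
  have hterm : ∀ i m, d i * (r i m * ((if m ∈ P then (1 : ℝ) else 0) - if i ∈ P then 1 else 0))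
      ≤ 0 := by
    intro i m
    by_cases hi : i ∈ P <;> by_cases hm : m ∈ P <;> simp only [hi, hm, if_true, if_false]
    · simp
    · have := mul_nonneg ((memP i).1 hi).le (hr.nonneg i m)
      linarith
    · have := mul_nonneg (neg_nonneg.2 (not_lt.1 (mt (memP i).2 hi))) (hr.nonneg i m)
      linarith
    · simp
  simp only [mul_sum] at hsum
  have hrow : ∀ i, ∑ m, d i * (r i m * ((if m ∈ P then (1 : ℝ) else 0) - if i ∈ P then 1 else 0))
      ≤ 0 := fun i => sum_nonpos fun m _ => hterm i m
  have h0 := (sum_eq_zero_iff_of_nonpos fun i _ => hrow i).1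
    (le_antisymm (sum_nonpos fun i _ => hrow i) hsum) k (mem_univ k)
  have h00 := (sum_eq_zero_iff_of_nonpos fun m _ => hterm k m).1 h0 l (mem_univ l)
  simp only [hk, hl, if_true, if_false] at h00
  have := mul_pos ((memP k).1 hk) hkl
  linarith

lemma nonneg_of_flux_nonpos (hr : Escaping r) (hA : A.Nonempty) {d : V → ℝ}
    (h1 : ∀ j ∈ A, 0 ≤ d j) (h2 : ∀ j ∉ A, flux r d j ≤ 0) (j : V) : 0 ≤ d j := by
  have := nonpos_of_flux_nonneg hr hA (d := -d) (fun j hj => by simpa using h1 j hj)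
    (fun j hj => by simpa [map_neg] using h2 j hj) j
  simpa using this

lemma eq_of_flux_eq (hr : Escaping r) (hA : A.Nonempty) {p q : V → ℝ}
    (h1 : ∀ j ∈ A, p j = q j) (h2 : ∀ j ∉ A, flux r p j = flux r q j) : p = q := by
  have h3 := nonpos_of_flux_nonneg hr hA (d := p - q) (fun j hj => by simp [h1 j hj])
    (fun j hj => by simp [map_sub, h2 j hj])
  have h4 := nonneg_of_flux_nonpos hr hA (d := p - q) (fun j hj => by simp [h1 j hj])
    (fun j hj => by simp [map_sub, h2 j hj])
  ext j
  have := h3 j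
  have := h4 j
  simp only [Pi.sub_apply] at *
  linarith

/-- The identity on `A` together with the flux outside `A`. -/
def mixedFlux (r : V → V → ℝ) (A : Finset V) : (V → ℝ) →ₗ[ℝ] (V → ℝ) where
  toFun p j := if j ∈ A then p j else flux r p j
  map_add' p q := by ext j; by_cases h : j ∈ A <;> simp [h, map_add]
  map_smul' c p := by ext j; by_cases h : j ∈ A <;> simp [h, map_smul]

/-- The vector equal to `u` on `A` whose flux is `u` outside `A`. -/
noncomputable def balance (r : V → V → ℝ) (A : Finset V) : (V → ℝ) →ₗ[ℝ] (V → ℝ) :=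
  Ring.inverse (M₀ := Module.End ℝ (V → ℝ)) (mixedFlux r A)

lemma mixedFlux_balance (hr : Escaping r) (hA : A.Nonempty) (u : V → ℝ) :
    mixedFlux r A (balance r A u) = u := by
  have hu : IsUnit (M := Module.End ℝ (V → ℝ)) (mixedFlux r A) := by
    refine (LinearMap.isUnit_iff_ker_eq_bot _).2 (LinearMap.ker_eq_bot'.2 fun p hp => ?_)
    have hp' : ∀ j, (if j ∈ A then p j else flux r p j) = 0 := fun j => congrFun hp j
    refine eq_of_flux_eq hr hA (fun j hj => ?_) (fun j hj => ?_)
    · simpa [hj] using hp' j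
    · simpa [hj] using hp' j
  exact LinearMap.congr_fun (Ring.mul_inverse_cancel _ hu) u

lemma balance_of_mem (hr : Escaping r) (u : V → ℝ) {j : V} (hj : j ∈ A) :
    balance r A u j = u j := by
  have h := congrFun (mixedFlux_balance hr ⟨j, hj⟩ u) j
  simpa [mixedFlux, hj] using h

lemma flux_balance (hr : Escaping r) (hA : A.Nonempty) (u : V → ℝ) {j : V} (hj : j ∉ A) :
    flux r (balance r A u) j = u j := by
  have h := congrFun (mixedFlux_balance hr hA u) j
  simpa [mixedFlux, hj] using h

/-- The emission rates equal to one on `A` and balanced outside `A`. -/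
noncomputable def occupation (r : V → V → ℝ) (A : Finset V) : V → ℝ :=
  balance r A fun i => if i ∈ A then 1 else 0

lemma occupation_of_mem (hr : Escaping r) {j : V} (hj : j ∈ A) : occupation r A j = 1 := by
  simp [occupation, balance_of_mem hr _ hj, hj]

lemma flux_occupation (hr : Escaping r) (hA : A.Nonempty) {j : V} (hj : j ∉ A) :
    flux r (occupation r A) j = 0 := by
  simp [occupation, flux_balance hr hA _ hj, hj]

/-! ### Absorbing sets in terms of occupation rates -/

lemma sum_ind_eq_one (hr : Escaping r) {ind : Finset V → V → V → ℝ} (hind : IsHarmFamily r ind)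
    (hB : B.Nonempty) (l : V) : ∑ j ∈ B, ind B j l = 1 := by
  set w : V → ℝ := fun l => ∑ j ∈ B, ind B j l with hw
  have hwB : ∀ i ∈ B, w i = 1 := by
    intro i hi
    simp only [hw]
    rw [sum_congr rfl fun j hj => (hind B j hj).1 i hi]
    simp [hi]
  have hL : ∀ k ∉ B, ∑ l, r k l * (w l - w k) = 0 := by
    intro k hk
    simp only [hw, ← sum_sub_distrib, mul_sum]
    rw [sum_comm]
    exact sum_eq_zero fun j hj => (hind B j hj).2 k hk
  set s : V → ℝ := fun l => if l ∈ B then 0 else w l - 1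
  have hs : ∀ l, w l - 1 = s l := by
    intro l
    by_cases h : l ∈ B <;> simp [s, h, hwB]
  have key := sum_flux_mul (r := r) (balance r B s) (fun l => w l - 1)
  have hright : ∑ k, balance r B s k * ∑ l, r k l * ((w l - 1) - (w k - 1)) = 0 := by
    refine sum_eq_zero fun k _ => ?_
    by_cases hk : k ∈ B
    · simp [balance_of_mem hr s hk, s, hk]
    · rw [show ∑ l, r k l * ((w l - 1) - (w k - 1)) = ∑ l, r k l * (w l - w k) from
        sum_congr rfl fun _ _ => by ring, hL k hk, mul_zero]
  have hleft : ∑ j, flux r (balance r B s) j * (w j - 1) = ∑ j, (w j - 1) * (w j - 1) := by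
    refine sum_congr rfl fun j _ => ?_
    by_cases hj : j ∈ B
    · simp [hwB j hj]
    · rw [flux_balance hr hB s hj, hs]
  rw [hright, hleft] at key
  have := (sum_eq_zero_iff_of_nonneg fun i _ => mul_self_nonneg (w i - 1)).1 key l (mem_univ l)
  have := mul_self_eq_zero.1 this
  change w l = 1
  linarith

lemma lamA_eq_flux (hr : Escaping r) {ind : Finset V → V → V → ℝ}
    (hind : IsHarmFamily r ind) {i : V} (hi : i ∈ B) :
    lamA r ind B i = flux r (occupation r B) i := by
  have hB : B.Nonempty := ⟨i, hi⟩
  set w := ind B i with hw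
  have hwB := (hind B i hi).1
  have h1 : flux r (occupation r B) i = ∑ k ∈ B, ∑ l, r k l * (w l - w k) := by
    have key := sum_flux_mul (r := r) (occupation r B) w
    have hl : ∑ j, flux r (occupation r B) j * w j = flux r (occupation r B) i := by
      rw [sum_eq_single i]
      · rw [hw, hwB i hi]; simp
      · intro j _ hji
        by_cases hj : j ∈ B
        · rw [hw, hwB j hj]; simp [hji]
        · rw [flux_occupation hr hB hj, zero_mul]
      · simp
    rw [← hl, key, ← sum_subset (subset_univ B)]
    · exact sum_congr rfl fun k hk => by rw [occupation_of_mem hr hk, one_mul]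
    · intro k _ hk
      rw [(hind B i hi).2 k hk, mul_zero]
  have htr : ∀ k ∈ B, ∀ j ∈ B, k ≠ j →
      traceRate r ind B k j = ∑ l, r k l * ind B j l := by
    intro k hk j hj hkj
    rw [traceRate, if_neg hkj, ← sum_add_sum_compl B]
    congr 1
    rw [sum_eq_single j]
    · simp [(hind B j hj).1 j hj]
    · intro l hl hlj; simp [(hind B j hj).1 l hl, hlj]
    · exact fun h => absurd hj h
  have htr0 : ∀ k, traceRate r ind B k k = 0 := by intro k; simp [traceRate]
  rw [h1, lamA, sum_sub_distrib, ← add_sum_erase B _ hi, ← add_sum_erase B _ hi,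
    ← add_sum_erase B _ hi, htr0]
  have ha : ∑ k ∈ B.erase i, ∑ l, r k l * (w l - w k) = ∑ k ∈ B.erase i, traceRate r ind B k i := by
    refine sum_congr rfl fun k hk => ?_
    rw [htr k (mem_of_mem_erase hk) i hi (ne_of_mem_erase hk)]
    have : w k = 0 := by rw [hw, hwB k (mem_of_mem_erase hk), if_neg (ne_of_mem_erase hk)]
    simp only [this, sub_zero]
    rfl
  have hb : ∑ j ∈ B.erase i, traceRate r ind B i j = ∑ l, r i l * (1 - w l) := by
    rw [sum_congr rfl fun j hj => htr i hi j (mem_of_mem_erase hj) (ne_of_mem_erase hj).symm,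
      sum_comm]
    refine sum_congr rfl fun l _ => ?_
    rw [← mul_sum, ← sum_ind_eq_one hr hind hB l, ← add_sum_erase B _ hi, hw]
    ring
  have hc : ∑ l, r i l * (w l - w i) = -∑ l, r i l * (1 - w l) := by
    rw [← sum_neg_distrib]
    refine sum_congr rfl fun l _ => ?_
    rw [show w i = 1 by rw [hw, hwB i hi, if_pos rfl]]
    ring
  rw [ha, hb, hc]
  ring

theorem isAbsorbing_iff (hr : Escaping r) {ind : Finset V → V → V → ℝ}
    (hind : IsHarmFamily r ind) (hA : A.Nonempty) :
    IsAbsorbing r ind A ↔ ∀ j, occupation r A j ≤ 1 := by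
  have main : ∀ j ∉ A, (lamA r ind (insert j A) j ≤ 0 ↔ occupation r A j ≤ 1) := by
    intro j hj
    have hB : (insert j A).Nonempty := ⟨j, mem_insert_self j A⟩
    rw [lamA_eq_flux hr hind (mem_insert_self j A)]
    set d := occupation r (insert j A) - occupation r A with hdd
    have hdA : ∀ k ∈ A, d k = 0 := fun k hk => by
      simp [hdd, occupation_of_mem hr hk, occupation_of_mem hr (mem_insert_of_mem hk)]
    have hdj : d j = 1 - occupation r A j := by
      simp [hdd, occupation_of_mem hr (mem_insert_self j A)]
    have hfj : flux r d j = flux r (occupation r (insert j A)) j := by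
      simp [hdd, map_sub, flux_occupation hr hA hj]
    have hf : ∀ k ∉ A, k ≠ j → flux r d k = 0 := fun k hk hkj => by
      simp [hdd, map_sub, flux_occupation hr hA hk,
        flux_occupation hr hB (show k ∉ insert j A by simp [hk, hkj])]
    rw [← hfj]
    constructor
    · intro h
      have := nonneg_of_flux_nonpos hr hA (fun k hk => (hdA k hk).ge) (fun k hk => by
        by_cases hkj : k = j
        · rwa [hkj]
        · exact (hf k hk hkj).le) j
      linarith
    · intro h
      by_contra! hpos
      have hnp := nonpos_of_flux_nonneg hr hA (fun k hk => (hdA k hk).le) (fun k hk => by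
        by_cases hkj : k = j
        · rw [hkj]; exact hpos.le
        · exact (hf k hk hkj).ge)
      exact absurd (flux_nonpos_of_eq_zero hr hnp (j := j) (by linarith [hnp j])) (not_le.2 hpos)
  constructor
  · rintro (rfl | h) j
    · exact (occupation_of_mem hr (mem_univ j)).le
    · by_cases hj : j ∈ A
      · exact (occupation_of_mem hr hj).le
      · exact (main j hj).1 (h j hj)
  · exact fun h => Or.inr fun j hj => (main j hj).2 (h j)

/-- Removing sites with nonpositive net flux from an absorbing set leaves an absorbing set. -/
lemma occupation_le_one_of_subset (hr : Escaping r) (hC : C.Nonempty) (hCS : C ⊆ S)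
    (hS : ∀ j, occupation r S j ≤ 1)
    (h : ∀ j ∈ S, j ∉ C → flux r (occupation r S) j ≤ 0) (j : V) :
    occupation r C j ≤ 1 := by
  have := nonneg_of_flux_nonpos hr hC (d := occupation r S - occupation r C)
    (fun k hk => by simp [occupation_of_mem hr hk, occupation_of_mem hr (hCS hk)])
    (fun k hk => by
      rw [map_sub, Pi.sub_apply, flux_occupation hr hC hk, sub_zero]
      by_cases hkS : k ∈ S
      · exact h k hkS hk
      · exact (flux_occupation hr (hC.mono hCS) hkS).le) j
  have := hS j
  simp only [Pi.sub_apply] at *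
  linarith

/-- Every set lies in an absorbing set whose additional sites all have positive net flux. -/
lemma exists_absorbing_superset (hr : Escaping r) (hA : A.Nonempty) :
    ∃ B, A ⊆ B ∧ (∀ j, occupation r B j ≤ 1) ∧
      ∀ j ∈ B, j ∉ A → 0 < flux r (occupation r B) j := by
  obtain ⟨B, ⟨hAB, hB⟩, hmin⟩ := WellFounded.has_min (wellFounded_lt (α := Finset V))
    {B | A ⊆ B ∧ ∀ j, occupation r B j ≤ 1}
    ⟨univ, subset_univ _, fun j => (occupation_of_mem hr (mem_univ j)).le⟩
  refine ⟨B, hAB, hB, fun j hj hjA => ?_⟩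
  by_contra! hneg
  have hAC : A ⊆ B.erase j := subset_erase.2 ⟨hAB, hjA⟩
  refine hmin (B.erase j) ⟨hAC, occupation_le_one_of_subset hr (hA.mono hAC) (erase_subset j B) hB
    fun k hk hkC => ?_⟩ (erase_ssubset hj)
  obtain rfl : k = j := by
    by_contra hkj
    exact hkC (mem_erase.2 ⟨hkj, hk⟩)
  exact hneg

/-- An absorbing set which grows out of a subset of an absorbing set `A` remains in `A`. -/
lemma subset_of_flux_pos (hr : Escaping r) (hA : A.Nonempty) (hS : S.Nonempty)
    (hA1 : ∀ j, occupation r A j ≤ 1)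
    (h : ∀ j ∈ S, j ∉ A → 0 < flux r (occupation r S) j) (hS1 : ∀ j, occupation r S j ≤ 1) :
    S ⊆ A := by
  set d := occupation r S - occupation r A with hd
  have hf : ∀ k ∉ A, flux r d k = flux r (occupation r S) k := fun k hk => by
    simp [hd, map_sub, flux_occupation hr hA hk]
  have hnp := nonpos_of_flux_nonneg hr hA (d := d)
    (fun k hk => by simp [hd, occupation_of_mem hr hk, hS1 k])
    (fun k hk => by
      rw [hf k hk]
      by_cases hkS : k ∈ S
      · exact (h k hkS hk).le
      · exact (flux_occupation hr hS hkS).ge)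
  intro j hj
  by_contra hjA
  have hdj : d j = 0 := le_antisymm (hnp j) (by
    simp [hd, occupation_of_mem hr hj, hA1 j])
  exact absurd (flux_nonpos_of_eq_zero hr hnp hdj) (not_le.2 (hf j hjA ▸ h j hj hjA))

/-! ### Potentials and the projection onto a face -/

/-- Restriction to the complement of `S`, up to sign. -/
def negOff (S : Finset V) : (V → ℝ) →ₗ[ℝ] (V → ℝ) where
  toFun u j := if j ∈ S then 0 else -u j
  map_add' u v := by ext j; by_cases h : j ∈ S <;> simp [h, add_comm]
  map_smul' c u := by ext j; by_cases h : j ∈ S <;> simp [h]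

/-- The Green potential, killed on `S`, of the mass lying outside `S`. -/
noncomputable def potential (r : V → V → ℝ) (S : Finset V) : (V → ℝ) →ₗ[ℝ] (V → ℝ) :=
  balance r S ∘ₗ negOff S

lemma potential_of_mem (hr : Escaping r) (u : V → ℝ) {j : V} (hj : j ∈ S) :
    potential r S u j = 0 := by
  simp [potential, balance_of_mem hr _ hj, negOff, hj]

lemma flux_potential (hr : Escaping r) (hS : S.Nonempty) (u : V → ℝ) {j : V} (hj : j ∉ S) :
    flux r (potential r S u) j = -u j := by
  simp [potential, flux_balance hr hS _ hj, negOff, hj]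

lemma potential_eq (hr : Escaping r) (hS : S.Nonempty) {u y : V → ℝ} (h1 : ∀ j ∈ S, y j = 0)
    (h2 : ∀ j ∉ S, flux r y j = -u j) : potential r S u = y :=
  eq_of_flux_eq hr hS (fun j hj => by rw [potential_of_mem hr u hj, h1 j hj])
    (fun j hj => by rw [flux_potential hr hS u hj, h2 j hj])

lemma potential_nonneg (hr : Escaping r) (hS : S.Nonempty) {u : V → ℝ} (hu : ∀ j, 0 ≤ u j)
    (j : V) : 0 ≤ potential r S u j :=
  nonneg_of_flux_nonpos hr hS (fun j hj => (potential_of_mem hr u hj).ge)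
    (fun j hj => by rw [flux_potential hr hS u hj]; linarith [hu j]) j

lemma potential_vvec (hr : Escaping r) {i : V} (hS : S.Nonempty) (hi : i ∉ S) :
    potential r S (vvec r i) = -Pi.single i 1 := by
  refine potential_eq hr hS (fun j hj => ?_) (fun j _ => ?_)
  · have : j ≠ i := by rintro rfl; exact hi hj
    simp [this]
  · rw [map_neg, vvec_eq_flux, Pi.neg_apply]

lemma potential_lamV (hr : Escaping r) (hS : S.Nonempty) :
    potential r S (lamV r) = occupation r S - 1 := by
  refine potential_eq hr hS (fun j hj => ?_) (fun j hj => ?_)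
  · simp [occupation_of_mem hr hj]
  · rw [map_sub, lamV_eq_flux, Pi.sub_apply, flux_occupation hr hS hj, zero_sub]

/-- The linear projection onto the vectors supported on `S` along the `v_i`, `i ∉ S`. -/
noncomputable def proj (r : V → V → ℝ) (S : Finset V) : (V → ℝ) →L[ℝ] (V → ℝ) :=
  LinearMap.toContinuousLinearMap (LinearMap.id + flux r ∘ₗ potential r S)

lemma proj_apply (u : V → ℝ) : proj r S u = u + flux r (potential r S u) := rfl

lemma proj_vvec (hr : Escaping r) {i : V} (hS : S.Nonempty) (hi : i ∉ S) :
    proj r S (vvec r i) = 0 := by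
  rw [proj_apply, potential_vvec hr hS hi, map_neg, vvec_eq_flux, add_neg_cancel]

lemma proj_lamV (hr : Escaping r) (hS : S.Nonempty) :
    proj r S (lamV r) = flux r (occupation r S) := by
  rw [proj_apply, potential_lamV hr hS, map_sub, ← lamV_eq_flux, add_sub_cancel]

lemma proj_of_support (hr : Escaping r) (hS : S.Nonempty) {u : V → ℝ} (hu : ∀ j ∉ S, u j = 0) :
    proj r S u = u := by
  rw [proj_apply, potential_eq hr hS (u := u) (y := 0) (by simp)
    (fun j hj => by simp [hu j hj]), map_zero, add_zero]

lemma height_pos (hr : Escaping r) {i : V} (hS : S.Nonempty) (hi : i ∉ S) :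
    0 < potential r S 1 i := by
  have hnn := potential_nonneg hr hS (u := 1) (fun _ => zero_le_one)
  refine (hnn i).lt_of_ne fun h0 => ?_
  have h := flux_potential hr hS 1 hi
  rw [flux_apply, ← h0, Pi.one_apply] at h
  have := sum_nonneg fun k (_ : k ∈ univ) => mul_nonneg (hnn k) (hr.nonneg k i)
  linarith

/-- The potential at `i`, normalized by the potential of the unit mass profile. -/
noncomputable def normPot (r : V → V → ℝ) (S : Finset V) (i : V) : (V → ℝ) →L[ℝ] ℝ :=
  LinearMap.toContinuousLinearMap
    ((potential r S 1 i)⁻¹ • (LinearMap.proj i ∘ₗ potential r S))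

lemma normPot_apply (i : V) (u : V → ℝ) :
    normPot r S i u = (potential r S 1 i)⁻¹ * potential r S u i := rfl

lemma potential_eq_mul_normPot (hr : Escaping r) {i : V} (hS : S.Nonempty) (hi : i ∉ S)
    (u : V → ℝ) : potential r S u i = normPot r S i u * potential r S 1 i := by
  have := (height_pos hr hS hi).ne'
  rw [normPot_apply]
  field_simp

lemma potential_le_of_normPot_le (hr : Escaping r) (hS : S.Nonempty) {u : V → ℝ} {m : ℝ}
    (h : ∀ k ∉ S, normPot r S k u ≤ m) (k : V) :
    potential r S u k ≤ m * potential r S 1 k := by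
  by_cases hk : k ∈ S
  · simp [potential_of_mem hr _ hk]
  · rw [potential_eq_mul_normPot hr hS hk]
    exact mul_le_mul_of_nonneg_right (h k hk) (height_pos hr hS hk).le

lemma support_of_normPot_nonpos (hr : Escaping r) (hS : S.Nonempty) {u : V → ℝ}
    (hu : ∀ j, 0 ≤ u j) (h : ∀ k ∉ S, normPot r S k u ≤ 0) {j : V} (hj : j ∉ S) : u j = 0 := by
  have h0 : potential r S u = 0 := by
    ext k
    refine le_antisymm ?_ (potential_nonneg hr hS hu k)
    simpa using potential_le_of_normPot_le hr hS h k
  have := flux_potential hr hS u hj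
  rw [h0, map_zero, Pi.zero_apply] at this
  linarith

lemma normPot_of_support (hr : Escaping r) (hS : S.Nonempty) {u : V → ℝ}
    (hu : ∀ j ∉ S, u j = 0) (k : V) : normPot r S k u = 0 := by
  rw [normPot_apply, potential_eq hr hS (u := u) (y := 0) (by simp)
    (fun j hj => by simp [hu j hj])]
  simp

/-- An empty site has normalized potential a factor below the maximum. -/
lemma exists_normPot_gap (hr : Escaping r) (hS : S.Nonempty) :
    ∃ ρ : ℝ, 0 < ρ ∧ ρ < 1 ∧ ∀ i ∉ S, ∀ u : V → ℝ, (∀ j, 0 ≤ u j) → u i = 0 →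
      ∀ m, (∀ k ∉ S, normPot r S k u ≤ m) → normPot r S i u ≤ ρ * m := by
  have hnn := potential_nonneg hr hS (u := 1) (fun _ => zero_le_one)
  have hR : ∀ i, 0 ≤ ∑ k, r i k := fun i => sum_nonneg fun k _ => hr.nonneg i k
  set K : ℝ := 2 + ∑ i, potential r S 1 i * ∑ k, r i k with hK
  have hsum : 0 ≤ ∑ i, potential r S 1 i * ∑ k, r i k :=
    sum_nonneg fun i _ => mul_nonneg (hnn i) (hR i)
  have hK2 : 2 ≤ K := by linarith
  have hKinv : K⁻¹ < 1 := inv_lt_one_of_one_lt₀ (by linarith)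
  refine ⟨1 - K⁻¹, by linarith, by have := inv_pos.2 (show 0 < K by linarith); linarith, ?_⟩
  intro i hi u hu hui m hm
  have hh := height_pos hr hS hi
  have hy := potential_le_of_normPot_le hr hS hm
  have hm0 : 0 ≤ m := by
    have := (potential_nonneg hr hS hu i).trans (hy i)
    exact nonneg_of_mul_nonneg_left this hh
  have h1 := flux_potential hr hS 1 hi
  have hu1 := flux_potential hr hS u hi
  rw [flux_apply, Pi.one_apply] at h1
  rw [flux_apply, hui] at hu1
  have hle : ∑ k, potential r S u k * r k i ≤ m * ∑ k, potential r S 1 k * r k i := by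
    rw [mul_sum]
    refine sum_le_sum fun k _ => ?_
    rw [← mul_assoc]
    exact mul_le_mul_of_nonneg_right (hy k) (hr.nonneg k i)
  have hin : 0 ≤ ∑ k, potential r S 1 k * r k i :=
    sum_nonneg fun k _ => mul_nonneg (hnn k) (hr.nonneg k i)
  set R := ∑ k, r i k with hRdef
  have hRh : potential r S 1 i * R ≤ K := by
    have := single_le_sum (f := fun i => potential r S 1 i * ∑ k, r i k)
      (fun i _ => mul_nonneg (hnn i) (hR i)) (mem_univ i)
    linarith
  have hRpos : 0 < R := by
    refine (hR i).lt_of_ne fun h0 => ?_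
    rw [← hRdef] at h0
    rw [← h0] at h1
    linarith
  have hgap : potential r S 1 i * R - 1 ≤ (1 - K⁻¹) * (potential r S 1 i * R) := by
    have : K⁻¹ * (potential r S 1 i * R) ≤ 1 := by
      rw [inv_mul_le_iff₀ (by linarith)]; linarith
    linarith
  have hfin : potential r S u i * R ≤ ((1 - K⁻¹) * m * potential r S 1 i) * R := by
    have := mul_le_mul_of_nonneg_left hgap hm0
    have h2 : ∑ k, potential r S 1 k * r k i = potential r S 1 i * R - 1 := by linarith
    rw [h2] at hle
    calc potential r S u i * R = ∑ k, potential r S u k * r k i := by linarith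
      _ ≤ _ := hle
      _ ≤ _ := this
      _ = _ := by ring
  rw [potential_eq_mul_normPot hr hS hi] at hfin
  exact le_of_mul_le_mul_right (le_of_mul_le_mul_right hfin hRpos) hh

/-! ### Test functions localized near a face -/

/-- A `C¹` cutoff equal to one below `a` and to zero above `b`. -/
structure IsCutoff (φ : ℝ → ℝ) (a b : ℝ) : Prop where
  contDiff : ContDiff ℝ 1 φ
  antitone : Antitone φ
  eq_one : ∀ x ≤ a, φ x = 1
  eq_zero : ∀ x, b ≤ x → φ x = 0

lemma exists_cutoff {a b : ℝ} (hab : a < b) : ∃ φ, IsCutoff φ a b := by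
  have hpos : 0 < b - a := sub_pos.2 hab
  refine ⟨fun x => 1 - Real.smoothTransition ((x - a) / (b - a)), ?_, ?_, ?_, ?_⟩
  · have := Real.smoothTransition.contDiff (n := 1)
    exact contDiff_const.sub (this.comp ((contDiff_id.sub contDiff_const).div_const _))
  · intro x y hxy
    have := Real.smoothTransition.monotone
      (div_le_div_of_nonneg_right (sub_le_sub_right hxy a) hpos.le)
    simp only
    linarith
  · intro x hx
    have := Real.smoothTransition.zero_of_nonpos
      (div_nonpos_of_nonpos_of_nonneg (sub_nonpos.2 hx) hpos.le)
    simp [this]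
  · intro x hx
    have := Real.smoothTransition.one_of_one_le
      ((one_le_div hpos).2 (sub_le_sub_right hx a))
    simp [this]

namespace IsCutoff

variable {φ : ℝ → ℝ} {a b : ℝ}

lemma nonneg (h : IsCutoff φ a b) (x : ℝ) : 0 ≤ φ x := by
  rw [← h.eq_zero (max x b) (le_max_right _ _)]
  exact h.antitone (le_max_left _ _)

lemma le_one (h : IsCutoff φ a b) (x : ℝ) : φ x ≤ 1 := by
  rw [← h.eq_one (min x a) (min_le_right _ _)]
  exact h.antitone (min_le_left _ _)

lemma deriv_nonpos (h : IsCutoff φ a b) (x : ℝ) : deriv φ x ≤ 0 :=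
  h.antitone.deriv_nonpos

lemma deriv_eq_zero (h : IsCutoff φ a b) {x : ℝ} (hx : x ≤ a) : deriv φ x = 0 :=
  IsLocalMax.deriv_eq_zero (Filter.Eventually.of_forall fun y => by
    rw [h.eq_one x hx]; exact h.le_one y)

end IsCutoff

/-- The product of cutoffs of the normalized potentials off `S`. -/
noncomputable def faceCutoff (r : V → V → ℝ) (S : Finset V) (φ : ℝ → ℝ) (u : V → ℝ) : ℝ :=
  ∏ k ∈ Sᶜ, φ (normPot r S k u)

section FaceCutoff

variable {φ : ℝ → ℝ} {a b : ℝ}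

lemma contDiff_faceCutoff (hφ : IsCutoff φ a b) : ContDiff ℝ 1 (faceCutoff r S φ) :=
  contDiff_prod fun k _ => hφ.contDiff.comp (normPot r S k).contDiff

lemma fderiv_faceCutoff (hφ : IsCutoff φ a b) (u v : V → ℝ) :
    fderiv ℝ (faceCutoff r S φ) u v =
      ∑ k ∈ Sᶜ, (∏ l ∈ Sᶜ.erase k, φ (normPot r S l u)) *
        (deriv φ (normPot r S k u) * normPot r S k v) := by
  have hd : ∀ k ∈ Sᶜ, HasFDerivAt (fun u => φ (normPot r S k u))
      (deriv φ (normPot r S k u) • normPot r S k) u := fun k _ =>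
    ((hφ.contDiff.differentiable one_ne_zero _).hasDerivAt).comp_hasFDerivAt u
      (normPot r S k).hasFDerivAt
  have h : fderiv ℝ (faceCutoff r S φ) u = _ := (HasFDerivAt.finsetProd hd).fderiv
  rw [h]
  simp

lemma fderiv_faceCutoff_lamV_nonneg (hr : Escaping r) (hS : S.Nonempty)
    (hS1 : ∀ j, occupation r S j ≤ 1) (hφ : IsCutoff φ a b) (u : V → ℝ) :
    0 ≤ fderiv ℝ (faceCutoff r S φ) u (lamV r) := by
  rw [fderiv_faceCutoff hφ]
  refine sum_nonneg fun k hk => mul_nonneg (prod_nonneg fun l _ => hφ.nonneg _)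
    (mul_nonneg_of_nonpos_of_nonpos (hφ.deriv_nonpos _) ?_)
  rw [normPot_apply, potential_lamV hr hS]
  refine mul_nonpos_of_nonneg_of_nonpos
    (inv_nonneg.2 (height_pos hr hS (mem_compl.1 hk)).le) ?_
  simpa using hS1 k

/-- With cutoff levels separated by the potential gap, the cutoff satisfies the boundary
condition at every site off the face. -/
lemma fderiv_faceCutoff_vvec (hr : Escaping r) (hS : S.Nonempty) {ρ : ℝ} (hb : 0 < b)
    (hρ : ρ < 1)
    (hgap : ∀ i ∉ S, ∀ u : V → ℝ, (∀ j, 0 ≤ u j) → u i = 0 →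
      ∀ m, (∀ k ∉ S, normPot r S k u ≤ m) → normPot r S i u ≤ ρ * m)
    (hφ : IsCutoff φ (ρ * b) b) {u : V → ℝ} (hu : ∀ j, 0 ≤ u j) {i : V} (hi : i ∉ S)
    (hui : u i = 0) : fderiv ℝ (faceCutoff r S φ) u (vvec r i) = 0 := by
  rw [fderiv_faceCutoff hφ]
  refine sum_eq_zero fun k hk => ?_
  by_cases hki : k = i
  · subst hki
    obtain ⟨m, hm, hmax⟩ := exists_max_image Sᶜ (fun l => normPot r S l u) ⟨k, hk⟩
    have hgap' := hgap k hi u hu hui (normPot r S m u) fun l hl => hmax l (mem_compl.2 hl)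
    by_cases hmb : normPot r S m u ≤ b
    · have := hgap k hi u hu hui b fun l hl => (hmax l (mem_compl.2 hl)).trans hmb
      rw [hφ.deriv_eq_zero this]
      simp
    · push Not at hmb
      have hmk : m ≠ k := by
        rintro rfl
        have : 0 < normPot r S m u := hb.trans hmb
        nlinarith
      rw [prod_eq_zero (mem_erase.2 ⟨hmk, hm⟩) (hφ.eq_zero _ hmb.le), zero_mul]
  · rw [normPot_apply k (vvec r i), potential_vvec hr hS hi]
    simp [hki]

lemma normPot_lt_of_faceCutoff_ne_zero (hφ : IsCutoff φ a b) {u : V → ℝ}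
    (h : faceCutoff r S φ u ≠ 0) {k : V} (hk : k ∉ S) : normPot r S k u < b := by
  by_contra! hle
  exact h (prod_eq_zero (mem_compl.2 hk) (hφ.eq_zero _ hle))

lemma faceCutoff_eventually_zero (hφ : IsCutoff φ a b) {u : V → ℝ} {k : V} (hk : k ∉ S)
    (h : b < normPot r S k u) : ∀ᶠ w in nhds u, faceCutoff r S φ w = 0 := by
  filter_upwards [(normPot r S k).continuous.continuousAt.eventually_const_lt h] with w hw
  exact prod_eq_zero (mem_compl.2 hk) (hφ.eq_zero _ hw.le)

lemma faceCutoff_eventually_one (hr : Escaping r) (hS : S.Nonempty) (ha : 0 < a)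
    (hφ : IsCutoff φ a b) {u : V → ℝ} (hu : ∀ j ∉ S, u j = 0) :
    ∀ᶠ w in nhds u, faceCutoff r S φ w = 1 := by
  have : ∀ᶠ w in nhds u, ∀ k, normPot r S k w < a := by
    refine Filter.eventually_all.2 fun k => ?_
    refine (normPot r S k).continuous.continuousAt.eventually_lt_const ?_
    rwa [normPot_of_support hr hS hu]
  filter_upwards [this] with w hw
  exact prod_eq_one fun k _ => hφ.eq_one _ (hw k).le

end FaceCutoff

/-- A function of the projection onto a face, cut off near that face, belongs to `D_V`
as soon as it vanishes where the projection is close to the boundary of the face. -/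
lemma memD_mul_faceCutoff (hr : Escaping r) (hS : S.Nonempty) {ρ b η : ℝ} (hb : 0 < b)
    (hρ : ρ < 1)
    (hgap : ∀ i ∉ S, ∀ u : V → ℝ, (∀ j, 0 ≤ u j) → u i = 0 →
      ∀ m, (∀ k ∉ S, normPot r S k u ≤ m) → normPot r S i u ≤ ρ * m)
    {φ : ℝ → ℝ} (hφ : IsCutoff φ (ρ * b) b) {Θ : (V → ℝ) → ℝ} (hΘ : ContDiff ℝ 1 Θ)
    (hΘ0 : ∀ q, ∀ i ∈ S, q i < η → Θ q = 0)
    (hbη : ∀ i ∈ S, b * ∑ k, potential r S 1 k * r k i < η) :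
    MemD r univ fun u => Θ (proj r S u) * faceCutoff r S φ u := by
  have hΘp : ContDiff ℝ 1 fun u => Θ (proj r S u) := hΘ.comp (proj r S).contDiff
  refine ⟨⟨Set.univ, isOpen_univ, Set.subset_univ _,
    (hΘp.mul (contDiff_faceCutoff hφ)).contDiffOn⟩, fun i _ u hu hui => ?_⟩
  by_cases hi : i ∈ S
  · suffices h : (fun u => Θ (proj r S u) * faceCutoff r S φ u) =ᶠ[nhds u] fun _ => 0 by
      rw [h.fderiv_eq]; simp
    by_cases hbig : ∃ k ∉ S, b < normPot r S k u
    · obtain ⟨k, hk, hkb⟩ := hbig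
      filter_upwards [faceCutoff_eventually_zero hφ hk hkb] with w hw
      rw [hw, mul_zero]
    · push Not at hbig
      have hy := potential_le_of_normPot_le hr hS hbig
      have hlt : proj r S u i < η := by
        rw [proj_apply, Pi.add_apply, hui, zero_add, flux_apply, potential_of_mem hr u hi,
          zero_mul, sub_zero]
        refine lt_of_le_of_lt ?_ (hbη i hi)
        rw [mul_sum]
        refine sum_le_sum fun k _ => ?_
        rw [← mul_assoc]
        exact mul_le_mul_of_nonneg_right (hy k) (hr.nonneg k i)
      have hcont : ContinuousAt (fun w => proj r S w i) u :=
        ((continuous_apply i).comp (proj r S).continuous).continuousAt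
      filter_upwards [hcont.eventually_lt_const hlt] with w hw
      rw [hΘ0 _ i hi hw, zero_mul]
  · have h1 : DifferentiableAt ℝ (fun u => Θ (proj r S u)) u :=
      hΘp.differentiable one_ne_zero u
    have h2 : DifferentiableAt ℝ (faceCutoff r S φ) u :=
      (contDiff_faceCutoff hφ).differentiable one_ne_zero u
    have h3 : fderiv ℝ (fun u => Θ (proj r S u)) u (vvec r i) = 0 := by
      have := fderiv_comp u (hΘ.differentiable one_ne_zero (proj r S u))
        (proj r S).differentiableAt
      rw [Function.comp_def] at this
      rw [this]
      simp [proj_vvec hr hS hi]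
    rw [fderiv_fun_mul h1 h2]
    simp [h3, fderiv_faceCutoff_vvec hr hS hb hρ hgap hφ hu.1 hi hui]

/-! ### Paths satisfying condition (A) -/

lemma continuousOn_fderiv_path {ζ : ℝ → V → ℝ} (hζ : IsPath ζ) {f : (V → ℝ) → ℝ}
    (hf : MemD r B f) (v : V → ℝ) :
    ContinuousOn (fun s => fderiv ℝ f (ζ s) v) (Set.Ici 0) := by
  obtain ⟨⟨U, hU, hsub, hfU⟩, -⟩ := hf
  have h := (hfU.continuousOn_fderiv_of_isOpen hU le_rfl).comp hζ.1
    (fun t ht => hsub (hζ.2 t ht))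
  exact h.clm_apply continuousOn_const

lemma intervalIntegrable_fderiv_path {ζ : ℝ → V → ℝ} (hζ : IsPath ζ) {f : (V → ℝ) → ℝ}
    (hf : MemD r B f) (v : V → ℝ) {s t : ℝ} (hs : 0 ≤ s) (ht : 0 ≤ t) :
    IntervalIntegrable (fun x => fderiv ℝ f (ζ x) v) MeasureTheory.volume s t :=
  ((continuousOn_fderiv_path hζ hf v).mono fun _ hx =>
    le_trans (le_min hs ht) hx.1).intervalIntegrable

lemma condA_eq_add_integral {ζ : ℝ → V → ℝ} (hζ : IsPath ζ) (hA : CondA r ζ)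
    {f : (V → ℝ) → ℝ} (hf : MemD r univ f) {s t : ℝ} (hs : 0 ≤ s) (hst : s ≤ t) :
    f (ζ t) = f (ζ s) + ∫ x in s..t, fderiv ℝ f (ζ x) (lamV r) := by
  have ht := hs.trans hst
  rw [hA f hf t ht, hA f hf s hs, add_assoc, intervalIntegral.integral_add_adjacent_intervals
    (intervalIntegrable_fderiv_path hζ hf _ le_rfl hs)
    (intervalIntegrable_fderiv_path hζ hf _ hs ht)]

/-- Starting from the interior of an absorbing face, a path satisfying condition (A)
moves for some time along that face with constant velocity. -/
lemma exists_linear_right (hr : Escaping r) (hS : S.Nonempty)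
    (hS1 : ∀ j, occupation r S j ≤ 1) {ζ : ℝ → V → ℝ} (hζ : IsPath ζ) (hA : CondA r ζ)
    {s : ℝ} (hs : 0 ≤ s) (hoff : ∀ j ∉ S, ζ s j = 0) (hpos : ∀ j ∈ S, 0 < ζ s j) :
    ∃ δ > 0, ∀ t ∈ Set.Icc s (s + δ),
      ζ t = ζ s + (t - s) • flux r (occupation r S) := by
  obtain ⟨ρ, hρ0, hρ, hgap⟩ := exists_normPot_gap hr hS
  obtain ⟨η, hη, hηs⟩ : ∃ η > 0, ∀ i ∈ S, 2 * η < ζ s i := by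
    obtain ⟨i, hi, hmin⟩ := exists_min_image S (ζ s) hS
    exact ⟨ζ s i / 3, by linarith [hpos i hi],
      fun j hj => by linarith [hmin j hj, hpos i hi]⟩
  obtain ⟨θ, hθ⟩ := exists_cutoff (show η < 2 * η by linarith)
  set χ : (V → ℝ) → ℝ := fun q => ∏ i ∈ S, (1 - θ (q i)) with hχ
  have hχC : ContDiff ℝ 1 χ := contDiff_prod fun i _ =>
    contDiff_const.sub (hθ.contDiff.comp (contDiff_apply ℝ ℝ i))
  have hχ0 : ∀ q, ∀ i ∈ S, q i < η → χ q = 0 := fun q i hi hq =>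
    prod_eq_zero hi (by rw [hθ.eq_one _ hq.le, sub_self])
  have hχ1 : ∀ q : V → ℝ, (∀ i ∈ S, 2 * η ≤ q i) → χ q = 1 := fun q hq =>
    prod_eq_one fun i hi => by rw [hθ.eq_zero _ (hq i hi), sub_zero]
  obtain ⟨b₀, hb₀, hb₀η⟩ : ∃ b₀ > 0, ∀ b, b ≤ b₀ →
      ∀ i ∈ S, b * ∑ k, potential r S 1 k * r k i < η := by
    have hnn : ∀ i, 0 ≤ ∑ k, potential r S 1 k * r k i := fun i => sum_nonneg fun k _ =>
      mul_nonneg (potential_nonneg hr hS (u := 1) (fun _ => zero_le_one) k) (hr.nonneg k i)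
    set K := ∑ i, ∑ k, potential r S 1 k * r k i
    have hK : 0 ≤ K := sum_nonneg fun i _ => hnn i
    refine ⟨η / (K + 1), by positivity, fun b hb i _ => ?_⟩
    have hi : ∑ k, potential r S 1 k * r k i ≤ K :=
      single_le_sum (f := fun i => ∑ k, potential r S 1 k * r k i) (fun i _ => hnn i) (mem_univ i)
    calc b * ∑ k, potential r S 1 k * r k i
        ≤ η / (K + 1) * ∑ k, potential r S 1 k * r k i := mul_le_mul_of_nonneg_right hb (hnn i)
      _ ≤ η / (K + 1) * K := mul_le_mul_of_nonneg_left hi (by positivity)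
      _ < η := by
        rw [div_mul_eq_mul_div, div_lt_iff₀ (by linarith)]
        exact mul_lt_mul_of_pos_left (by linarith) hη
  have hproj_s : proj r S (ζ s) = ζ s := proj_of_support hr hS hoff
  obtain ⟨δ, hδ, hnear⟩ : ∃ δ > 0, ∀ t ∈ Set.Icc s (s + δ), ∀ i ∈ S,
      2 * η < proj r S (ζ t) i := by
    have hev : ∀ᶠ t in nhdsWithin s (Set.Ici s), ∀ i ∈ S, 2 * η < proj r S (ζ t) i := by
      refine (Finset.eventually_all S).2 fun i hi => ?_
      have hc : ContinuousWithinAt (fun t => proj r S (ζ t) i) (Set.Ici s) s :=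
        ((continuous_apply i).comp (proj r S).continuous).continuousAt.comp_continuousWithinAt
          ((hζ.1 s hs).mono (Set.Ici_subset_Ici.2 hs))
      refine hc.eventually_const_lt ?_
      change 2 * η < proj r S (ζ s) i
      rw [hproj_s]
      exact hηs i hi
    obtain ⟨c, hc, hcs⟩ := mem_nhdsGE_iff_exists_Icc_subset.1 hev
    exact ⟨c - s, sub_pos.2 hc, fun t ht => hcs ⟨ht.1, by linarith [ht.2]⟩⟩
  have hχnear : ∀ t ∈ Set.Icc s (s + δ), ∀ᶠ w in nhds (ζ t), χ (proj r S w) = 1 := by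
    intro t ht
    have : ∀ᶠ w in nhds (ζ t), ∀ i ∈ S, 2 * η < proj r S w i :=
      (Finset.eventually_all S).2 fun i hi =>
        ((continuous_apply i).comp (proj r S).continuous).continuousAt.eventually_const_lt
          (hnear t ht i hi)
    filter_upwards [this] with w hw
    exact hχ1 _ fun i hi => (hw i hi).le
  have hsub : ∀ {t}, t ∈ Set.Icc s (s + δ) → ∀ x ∈ Set.Icc s t, x ∈ Set.Icc s (s + δ) :=
    fun ht x hx => ⟨hx.1, hx.2.trans ht.2⟩
  have hface : ∀ t ∈ Set.Icc s (s + δ), ∀ j ∉ S, ζ t j = 0 := by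
    intro t ht j hj
    have ht0 := hs.trans ht.1
    refine support_of_normPot_nonpos hr hS (hζ.2 t ht0).1 (fun k hk => ?_) hj
    refine le_of_forall_pos_le_add fun ε hε => ?_
    rw [zero_add]
    set b := min ε b₀
    have hb : 0 < b := lt_min hε hb₀
    obtain ⟨φ, hφ⟩ := exists_cutoff (show ρ * b < b by nlinarith)
    have hF := memD_mul_faceCutoff hr hS hb hρ hgap hφ hχC hχ0 (hb₀η b (min_le_right _ _))
    have hFt := condA_eq_add_integral hζ hA hF hs ht.1
    have hint : 0 ≤ ∫ x in s..t,
        fderiv ℝ (fun u => χ (proj r S u) * faceCutoff r S φ u) (ζ x) (lamV r) := by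
      refine intervalIntegral.integral_nonneg ht.1 fun x hx => ?_
      have : (fun u => χ (proj r S u) * faceCutoff r S φ u) =ᶠ[nhds (ζ x)]
          faceCutoff r S φ := by
        filter_upwards [hχnear x (hsub ht x hx)] with w hw
        rw [hw, one_mul]
      rw [this.fderiv_eq]
      exact fderiv_faceCutoff_lamV_nonneg hr hS hS1 hφ _
    have hs1 : faceCutoff r S φ (ζ s) = 1 :=
      (faceCutoff_eventually_one hr hS (mul_pos hρ0 hb) hφ hoff).self_of_nhds
    simp only [(hχnear t ht).self_of_nhds, (hχnear s ⟨le_rfl, by linarith⟩).self_of_nhds,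
      one_mul, hs1] at hFt
    have hne : faceCutoff r S φ (ζ t) ≠ 0 := by
      intro h0
      rw [h0] at hFt
      linarith
    exact (normPot_lt_of_faceCutoff_ne_zero hφ hne hk).le.trans (min_le_left _ _)
  refine ⟨δ, hδ, fun t ht => ?_⟩
  obtain ⟨φ, hφ⟩ := exists_cutoff (show ρ * b₀ < b₀ by nlinarith)
  ext j
  by_cases hj : j ∈ S
  · have hF := memD_mul_faceCutoff hr hS hb₀ hρ hgap hφ
      (Θ := fun q => χ q * q j) (hχC.mul (contDiff_apply ℝ ℝ j))
      (fun q i hi hq => by rw [hχ0 q i hi hq, zero_mul]) (hb₀η b₀ le_rfl)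
    have hFt := condA_eq_add_integral hζ hA hF hs ht.1
    have hloc : ∀ x ∈ Set.Icc s (s + δ),
        (fun u => (χ (proj r S u) * proj r S u j) * faceCutoff r S φ u) =ᶠ[nhds (ζ x)]
          fun u => proj r S u j := by
      intro x hx
      filter_upwards [hχnear x hx,
        faceCutoff_eventually_one hr hS (mul_pos hρ0 hb₀) hφ (hface x hx)] with w h1 h2
      rw [h1, h2, one_mul, mul_one]
    have hder : ∀ x ∈ Set.uIcc s t,
        fderiv ℝ (fun u => (χ (proj r S u) * proj r S u j) * faceCutoff r S φ u) (ζ x) (lamV r)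
          = flux r (occupation r S) j := by
      intro x hx
      rw [Set.uIcc_of_le ht.1] at hx
      rw [(hloc x (hsub ht x hx)).fderiv_eq, ← proj_lamV hr hS]
      have h : HasFDerivAt (fun u => proj r S u j)
          ((ContinuousLinearMap.proj (R := ℝ) (φ := fun _ : V => ℝ) j).comp (proj r S)) (ζ x) :=
        ((ContinuousLinearMap.proj (R := ℝ) (φ := fun _ : V => ℝ) j).comp (proj r S)).hasFDerivAt
      rw [h.fderiv]
      rfl
    rw [intervalIntegral.integral_congr hder, intervalIntegral.integral_const] at hFt
    have e1 := (hloc t ht).self_of_nhds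
    have e2 := (hloc s ⟨le_rfl, by linarith⟩).self_of_nhds
    simp only at e1 e2 hFt
    rw [e1, e2, hproj_s, proj_of_support hr hS (hface t ht)] at hFt
    simpa using hFt
  · simp [hface t ht j hj, hoff j hj, flux_occupation hr hS hj]

/-- As long as the sites of an absorbing support stay occupied, the motion is linear. -/
lemma linear_of_pos (hr : Escaping r) (hS : S.Nonempty) (hS1 : ∀ j, occupation r S j ≤ 1)
    {ζ : ℝ → V → ℝ} (hζ : IsPath ζ) (hA : CondA r ζ) {s τ : ℝ} (hs : 0 ≤ s)
    (hoff : ∀ j ∉ S, ζ s j = 0) (hpos : ∀ x ∈ Set.Ico s τ, ∀ j ∈ S, 0 < ζ x j) :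
    ∀ x ∈ Set.Icc s τ, ζ x = ζ s + (x - s) • flux r (occupation r S) := by
  set E := {x | ζ x = ζ s + (x - s) • flux r (occupation r S)} with hE
  have hζc : ContinuousOn ζ (Set.Icc s τ) := hζ.1.mono fun x hx => hs.trans hx.1
  have hclosed : IsClosed (E ∩ Set.Icc s τ) := by
    have hg : ContinuousOn (fun x => ζ x - (ζ s + (x - s) • flux r (occupation r S)))
        (Set.Icc s τ) := hζc.sub (by fun_prop)
    have := hg.preimage_isClosed_of_isClosed isClosed_Icc (isClosed_singleton (x := 0))
    convert this using 1
    ext x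
    simp [hE, sub_eq_zero, and_comm]
  refine IsClosed.Icc_subset_of_forall_exists_gt hclosed
    (show ζ s = _ by rw [sub_self, zero_smul, add_zero]) ?_
  rintro x ⟨hxE, hx⟩ y hy
  have hxoff : ∀ j ∉ S, ζ x j = 0 := fun j hj => by
    rw [show ζ x = _ from hxE]
    simp [hoff j hj, flux_occupation hr hS hj]
  obtain ⟨δ, hδ, hlin⟩ := exists_linear_right hr hS hS1 hζ hA (hs.trans hx.1) hxoff (hpos x hx)
  have hxy : x < y := hy
  refine ⟨min y (x + δ), ?_, lt_min hxy (by linarith), min_le_left _ _⟩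
  have h := hlin (min y (x + δ)) ⟨le_min hxy.le (by linarith), min_le_right _ _⟩
  change ζ _ = _
  rw [h, show ζ x = _ from hxE, add_assoc, ← add_smul]
  congr 2
  ring

/-- Once the support is absorbing, it remains so and can only shrink. -/
lemma suppF_subset_of_absorbing (hr : Escaping r) {ζ : ℝ → V → ℝ} (hζ : IsPath ζ)
    (hA : CondA r ζ) {t : ℝ} : ∀ {s : ℝ}, 0 ≤ s → s ≤ t →
      (∀ j, occupation r (suppF (ζ s)) j ≤ 1) →
      suppF (ζ t) ⊆ suppF (ζ s) ∧ ∀ j, occupation r (suppF (ζ t)) j ≤ 1 := by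
  suffices H : ∀ S : Finset V, ∀ s, suppF (ζ s) = S → 0 ≤ s → s ≤ t →
      (∀ j, occupation r S j ≤ 1) → suppF (ζ t) ⊆ S ∧ ∀ j, occupation r (suppF (ζ t)) j ≤ 1 from
    fun {s} hs hst h => H _ s rfl hs hst h
  intro S
  induction S using Finset.strongInduction with
  | H S ih =>
  intro s hsupp hs hst hS1
  have hS : S.Nonempty := hsupp ▸ suppF_nonempty (hζ.2 s hs)
  have hoff : ∀ j ∉ S, ζ s j = 0 := fun j hj =>
    eq_zero_of_notMem_suppF (hζ.2 s hs) (hsupp ▸ hj)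
  have hpos : ∀ j ∈ S, 0 < ζ s j := fun j hj => mem_suppF.1 (hsupp ▸ hj)
  have hlin_off : ∀ x, ζ x = ζ s + (x - s) • flux r (occupation r S) → ∀ j ∉ S, ζ x j = 0 :=
    fun x hx j hj => by rw [hx]; simp [hoff j hj, flux_occupation hr hS hj]
  set Z := {x ∈ Set.Icc s t | ∃ i ∈ S, ζ x i = 0} with hZ
  have hZc : IsCompact Z := by
    have hcl : ∀ i, IsClosed (Set.Icc s t ∩ (fun x => ζ x i) ⁻¹' {0}) := fun i =>
      ContinuousOn.preimage_isClosed_of_isClosed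
        ((continuous_apply i).comp_continuousOn (hζ.1.mono fun x hx => hs.trans hx.1))
        isClosed_Icc isClosed_singleton
    have : Z = ⋃ i ∈ S, (Set.Icc s t ∩ (fun x => ζ x i) ⁻¹' {0}) := by
      ext x; simp [hZ]
    rw [this]
    exact S.finite_toSet.isCompact_biUnion fun i _ =>
      isCompact_Icc.of_isClosed_subset (hcl i) Set.inter_subset_left
  by_cases hne : Z.Nonempty
  · obtain ⟨τ, ⟨⟨hτ1, hτ2⟩, i, hi, hi0⟩, hleast⟩ := hZc.exists_isLeast hne
    have hpos' : ∀ x ∈ Set.Ico s τ, ∀ j ∈ S, 0 < ζ x j := fun x hx j hj =>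
      ((hζ.2 x (hs.trans hx.1)).1 j).lt_of_ne fun h =>
        absurd (hleast ⟨⟨hx.1, hx.2.le.trans hτ2⟩, j, hj, h.symm⟩) (not_le.2 hx.2)
    have hlin := linear_of_pos hr hS hS1 hζ hA hs hoff hpos' τ ⟨hτ1, le_rfl⟩
    have hτ0 := hs.trans hτ1
    have hCS : suppF (ζ τ) ⊆ S := fun j hj => by
      by_contra hjS
      exact (mem_suppF.1 hj).ne' (hlin_off τ hlin j hjS)
    have hss : suppF (ζ τ) ⊂ S := Finset.ssubset_iff_subset_ne.2 ⟨hCS, fun h =>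
      (mem_suppF.1 (h.symm ▸ hi : i ∈ suppF (ζ τ))).ne' hi0⟩
    have hC1 := occupation_le_one_of_subset hr (suppF_nonempty (hζ.2 τ hτ0)) hCS hS1
      fun j hj hjC => by
        have h0 := eq_zero_of_notMem_suppF (hζ.2 τ hτ0) hjC
        rw [hlin] at h0
        simp only [Pi.add_apply, Pi.smul_apply, smul_eq_mul] at h0
        have := hpos j hj
        by_contra! hlt
        have := mul_nonneg (sub_nonneg.2 hτ1) hlt.le
        linarith
    obtain ⟨h1, h2⟩ := ih _ hss τ rfl hτ0 hτ2 hC1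
    exact ⟨h1.trans hCS, h2⟩
  · have hpos' : ∀ x ∈ Set.Icc s t, ∀ j ∈ S, 0 < ζ x j := fun x hx j hj =>
      ((hζ.2 x (hs.trans hx.1)).1 j).lt_of_ne fun h => hne ⟨x, hx, j, hj, h.symm⟩
    have hlin := linear_of_pos hr hS hS1 hζ hA hs hoff
      (fun x hx => hpos' x ⟨hx.1, hx.2.le⟩) t ⟨hst, le_rfl⟩
    have : suppF (ζ t) = S := by
      ext j
      rw [mem_suppF]
      refine ⟨fun h => ?_, hpos' t ⟨hst, le_rfl⟩ j⟩
      by_contra hj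
      exact h.ne' (hlin_off t hlin j hj)
    rw [this]
    exact ⟨subset_rfl, hS1⟩

/-- A path satisfying (A) and (B) started on an absorbing face stays on that face. -/
lemma suppF_subset_of_condB (hr : Escaping r) {ind : Finset V → V → V → ℝ}
    (hind : IsHarmFamily r ind) (hA : A.Nonempty) (hA1 : ∀ j, occupation r A j ≤ 1)
    {ζ : ℝ → V → ℝ} (hζ : IsPath ζ) (h0 : ∀ j ∉ A, ζ 0 j = 0) (hCA : CondA r ζ)
    (hCB : CondB r ind ζ) {t : ℝ} (ht : 0 < t) : suppF (ζ t) ⊆ A := by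
  have habs : ∀ t, 0 < t → ∀ j, occupation r (suppF (ζ t)) j ≤ 1 := by
    intro t ht
    obtain ⟨s, hs, hst, hs_mem, hsabs⟩ := hCB t ht
    exact (suppF_subset_of_absorbing hr hζ hCA hs hst.le
      ((isAbsorbing_iff hr hind (suppF_nonempty hs_mem)).1 hsabs)).2
  have hanti : ∀ s t, 0 < s → s ≤ t → suppF (ζ t) ⊆ suppF (ζ s) := fun s t hs hst =>
    (suppF_subset_of_absorbing hr hζ hCA hs.le hst (habs s hs)).1
  obtain ⟨t₀, ht₀, hconst⟩ : ∃ t₀ > 0, ∀ x, 0 < x → x ≤ t₀ → suppF (ζ x) = suppF (ζ t₀) := by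
    obtain ⟨S, ⟨t₀, ht₀, hSt⟩, hmax⟩ := WellFounded.has_min (wellFounded_gt (α := Finset V))
      {S | ∃ t > 0, suppF (ζ t) = S} ⟨_, 1, one_pos, rfl⟩
    refine ⟨t₀, ht₀, fun x hx hxt => ?_⟩
    by_contra hne
    refine hmax _ ⟨x, hx, rfl⟩ ?_
    rw [← hSt]
    exact lt_of_le_of_ne (hanti x t₀ hx hxt) (Ne.symm hne)
  set S := suppF (ζ t₀) with hSdef
  have hS : S.Nonempty := suppF_nonempty (hζ.2 t₀ ht₀.le)
  have hoff : ∀ x, 0 < x → x ≤ t₀ → ∀ j ∉ S, ζ x j = 0 := fun x hx hxt j hj =>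
    eq_zero_of_notMem_suppF (hζ.2 x hx.le) (by rwa [hconst x hx hxt])
  have hpos : ∀ x, 0 < x → x ≤ t₀ → ∀ j ∈ S, 0 < ζ x j := fun x hx hxt j hj =>
    mem_suppF.1 (by rwa [hconst x hx hxt])
  have hlin : ∀ s ∈ Set.Ioc 0 t₀, ζ t₀ - (t₀ - s) • flux r (occupation r S) = ζ s := by
    intro s hs
    rw [linear_of_pos hr hS (habs t₀ ht₀) hζ hCA hs.1.le (hoff s hs.1 hs.2)
      (fun x hx => hpos x (hs.1.trans_le hx.1) hx.2.le) t₀ ⟨hs.2, le_rfl⟩, add_sub_cancel_right]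
  have hlim : ζ t₀ - (t₀ - 0) • flux r (occupation r S) = ζ 0 := by
    have hcl : Filter.Tendsto ζ (nhdsWithin 0 (Set.Ioc 0 t₀)) (nhds (ζ 0)) :=
      (hζ.1 0 Set.self_mem_Ici).mono_left
        (nhdsWithin_mono _ fun x hx => hx.1.le)
    have hcr : Filter.Tendsto (fun s : ℝ => ζ t₀ - (t₀ - s) • flux r (occupation r S))
        (nhdsWithin 0 (Set.Ioc 0 t₀)) (nhds (ζ t₀ - (t₀ - 0) • flux r (occupation r S))) :=
      (Continuous.tendsto (by fun_prop) 0).mono_left nhdsWithin_le_nhds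
    have : (nhdsWithin (0 : ℝ) (Set.Ioc 0 t₀)).NeBot := by
      rw [nhdsWithin_Ioc_eq_nhdsGT ht₀]; infer_instance
    exact tendsto_nhds_unique hcr
      (hcl.congr' (eventually_nhdsWithin_of_forall fun s hs => (hlin s hs).symm))
  have hSA : S ⊆ A := subset_of_flux_pos hr hA hS hA1 (fun j hj hjA => by
    have h := congrFun hlim j
    simp only [Pi.sub_apply, Pi.smul_apply, smul_eq_mul, h0 j hjA, sub_zero] at h
    have := hpos t₀ ht₀ le_rfl j hj
    exact pos_of_mul_pos_right (b := flux r (occupation r S) j) (by linarith) ht₀.le)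
    (habs t₀ ht₀)
  rcases le_total t t₀ with h | h
  · rwa [hconst t ht h]
  · exact (hanti t₀ t ht₀ h).trans hSA

/-! ### Construction of paths -/

/-- At points supported on `B`, test functions do not distinguish `λ` from the flux
of the occupation rates of `B`. -/
lemma memD_fderiv_flux_occupation (hr : Escaping r) {f : (V → ℝ) → ℝ} (hf : MemD r univ f)
    {u : V → ℝ} (hu : u ∈ stdSimplex ℝ V) (huB : ∀ j ∉ B, u j = 0) :
    fderiv ℝ f u (flux r (occupation r B)) = fderiv ℝ f u (lamV r) := by
  have : flux r (occupation r B) = lamV r + flux r (occupation r B - 1) := by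
    rw [lamV_eq_flux, map_sub, add_sub_cancel]
  rw [this, map_add, flux_eq_sum_vvec, map_sum, add_eq_left]
  refine sum_eq_zero fun i _ => ?_
  rw [map_smul]
  by_cases hi : i ∈ B
  · simp [occupation_of_mem hr hi]
  · rw [hf.2 i (mem_univ i) u hu (huB i hi), smul_zero]

/-- Prolongs a path backwards by a linear segment along the face of `B`. -/
lemma exists_path_prepend (hr : Escaping r) (hB : B.Nonempty) {u : V → ℝ}
    (hu : u ∈ stdSimplex ℝ V) (huB : ∀ j ∉ B, u j = 0) {δ : ℝ} (hδ : 0 < δ)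
    {η : ℝ → V → ℝ} (hη : IsPath η) (hηA : CondA r η)
    (hη0 : η 0 = u + δ • flux r (occupation r B)) :
    ∃ ζ, IsPath ζ ∧ CondA r ζ ∧
      ∀ t ∈ Set.Icc 0 δ, ζ t = u + t • flux r (occupation r B) := by
  set c := flux r (occupation r B) with hc
  set ζ : ℝ → V → ℝ := fun t => (u + min t δ • c) + (η (max (t - δ) 0) - η 0) with hζdef
  have hleft : ∀ t ∈ Set.Icc 0 δ, ζ t = u + t • c := fun t ht => by
    simp only [hζdef]
    rw [min_eq_left ht.2, max_eq_right (by linarith [ht.2]), sub_self, add_zero]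
  have hright : ∀ t, δ ≤ t → ζ t = η (t - δ) := fun t ht => by
    simp only [hζdef]
    rw [min_eq_right ht, max_eq_left (by linarith), hη0, add_sub_cancel]
  have hseg : ∀ t ∈ Set.Icc 0 δ, u + t • c ∈ stdSimplex ℝ V := fun t ht => by
    have hend : u + δ • c ∈ stdSimplex ℝ V := hη0 ▸ hη.2 0 le_rfl
    have hδ' := hδ.ne'
    have := (convex_stdSimplex ℝ V) hu hend (a := 1 - t / δ) (b := t / δ)
      (sub_nonneg.2 ((div_le_one hδ).2 ht.2)) (div_nonneg ht.1 hδ.le) (by ring)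
    convert this using 1
    ext j
    simp only [Pi.add_apply, Pi.smul_apply, smul_eq_mul]
    field_simp
    ring
  have hpath : IsPath ζ := by
    constructor
    · refine ContinuousOn.add (by fun_prop) (ContinuousOn.sub ?_ continuousOn_const)
      exact hη.1.comp (by fun_prop) fun t _ => Set.mem_Ici.2 (le_max_right _ _)
    · intro t ht
      rcases le_total t δ with h | h
      · rw [hleft t ⟨ht, h⟩]; exact hseg t ⟨ht, h⟩
      · rw [hright t h]; exact hη.2 _ (sub_nonneg.2 h)
  refine ⟨ζ, hpath, fun f hf t ht => ?_, hleft⟩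
  have hfirst : ∀ t ∈ Set.Icc 0 δ,
      f (ζ t) = f (ζ 0) + ∫ s in (0 : ℝ)..t, fderiv ℝ f (ζ s) (lamV r) := by
    intro t ht
    have hsub : ∀ x ∈ Set.uIcc 0 t, x ∈ Set.Icc 0 δ := fun x hx => by
      rw [Set.uIcc_of_le ht.1] at hx
      exact ⟨hx.1, hx.2.trans ht.2⟩
    obtain ⟨U, hU, hU_sub, hfU⟩ := hf.1
    have hder : ∀ x ∈ Set.uIcc 0 t,
        HasDerivAt (fun y : ℝ => f (u + y • c)) (fderiv ℝ f (ζ x) (lamV r)) x := by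
      intro x hx
      have hx' := hsub x hx
      have hx_mem := hseg x hx'
      have hd : HasFDerivAt f (fderiv ℝ f (u + x • c)) (u + x • c) :=
        ((hfU.differentiableOn one_ne_zero).differentiableAt
          (hU.mem_nhds (hU_sub hx_mem))).hasFDerivAt
      have hl : HasDerivAt (fun y : ℝ => u + y • c) c x := by
        simpa using ((hasDerivAt_id x).smul_const c).const_add u
      have := hd.comp_hasDerivAt x hl
      rw [hleft x hx', ← memD_fderiv_flux_occupation (B := B) hr hf hx_mem]
      · exact this
      · intro j hj
        simp [huB j hj, hc, flux_occupation hr hB hj]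
    have := intervalIntegral.integral_eq_sub_of_hasDerivAt hder
      (intervalIntegrable_fderiv_path hpath hf _ le_rfl ht.1)
    rw [this, hleft t ht, hleft 0 ⟨le_rfl, hδ.le⟩]
    ring
  rcases le_total t δ with h | h
  · exact hfirst t ⟨ht, h⟩
  · have hsecond : ∫ s in δ..t, fderiv ℝ f (ζ s) (lamV r) = f (ζ t) - f (ζ δ) := by
      have h1 : ∫ s in δ..t, fderiv ℝ f (ζ s) (lamV r) =
          ∫ s in δ..t, fderiv ℝ f (η (s - δ)) (lamV r) := by
        refine intervalIntegral.integral_congr fun x hx => ?_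
        rw [Set.uIcc_of_le h] at hx
        simp only [hright x hx.1]
      rw [h1, intervalIntegral.integral_comp_sub_right
        (fun s => fderiv ℝ f (η s) (lamV r)), sub_self, hright t h, hright δ le_rfl, sub_self,
        hηA f hf (t - δ) (sub_nonneg.2 h)]
      ring
    rw [← intervalIntegral.integral_add_adjacent_intervals
      (intervalIntegrable_fderiv_path hpath hf _ le_rfl hδ.le)
      (intervalIntegrable_fderiv_path hpath hf _ hδ.le ht), hsecond]
    have := hfirst δ ⟨hδ.le, le_rfl⟩
    linarith

/-- Every point of the simplex is the starting point of a path satisfying (A). -/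
lemma exists_path (hr : Escaping r) {u : V → ℝ} (hu : u ∈ stdSimplex ℝ V) :
    ∃ ζ, IsPath ζ ∧ CondA r ζ ∧ ζ 0 = u := by
  suffices H : ∀ S : Finset V, ∀ u ∈ stdSimplex ℝ V, suppF u = S →
      ∃ ζ, IsPath ζ ∧ CondA r ζ ∧ ζ 0 = u from H _ u hu rfl
  intro S
  induction S using Finset.strongInduction with
  | H S ih =>
  intro u hu hsupp
  have hS : S.Nonempty := hsupp ▸ suppF_nonempty hu
  have hoff : ∀ j ∉ S, u j = 0 := fun j hj => eq_zero_of_notMem_suppF hu (hsupp ▸ hj)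
  have hpos : ∀ j ∈ S, 0 < u j := fun j hj => mem_suppF.1 (hsupp ▸ hj)
  set c := flux r (occupation r S) with hc
  have hcoff : ∀ j ∉ S, c j = 0 := fun j hj => flux_occupation hr hS hj
  set N := univ.filter fun i => c i < 0 with hN
  have memN : ∀ i, i ∈ N ↔ c i < 0 := fun i => by simp [hN]
  have hNS : ∀ i ∈ N, i ∈ S := fun i hi => by
    by_contra h
    exact ((memN i).1 hi).ne (hcoff i h)
  by_cases hNe : N.Nonempty
  · obtain ⟨i, hi, hmin⟩ := exists_min_image N (fun i => u i / -c i) hNe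
    have hci : 0 < -c i := neg_pos.2 ((memN i).1 hi)
    set τ := u i / -c i with hτ
    have hτpos : 0 < τ := div_pos (hpos i (hNS i hi)) hci
    have hw_mem : u + τ • c ∈ stdSimplex ℝ V := by
      refine ⟨fun j => ?_, sum_add_smul_flux hu.2 τ _⟩
      simp only [Pi.add_apply, Pi.smul_apply, smul_eq_mul]
      by_cases hj : j ∈ N
      · have hcj : 0 < -c j := neg_pos.2 ((memN j).1 hj)
        have := (le_div_iff₀ hcj).1 (hmin j hj)
        linarith
      · have := mul_nonneg hτpos.le (not_lt.1 (mt (memN j).2 hj))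
        linarith [hu.1 j]
    have hwi : (u + τ • c) i = 0 := by
      have : τ * -c i = u i := div_mul_cancel₀ _ hci.ne'
      simp only [Pi.add_apply, Pi.smul_apply, smul_eq_mul]
      linarith
    have hss : suppF (u + τ • c) ⊂ S := by
      refine Finset.ssubset_iff_subset_ne.2 ⟨fun j hj => ?_, fun h => ?_⟩
      · by_contra hjS
        refine (mem_suppF.1 hj).ne' ?_
        simp [hoff j hjS, hcoff j hjS]
      · exact (mem_suppF.1 (h.symm ▸ hNS i hi : i ∈ suppF (u + τ • c))).ne' hwi
    obtain ⟨η, hη, hηA, hη0⟩ := ih _ hss _ hw_mem rfl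
    obtain ⟨ζ, hζ, hζA, hlin⟩ := exists_path_prepend hr hS hu hoff hτpos hη hηA hη0
    exact ⟨ζ, hζ, hζA, by rw [hlin 0 ⟨le_rfl, hτpos.le⟩, zero_smul, add_zero]⟩
  · have hc0 : c = 0 := by
      have hnn : ∀ i, 0 ≤ c i := fun i => not_lt.1 fun h => hNe ⟨i, (memN i).2 h⟩
      ext i
      exact (sum_eq_zero_iff_of_nonneg fun i _ => hnn i).1 (sum_flux _) i (mem_univ i)
    refine ⟨fun _ => u, ⟨continuousOn_const, fun _ _ => hu⟩, fun f hf t _ => ?_, rfl⟩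
    have := memD_fderiv_flux_occupation (B := S) hr hf hu hoff
    simp only [← this, ← hc, hc0, map_zero, intervalIntegral.integral_zero, add_zero]

/-- From a set which is not absorbing one can leave its face along a path satisfying
(A) and (B). -/
lemma exists_path_leaving (hr : Escaping r) {ind : Finset V → V → V → ℝ}
    (hind : IsHarmFamily r ind) (hA : A.Nonempty) (hnot : ¬ IsAbsorbing r ind A) :
    ∃ ζ, IsPath ζ ∧ CondA r ζ ∧ CondB r ind ζ ∧ ∑ j ∈ A, ζ 0 j = 1 ∧
      ∃ t > 0, ∑ j ∈ A, ζ t j ≠ 1 := by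
  obtain ⟨B, hAB, hB1, hgrow⟩ := exists_absorbing_superset hr hA
  have hB : B.Nonempty := hA.mono hAB
  obtain ⟨k, hkB, hkA⟩ : ∃ k ∈ B, k ∉ A := by
    by_contra! h
    obtain rfl : A = B := hAB.antisymm h
    exact hnot ((isAbsorbing_iff hr hind hA).2 hB1)
  have hcard : (0 : ℝ) < A.card := by exact_mod_cast hA.card_pos
  set u : V → ℝ := fun i => if i ∈ A then (A.card : ℝ)⁻¹ else 0 with hu
  have huA : ∑ j ∈ A, u j = 1 := by
    rw [sum_congr rfl fun j hj => if_pos hj, sum_const, nsmul_eq_mul, mul_inv_cancel₀ hcard.ne']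
  have hu_mem : u ∈ stdSimplex ℝ V := by
    refine ⟨fun i => ?_, ?_⟩
    · simp only [hu]; split_ifs <;> positivity
    · rw [← huA]
      exact (sum_subset (subset_univ A) fun j _ hj => if_neg hj).symm
  have huB : ∀ j ∉ B, u j = 0 := fun j hj => if_neg fun h => hj (hAB h)
  set c := flux r (occupation r B) with hc
  obtain ⟨δ, hδ, hpos⟩ : ∃ δ : ℝ, 0 < δ ∧ ∀ t, 0 < t → t ≤ δ → ∀ j ∈ B, 0 < (u + t • c) j := by
    have hev : ∀ᶠ t : ℝ in nhdsWithin 0 (Set.Ioi 0), ∀ j ∈ B, 0 < (u + t • c) j := by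
      refine (Finset.eventually_all B).2 fun j hj => ?_
      by_cases hjA : j ∈ A
      · have hcont : Continuous fun t : ℝ => (u + t • c) j := by
          simp only [Pi.add_apply, Pi.smul_apply]; fun_prop
        refine (hcont.tendsto 0).mono_left nhdsWithin_le_nhds |>.eventually_const_lt ?_
        simp [hu, hjA, hcard]
      · filter_upwards [self_mem_nhdsWithin] with t ht
        simpa [hu, hjA] using mul_pos ht (hgrow j hj hjA)
    obtain ⟨δ, hδ, hsub⟩ := mem_nhdsGT_iff_exists_Ioc_subset.1 hev
    exact ⟨δ, hδ, fun t h0 h1 => hsub ⟨h0, h1⟩⟩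
  have hoff : ∀ t : ℝ, ∀ j ∉ B, (u + t • c) j = 0 := fun t j hj => by
    simp [huB j hj, hc, flux_occupation hr hB hj]
  have hw_mem : ∀ t, 0 < t → t ≤ δ → u + t • c ∈ stdSimplex ℝ V := fun t h0 h1 => by
    refine ⟨fun j => ?_, sum_add_smul_flux hu_mem.2 t _⟩
    by_cases hj : j ∈ B
    · exact (hpos t h0 h1 j hj).le
    · exact (hoff t j hj).ge
  obtain ⟨η, hη, hηA, hη0⟩ := exists_path hr (hw_mem δ hδ le_rfl)
  obtain ⟨ζ, hζ, hζA, hlin⟩ := exists_path_prepend hr hB hu_mem huB hδ hη hηA hη0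
  refine ⟨ζ, hζ, hζA, fun ε hε => ?_, ?_, δ, hδ, ?_⟩
  · have ht : 0 < min (ε / 2) δ := lt_min (by linarith) hδ
    refine ⟨min (ε / 2) δ, ht.le, (min_le_left _ _).trans_lt (by linarith), ?_⟩
    rw [hlin _ ⟨ht.le, min_le_right _ _⟩]
    refine ⟨hw_mem _ ht (min_le_right _ _), ?_⟩
    have hs : suppF (u + min (ε / 2) δ • c) = B := by
      ext j
      rw [mem_suppF]
      refine ⟨fun h => ?_, hpos _ ht (min_le_right _ _) j⟩
      by_contra hj
      exact h.ne' (hoff _ j hj)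
    rw [hs]
    exact (isAbsorbing_iff hr hind hB).2 hB1
  · rw [hlin 0 ⟨le_rfl, hδ.le⟩, zero_smul, add_zero, huA]
  · rw [hlin δ ⟨hδ.le, le_rfl⟩]
    have hw := hw_mem δ hδ le_rfl
    refine ne_of_lt ?_
    rw [← hw.2]
    exact sum_lt_sum_of_subset (subset_univ A) (mem_univ k) hkA (hpos δ hδ le_rfl k hkB)
      fun j _ _ => hw.1 j


end ZeroRange

/-- a nonempty `A ⊆ V` is `r`-absorbing iff the face `∂_AΣ` is invariant for
every solution of the `(λ, D_V)`-problem started in it. -/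
theorem absorbing_iff_face_invariant (V : Type*) [Fintype V] [DecidableEq V] [Nonempty V]
    (r : V → V → ℝ) (hr_nonneg : ∀ i j, 0 ≤ r i j) (hr_diag : ∀ i, r i i = 0)
    (hr_irr : IrreducibleRates r)
    (ind : Finset V → V → V → ℝ) (hind : IsHarmFamily r ind)
    (A : Finset V) (hA : A.Nonempty) :
    IsAbsorbing r ind A ↔
      (∀ u ∈ stdSimplex ℝ V, ∑ j ∈ A, u j = 1 →
        ∀ ζ : ℝ → V → ℝ, IsPath ζ → ζ 0 = u → CondA r ζ → CondB r ind ζ →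
          ∀ t : ℝ, 0 ≤ t → ∑ j ∈ A, ζ t j = 1) := by
  have hr := ZeroRange.Escaping.of_irreducible hr_nonneg hr_irr
  constructor
  · intro habs u hu huA ζ hζ hζ0 hCA hCB t ht
    have hA1 := (ZeroRange.isAbsorbing_iff hr hind hA).1 habs
    have h0 : ∀ j ∉ A, ζ 0 j = 0 := by
      intro j hj
      rw [hζ0]
      have hsplit := Finset.sum_add_sum_compl A u
      rw [huA, hu.2, add_eq_left] at hsplit
      exact (Finset.sum_eq_zero_iff_of_nonneg fun i _ => hu.1 i).1 hsplit j
        (Finset.mem_compl.2 hj)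
    have hoff : ∀ j ∉ A, ζ t j = 0 := by
      intro j hj
      rcases ht.eq_or_lt with rfl | htpos
      · exact h0 j hj
      · exact ZeroRange.eq_zero_of_notMem_suppF (hζ.2 t ht) fun h =>
          hj (ZeroRange.suppF_subset_of_condB hr hind hA hA1 hζ h0 hCA hCB htpos h)
    rw [← (hζ.2 t ht).2]
    exact Finset.sum_subset (Finset.subset_univ A) fun j _ hj => hoff j hj
  · intro hinv
    by_contra hnot
    obtain ⟨ζ, hζ, hCA, hCB, hζ0, t, ht, hne⟩ :=
      ZeroRange.exists_path_leaving hr hind hA hnot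
    exact hne (hinv _ (hζ.2 0 le_rfl) hζ0 ζ hζ rfl hCA hCB t ht.le)
end
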